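/- A positive proportion of the nontrivial zeros of the Riemann zeta function lie on the critical line: there exists a constant κ > 0 and T₀ such that for all T ≥ T₀, N₀(T) ≥ κ · N(T), where N(T) is the number of zeros ρ of ζ with 0 < Re ρ < 1 and 0 < Im ρ ≤ T, and N₀(T) is the number of such zeros with Re ρ = 1/2. -/

import Mathlib

/-- `zetaZeros T` is the number of zeros `ρ` of the Riemann zeta function with
`0 < Re ρ < 1` and `0 < Im ρ ≤ T`. -/
noncomputable def zetaZeros (T : ℝ) : ℕ :=
  {ρ : ℂ | riemannZeta ρ = 0 ∧ 0 < ρ.re ∧ ρ.re < 1 ∧ 0 < ρ.im ∧ ρ.im ≤ T}.ncard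

/-- `zetaZerosOnLine T` is the number of zeros `ρ` of the Riemann zeta function with
`Re ρ = 1/2` and `0 < Im ρ ≤ T`. -/
noncomputable def zetaZerosOnLine (T : ℝ) : ℕ :=
  {ρ : ℂ | riemannZeta ρ = 0 ∧ ρ.re = 1 / 2 ∧ 0 < ρ.im ∧ ρ.im ≤ T}.ncard

namespace Selberg

open ArithmeticFunction Finset

section Multiplicative

theorem nonneg_of_isMultiplicative {g : ArithmeticFunction ℝ} (hg : g.IsMultiplicative)
    (h : ∀ p k : ℕ, p.Prime → 0 ≤ g (p ^ k)) (n : ℕ) : 0 ≤ g n := by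
  rcases eq_or_ne n 0 with rfl | hn
  · simp
  rw [hg.multiplicative_factorization g hn]
  exact Finset.prod_nonneg fun p hp => h _ _ (Nat.prime_of_mem_primeFactors hp)

theorem le_one_of_isMultiplicative {g : ArithmeticFunction ℝ} (hg : g.IsMultiplicative)
    (h0 : ∀ p k : ℕ, p.Prime → 0 ≤ g (p ^ k)) (h1 : ∀ p k : ℕ, p.Prime → g (p ^ k) ≤ 1)
    (n : ℕ) : g n ≤ 1 := by
  rcases eq_or_ne n 0 with rfl | hn
  · simp
  rw [hg.multiplicative_factorization g hn]
  exact Finset.prod_le_one (fun p hp => h0 _ _ (Nat.prime_of_mem_primeFactors hp))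
    fun p hp => h1 _ _ (Nat.prime_of_mem_primeFactors hp)

/-- The arithmetic function `n ↦ n ^ s` for real `s`. -/
noncomputable def powR (s : ℝ) : ArithmeticFunction ℝ :=
  ⟨fun n => if n = 0 then 0 else (n : ℝ) ^ s, by simp⟩

theorem powR_apply (s : ℝ) {n : ℕ} (hn : n ≠ 0) : powR s n = (n : ℝ) ^ s := by
  simp [powR, hn]

theorem powR_isMultiplicative (s : ℝ) : (powR s).IsMultiplicative := by
  rw [IsMultiplicative.iff_ne_zero]
  refine ⟨by simp [powR], fun {m n} hm hn _ => ?_⟩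
  rw [powR_apply s hm, powR_apply s hn, powR_apply s (mul_ne_zero hm hn), Nat.cast_mul,
    Real.mul_rpow (by positivity) (by positivity)]

/-- The Möbius inverse of `n ↦ n ^ s`. -/
noncomputable def jordan (s : ℝ) : ArithmeticFunction ℝ := (moebius : ArithmeticFunction ℝ) * powR s

theorem jordan_isMultiplicative (s : ℝ) : (jordan s).IsMultiplicative :=
  isMultiplicative_moebius.intCast.mul (powR_isMultiplicative s)

theorem sum_jordan (s : ℝ) {n : ℕ} (hn : n ≠ 0) :
    ∑ d ∈ n.divisors, jordan s d = (n : ℝ) ^ s := by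
  rw [← coe_zeta_mul_apply, jordan, ← mul_assoc, coe_zeta_mul_coe_moebius, one_mul,
    powR_apply s hn]

theorem jordan_prime_pow (s : ℝ) {p : ℕ} (hp : p.Prime) (k : ℕ) :
    jordan s (p ^ (k + 1)) = ((p ^ (k + 1) : ℕ) : ℝ) ^ s - ((p ^ k : ℕ) : ℝ) ^ s := by
  rw [← sum_jordan s (pow_ne_zero _ hp.ne_zero), ← sum_jordan s (pow_ne_zero _ hp.ne_zero),
    Nat.sum_divisors_prime_pow hp, Nat.sum_divisors_prime_pow hp, Finset.sum_range_succ]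
  ring

theorem jordan_one (s : ℝ) : jordan s 1 = 1 := (jordan_isMultiplicative s).map_one

theorem jordan_nonneg {s : ℝ} (hs : 0 ≤ s) (n : ℕ) : 0 ≤ jordan s n := by
  refine nonneg_of_isMultiplicative (jordan_isMultiplicative s) (fun p k hp => ?_) n
  cases k with
  | zero => simp [jordan_one]
  | succ k =>
    rw [jordan_prime_pow s hp, sub_nonneg]
    refine Real.rpow_le_rpow (by positivity) ?_ hs
    exact_mod_cast Nat.pow_le_pow_right hp.pos (Nat.le_succ k)

theorem jordan_le {s : ℝ} (hs : 0 ≤ s) {n : ℕ} (hn : n ≠ 0) : jordan s n ≤ (n : ℝ) ^ s := by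
  rw [← sum_jordan s hn]
  exact Finset.single_le_sum (f := fun d => jordan s d) (fun d _ => jordan_nonneg hs d)
    (Nat.mem_divisors_self n hn)

/-- `μ²(n) 2^{-ω(n)}`. -/
noncomputable def halfPow : ArithmeticFunction ℝ :=
  ⟨fun n => if Squarefree n then (1 / 2 : ℝ) ^ n.primeFactors.card else 0, by simp⟩

theorem halfPow_apply (n : ℕ) :
    halfPow n = if Squarefree n then (1 / 2 : ℝ) ^ n.primeFactors.card else 0 := rfl

theorem halfPow_nonneg (n : ℕ) : 0 ≤ halfPow n := by
  rw [halfPow_apply]; split_ifs <;> positivity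

theorem halfPow_le_one (n : ℕ) : halfPow n ≤ 1 := by
  rw [halfPow_apply]; split_ifs
  · exact pow_le_one₀ (by norm_num) (by norm_num)
  · norm_num

theorem halfPow_isMultiplicative : halfPow.IsMultiplicative := by
  rw [IsMultiplicative.iff_ne_zero]
  refine ⟨by simp [halfPow_apply], fun {m n} hm hn hc => ?_⟩
  simp only [halfPow_apply, Nat.squarefree_mul hc, hc.primeFactors_mul,
    Finset.card_union_of_disjoint hc.disjoint_primeFactors]
  by_cases h1 : Squarefree m <;> by_cases h2 : Squarefree n <;> simp [h1, h2, pow_add]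

theorem halfPow_mul_le (d e : ℕ) : halfPow (d * e) ≤ halfPow d * halfPow e := by
  by_cases h : Squarefree (d * e)
  · rw [halfPow_isMultiplicative.map_mul_of_coprime (Nat.coprime_of_squarefree_mul h)]
  · rw [halfPow_apply, if_neg h]
    exact mul_nonneg (halfPow_nonneg d) (halfPow_nonneg e)

theorem halfPow_prime_pow {p : ℕ} (hp : p.Prime) (k : ℕ) :
    halfPow (p ^ k) = if k = 0 then 1 else if k = 1 then 1 / 2 else 0 := by
  rcases k with _ | _ | k
  · simp [halfPow_apply]
  · simp [halfPow_apply, hp.primeFactors, hp.prime.squarefree]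
  · have : ¬ Squarefree (p ^ (k + 2)) := by
      rw [Nat.squarefree_pow_iff hp.ne_one (by omega)]
      rintro ⟨_, h⟩; omega
    simp [halfPow_apply, this]

theorem halfPow_sq_prime_pow {p : ℕ} (hp : p.Prime) (k : ℕ) :
    (halfPow * halfPow) (p ^ k) =
      if k = 0 then 1 else if k = 1 then 1 else if k = 2 then 1 / 4 else 0 := by
  rw [ArithmeticFunction.mul_apply, Nat.sum_divisorsAntidiagonal (f := fun a b => halfPow a * halfPow b),
    Nat.sum_divisors_prime_pow hp]
  have : ∀ i ∈ Finset.range (k + 1), halfPow (p ^ i) * halfPow (p ^ k / p ^ i) =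
      halfPow (p ^ i) * halfPow (p ^ (k - i)) := by
    intro i hi
    rw [Nat.pow_div (by simp at hi; omega) hp.pos]
  rw [Finset.sum_congr rfl this]
  simp only [halfPow_prime_pow hp]
  rcases k with _ | _ | _ | k
  · simp
  · norm_num [Finset.sum_range_succ]
  · norm_num [Finset.sum_range_succ]
  · have h0 : k + 1 + 1 + 1 ≠ 0 := by omega
    have h1 : k + 1 + 1 + 1 ≠ 1 := by omega
    have h2 : k + 1 + 1 + 1 ≠ 2 := by omega
    simp only [h0, h1, h2, if_false]
    refine Finset.sum_eq_zero fun i hi => ?_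
    by_cases h : 2 ≤ i
    · rw [if_neg (by omega : i ≠ 0), if_neg (by omega : i ≠ 1), zero_mul]
    · rw [if_neg (by omega : k + 1 + 1 + 1 - i ≠ 0), if_neg (by omega : k + 1 + 1 + 1 - i ≠ 1),
        mul_zero]

theorem halfPow_sq_le_one (n : ℕ) : (halfPow * halfPow) n ≤ 1 := by
  refine le_one_of_isMultiplicative (halfPow_isMultiplicative.mul halfPow_isMultiplicative)
    (fun p k hp => ?_) (fun p k hp => ?_) n
  all_goals
    rw [halfPow_sq_prime_pow hp]
    split_ifs <;> norm_num

theorem halfPow_sq_of_squarefree {n : ℕ} (hn : Squarefree n) : (halfPow * halfPow) n = 1 := by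
  have hm : (halfPow * halfPow).IsMultiplicative :=
    halfPow_isMultiplicative.mul halfPow_isMultiplicative
  have h := hm.map_prod_of_subset_primeFactors n n.primeFactors subset_rfl
  rw [Nat.prod_primeFactors_of_squarefree hn] at h
  rw [h]
  refine Finset.prod_eq_one fun p hp => ?_
  have := halfPow_sq_prime_pow (Nat.prime_of_mem_primeFactors hp) 1
  simpa using this

/-- The sieve density `μ²(n) 2^{-ω(n)} / n`. -/
noncomputable def dens (n : ℕ) : ℝ := halfPow n / n

theorem dens_nonneg (n : ℕ) : 0 ≤ dens n := div_nonneg (halfPow_nonneg n) (by positivity)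

theorem dens_mul_le (d e : ℕ) : dens (d * e) ≤ dens d * dens e := by
  rw [dens, dens, dens, div_mul_div_comm, Nat.cast_mul]
  exact div_le_div_of_nonneg_right (halfPow_mul_le d e) (by positivity)

theorem dens_le (n : ℕ) : dens n ≤ 1 / n :=
  div_le_div_of_nonneg_right (halfPow_le_one n) (by positivity)

theorem dens_one : dens 1 = 1 := by simp [dens, halfPow_isMultiplicative.map_one]

theorem sum_dens_mul_dens (n : ℕ) :
    ∑ g ∈ n.divisors, dens g * dens (n / g) = (halfPow * halfPow) n / n := by
  rw [ArithmeticFunction.mul_apply, ← Nat.sum_divisorsAntidiagonal (f := fun a b => dens a * dens b),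
    Finset.sum_div]
  refine Finset.sum_congr rfl fun x hx => ?_
  rw [dens, dens, div_mul_div_comm, ← Nat.cast_mul, (Nat.mem_divisorsAntidiagonal.1 hx).1]

end Multiplicative

section Sums

theorem log_le_sum_inv {N : ℕ} (hN : 1 ≤ N) : Real.log N ≤ ∑ n ∈ Icc 1 N, (1 : ℝ) / n := by
  have h := log_add_one_le_harmonic N
  have h2 : (harmonic N : ℝ) = ∑ n ∈ Icc 1 N, (1 : ℝ) / n := by
    rw [harmonic_eq_sum_Icc]; push_cast; simp
  rw [← h2]
  refine le_trans (Real.log_le_log (by exact_mod_cast hN) (by simp)) h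

theorem sum_inv_le {N : ℕ} : ∑ n ∈ Icc 1 N, (1 : ℝ) / n ≤ 1 + Real.log N := by
  have h := harmonic_le_one_add_log N
  have h2 : (harmonic N : ℝ) = ∑ n ∈ Icc 1 N, (1 : ℝ) / n := by
    rw [harmonic_eq_sum_Icc]; push_cast; simp
  rwa [← h2]

theorem sum_inv_sq_le (N : ℕ) : ∑ n ∈ Icc 1 N, (1 : ℝ) / (n : ℝ) ^ 2 ≤ 2 := by
  suffices h : ∑ n ∈ Icc 1 N, (1 : ℝ) / (n : ℝ) ^ 2 ≤ 2 - 1 / N by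
    have : (0 : ℝ) ≤ 1 / N := by positivity
    linarith
  induction N with
  | zero => norm_num
  | succ k ih =>
    rw [Finset.sum_Icc_succ_top (by omega)]
    rcases Nat.eq_zero_or_pos k with rfl | hk
    · norm_num
    have hk' : (0 : ℝ) < k := by exact_mod_cast hk
    have h1 : (1 : ℝ) / ((k : ℝ) + 1) ^ 2 ≤ 1 / (k * (k + 1)) :=
      one_div_le_one_div_of_le (by positivity) (by nlinarith)
    have h2 : (1 : ℝ) / (k * (k + 1)) = 1 / k - 1 / (k + 1) := by field_simp; ring
    push_cast
    linarith

/-- The total sieve mass. -/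
noncomputable def mass (N : ℕ) : ℝ := ∑ n ∈ Icc 1 N, dens n

theorem one_le_mass {N : ℕ} (hN : 1 ≤ N) : 1 ≤ mass N := by
  rw [← dens_one]
  exact Finset.single_le_sum (f := dens) (fun n _ => dens_nonneg n) (by simp [hN])

theorem sum_divisorsAntidiagonal_le {f : ℕ × ℕ → ℝ} (hf : ∀ x, 0 ≤ f x) {N : ℕ} {S : Finset ℕ}
    (hS : S ⊆ Icc 1 N) :
    ∑ n ∈ S, ∑ x ∈ n.divisorsAntidiagonal, f x ≤ ∑ x ∈ Icc 1 N ×ˢ Icc 1 N, f x := by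
  rw [← Finset.sum_biUnion]
  · refine Finset.sum_le_sum_of_subset_of_nonneg ?_ fun x _ _ => hf x
    intro x hx
    obtain ⟨n, hn, hx⟩ := Finset.mem_biUnion.1 hx
    obtain ⟨h1, h0⟩ := Nat.mem_divisorsAntidiagonal.1 hx
    have hn' := Finset.mem_Icc.1 (hS hn)
    have h2 : x.1 ∣ n := ⟨_, h1.symm⟩
    have h3 : x.2 ∣ n := ⟨x.1, by rw [mul_comm]; exact h1.symm⟩
    simp only [Finset.mem_product, Finset.mem_Icc]
    exact ⟨⟨Nat.pos_of_dvd_of_pos h2 hn'.1, (Nat.le_of_dvd hn'.1 h2).trans hn'.2⟩,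
      Nat.pos_of_dvd_of_pos h3 hn'.1, (Nat.le_of_dvd hn'.1 h3).trans hn'.2⟩
  · intro a _ b _ hab
    refine Finset.disjoint_left.2 fun x hx hx' => hab ?_
    rw [← (Nat.mem_divisorsAntidiagonal.1 hx).1, ← (Nat.mem_divisorsAntidiagonal.1 hx').1]

theorem log_le_mass_sq {N : ℕ} (hN : 1 ≤ N) : Real.log N ≤ 2 * mass N ^ 2 := by
  set Q := (Icc 1 N).filter Squarefree with hQ
  have h1 : ∑ n ∈ Q, (1 : ℝ) / n ≤ mass N ^ 2 := by
    have e : ∀ n ∈ Q, (1 : ℝ) / n = ∑ x ∈ n.divisorsAntidiagonal, dens x.1 * dens x.2 := by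
      intro n hn
      rw [Nat.sum_divisorsAntidiagonal (f := fun a b => dens a * dens b), sum_dens_mul_dens,
        halfPow_sq_of_squarefree (Finset.mem_filter.1 hn).2]
    rw [Finset.sum_congr rfl e, sq, mass, Finset.sum_mul_sum, ← Finset.sum_product']
    exact sum_divisorsAntidiagonal_le (f := fun x => dens x.1 * dens x.2)
      (fun x => mul_nonneg (dens_nonneg _) (dens_nonneg _)) (Finset.filter_subset _ _)
  have h2 : ∑ n ∈ Icc 1 N, (1 : ℝ) / n ≤
      (∑ n ∈ Q, (1 : ℝ) / n) * ∑ n ∈ Icc 1 N, (1 : ℝ) / (n : ℝ) ^ 2 := by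
    choose a b hab hsq using Nat.sq_mul_squarefree
    have hinj : Set.InjOn (fun n => (a n, b n)) (Icc 1 N : Finset ℕ) := by
      intro m _ n _ h
      simp only [Prod.mk.injEq] at h
      rw [← hab m, ← hab n, h.1, h.2]
    rw [Finset.sum_mul_sum, ← Finset.sum_product']
    have e : ∀ n ∈ Icc 1 N, (1 : ℝ) / n =
        (fun x : ℕ × ℕ => (1 : ℝ) / x.1 * (1 / (x.2 : ℝ) ^ 2)) (a n, b n) := by
      intro n _
      have : (n : ℝ) = (b n : ℝ) ^ 2 * a n := by exact_mod_cast (hab n).symm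
      simp only
      rw [this, ← one_div_mul_one_div, mul_comm]
    rw [Finset.sum_congr rfl e,
      ← Finset.sum_image (f := fun x : ℕ × ℕ => (1 : ℝ) / x.1 * (1 / (x.2 : ℝ) ^ 2)) hinj]
    refine Finset.sum_le_sum_of_subset_of_nonneg ?_ fun x _ _ => by positivity
    intro x hx
    obtain ⟨n, hn, rfl⟩ := Finset.mem_image.1 hx
    obtain ⟨hn1, hn2⟩ := Finset.mem_Icc.1 hn
    have h2 : a n ∣ n := ⟨b n ^ 2, by rw [mul_comm]; exact (hab n).symm⟩
    have h3 : b n ∣ n := ⟨b n * a n, by rw [← mul_assoc, ← sq]; exact (hab n).symm⟩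
    simp only [Finset.mem_product, hQ, Finset.mem_filter, Finset.mem_Icc]
    exact ⟨⟨⟨Nat.pos_of_dvd_of_pos h2 hn1, (Nat.le_of_dvd hn1 h2).trans hn2⟩, hsq n⟩,
      Nat.pos_of_dvd_of_pos h3 hn1, (Nat.le_of_dvd hn1 h3).trans hn2⟩
  have h3 := sum_inv_sq_le N
  have h4 := log_le_sum_inv hN
  have h5 : 0 ≤ ∑ n ∈ Q, (1 : ℝ) / n := Finset.sum_nonneg fun _ _ => by positivity
  nlinarith

end Sums

end Selberg

namespace Selberg

open ArithmeticFunction Finset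

section Mollifier

/-- Selberg-type mollifier coefficients of length `N`. -/
noncomputable def moll (N ν : ℕ) : ℝ :=
  (∑ ρ ∈ Icc 1 N, if ν ∣ ρ then (moebius (ρ / ν) : ℝ) * moebius ρ * dens ρ else 0) / mass N

theorem abs_moebius_le_one_real (n : ℕ) : |(moebius n : ℝ)| ≤ 1 := by
  exact_mod_cast abs_moebius_le_one (n := n)

theorem moll_one {N : ℕ} (hN : 1 ≤ N) : moll N 1 = 1 := by
  have hB : mass N ≠ 0 := (zero_lt_one.trans_le (one_le_mass hN)).ne'
  rw [moll, div_eq_one_iff_eq hB, mass]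
  refine Finset.sum_congr rfl fun ρ _ => ?_
  simp only [one_dvd, if_true, Nat.div_one]
  by_cases h : Squarefree ρ
  · have : (moebius ρ : ℝ) * moebius ρ = 1 := by
      rw [moebius_apply_of_squarefree h]
      push_cast
      rw [← mul_pow]; norm_num
    rw [this, one_mul]
  · simp [dens, halfPow_apply, h]

theorem abs_moll_le_one {N : ℕ} (hN : 1 ≤ N) (ν : ℕ) : |moll N ν| ≤ 1 := by
  have hB : 0 < mass N := zero_lt_one.trans_le (one_le_mass hN)
  rw [moll, abs_div, abs_of_pos hB, div_le_one hB, mass]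
  refine (Finset.abs_sum_le_sum_abs _ _).trans (Finset.sum_le_sum fun ρ _ => ?_)
  split_ifs
  · rw [abs_mul, abs_mul, abs_of_nonneg (dens_nonneg ρ)]
    have := mul_le_one₀ (abs_moebius_le_one_real (ρ / ν)) (abs_nonneg _) (abs_moebius_le_one_real ρ)
    exact mul_le_of_le_one_left (dens_nonneg ρ) this
  · simpa using dens_nonneg ρ

/-- Sum of the mollifier coefficients over multiples of `d`. -/
noncomputable def mollDvd (N d : ℕ) : ℝ := ∑ ν ∈ Icc 1 N, if d ∣ ν then moll N ν else 0

theorem sum_moebius_div_between {d ρ : ℕ} (hρ : ρ ≠ 0) (hd : d ∣ ρ) :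
    ∑ ν ∈ ρ.divisors, (if d ∣ ν then (moebius (ρ / ν) : ℝ) else 0) = if ρ = d then 1 else 0 := by
  obtain ⟨m, rfl⟩ := hd
  have hd0 : d ≠ 0 := left_ne_zero_of_mul hρ
  have hm0 : m ≠ 0 := right_ne_zero_of_mul hρ
  have h1 : ∑ k ∈ m.divisors, (moebius k : ℝ) = if m = 1 then 1 else 0 := by
    have := coe_zeta_mul_apply (f := (moebius : ArithmeticFunction ℝ)) (x := m)
    rw [coe_zeta_mul_coe_moebius, one_apply] at this
    rw [this]
    rfl
  rw [← Finset.sum_filter]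
  have h2 : ∑ ν ∈ (d * m).divisors with d ∣ ν, (moebius (d * m / ν) : ℝ) =
      ∑ k ∈ m.divisors, (moebius (m / k) : ℝ) := by
    symm
    refine Finset.sum_bij (fun k _ => d * k) ?_ ?_ ?_ ?_
    · intro k hk
      simp only [Finset.mem_filter, Nat.mem_divisors]
      exact ⟨⟨Nat.mul_dvd_mul_left d (Nat.dvd_of_mem_divisors hk), hρ⟩, Dvd.intro _ rfl⟩
    · intro a _ b _ h
      exact Nat.eq_of_mul_eq_mul_left (Nat.pos_of_ne_zero hd0) h
    · rintro b hb
      obtain ⟨hb1, k, rfl⟩ := Finset.mem_filter.1 hb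
      refine ⟨k, ?_, rfl⟩
      rw [Nat.mem_divisors]
      exact ⟨Nat.dvd_of_mul_dvd_mul_left (Nat.pos_of_ne_zero hd0) (Nat.dvd_of_mem_divisors hb1), hm0⟩
    · intro k _
      rw [Nat.mul_div_mul_left _ _ (Nat.pos_of_ne_zero hd0)]
  rw [h2, Nat.sum_div_divisors m (fun k => (moebius k : ℝ)), h1]
  simp [hd0]

theorem mollDvd_eq (N d : ℕ) :
    mollDvd N d = if d ∈ Icc 1 N then moebius d * dens d / mass N else 0 := by
  have e : mollDvd N d = (∑ ρ ∈ Icc 1 N, moebius ρ * dens ρ *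
      ∑ ν ∈ Icc 1 N, if ν ∣ ρ then (if d ∣ ν then (moebius (ρ / ν) : ℝ) else 0) else 0) / mass N := by
    simp only [mollDvd, moll]
    simp only [Finset.mul_sum, Finset.sum_div]
    rw [Finset.sum_comm]
    refine Finset.sum_congr rfl fun ν _ => ?_
    split_ifs with h
    · refine Finset.sum_congr rfl fun ρ _ => ?_
      split_ifs
      · ring
      · simp
    · simp
  have e2 : ∀ ρ ∈ Icc 1 N, (∑ ν ∈ Icc 1 N, if ν ∣ ρ then
      (if d ∣ ν then (moebius (ρ / ν) : ℝ) else 0) else 0) = if ρ = d then 1 else 0 := by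
    intro ρ hρ
    obtain ⟨h1, h2⟩ := Finset.mem_Icc.1 hρ
    have h3 : (Icc 1 N).filter (· ∣ ρ) = ρ.divisors := by
      ext x
      simp only [Finset.mem_filter, Finset.mem_Icc, Nat.mem_divisors]
      constructor
      · rintro ⟨_, h⟩; exact ⟨h, by omega⟩
      · rintro ⟨h, _⟩
        exact ⟨⟨Nat.pos_of_dvd_of_pos h h1, (Nat.le_of_dvd h1 h).trans h2⟩, h⟩
    rw [← Finset.sum_filter, h3]
    by_cases hd : d ∣ ρ
    · exact sum_moebius_div_between (by omega) hd
    · rw [if_neg (by rintro rfl; exact hd dvd_rfl)]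
      refine Finset.sum_eq_zero fun ν hν => if_neg fun h => hd (h.trans (Nat.dvd_of_mem_divisors hν))
  rw [e, Finset.sum_congr rfl fun ρ hρ => by rw [e2 ρ hρ]]
  simp only [mul_ite, mul_one, mul_zero, Finset.sum_ite_eq']
  split_ifs <;> simp

theorem abs_mollDvd_le {N : ℕ} (hN : 1 ≤ N) (d : ℕ) : |mollDvd N d| ≤ dens d / mass N := by
  have hB : 0 < mass N := zero_lt_one.trans_le (one_le_mass hN)
  rw [mollDvd_eq]
  split_ifs
  · rw [abs_div, abs_of_pos hB, abs_mul, abs_of_nonneg (dens_nonneg d)]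
    gcongr
    exact mul_le_of_le_one_left (dens_nonneg d) (abs_moebius_le_one_real d)
  · simpa using div_nonneg (dens_nonneg d) hB.le

end Mollifier

section PrimeSums

theorem sum_log_div_prime_le {N : ℕ} (hN : 1 ≤ N) :
    ∑ p ∈ (Icc 1 N).filter Nat.Prime, Real.log p / p ≤ Real.log N + Real.log 4 := by
  set P := (Icc 1 N).filter Nat.Prime with hP
  have hN0 : (0 : ℝ) < N := by exact_mod_cast hN
  have h1 : ∑ p ∈ P, Real.log p * (N / p : ℕ) ≤ N * Real.log N := by
    have e : ∀ n ∈ Icc 1 N, ∑ p ∈ P, (if p ∣ n then Real.log p else 0) ≤ Real.log N := by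
      intro n hn
      obtain ⟨hn1, hn2⟩ := Finset.mem_Icc.1 hn
      rw [← Finset.sum_filter]
      have e1 : P.filter (· ∣ n) = n.primeFactors := by
        ext p
        simp only [hP, Finset.mem_filter, Finset.mem_Icc, Nat.mem_primeFactors]
        constructor
        · rintro ⟨⟨_, h⟩, h'⟩; exact ⟨h, h', by omega⟩
        · rintro ⟨h, h', _⟩
          exact ⟨⟨⟨h.pos, (Nat.le_of_dvd hn1 h').trans hn2⟩, h⟩, h'⟩
      rw [e1, ← Real.log_prod (fun p hp => by
        exact_mod_cast (Nat.prime_of_mem_primeFactors hp).ne_zero)]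
      refine Real.log_le_log (Finset.prod_pos fun p hp => by
        exact_mod_cast (Nat.prime_of_mem_primeFactors hp).pos) ?_
      have := Nat.le_of_dvd hn1 (Nat.prod_primeFactors_dvd n)
      rw [← Nat.cast_prod]
      exact_mod_cast this.trans hn2
    have h := Finset.sum_le_sum e
    rw [Finset.sum_comm] at h
    simp only [Finset.sum_const, nsmul_eq_mul, Nat.card_Icc, Nat.add_sub_cancel] at h
    refine le_trans (le_of_eq (Finset.sum_congr rfl fun p hp => ?_)) h
    rw [← Finset.sum_filter, Finset.sum_const, nsmul_eq_mul, mul_comm]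
    congr 2
    have := Nat.Ioc_filter_dvd_card_eq_div N p
    rw [← this]
    rfl
  have h2 : ∑ p ∈ P, Real.log p ≤ Real.log 4 * N := by
    have := Chebyshev.theta_le_log4_mul_x (x := (N : ℝ)) hN0.le
    rw [Chebyshev.theta_eq_sum_Icc] at this
    refine le_trans (Finset.sum_le_sum_of_subset_of_nonneg ?_ ?_) this
    · simp only [hP, Nat.floor_natCast]
      exact Finset.filter_subset_filter _ (Finset.Icc_subset_Icc (by omega) le_rfl)
    · intro p _ _
      exact Real.log_natCast_nonneg p
  have h3 : N * ∑ p ∈ P, Real.log p / p ≤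
      ∑ p ∈ P, Real.log p * (N / p : ℕ) + ∑ p ∈ P, Real.log p := by
    rw [Finset.mul_sum, ← Finset.sum_add_distrib]
    refine Finset.sum_le_sum fun p hp => ?_
    have hp0 : (0 : ℝ) < p := by exact_mod_cast (Finset.mem_filter.1 hp).2.pos
    have : (N : ℝ) / p ≤ (N / p : ℕ) + 1 := by
      have := Nat.lt_floor_add_one ((N : ℝ) / p)
      rw [Nat.floor_div_eq_div] at this
      exact this.le
    calc (N : ℝ) * (Real.log p / p) = Real.log p * (N / p) := by ring
      _ ≤ Real.log p * ((N / p : ℕ) + 1) := mul_le_mul_of_nonneg_left this (Real.log_natCast_nonneg p)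
      _ = _ := by ring
  have h4 : N * ∑ p ∈ P, Real.log p / p ≤ N * (Real.log N + Real.log 4) := by linarith
  exact le_of_mul_le_mul_left h4 hN0

theorem sum_squarefree_le_prod {G : ℕ → ℝ} (hG : ∀ n, 0 ≤ G n)
    (hmul : ∀ n, Squarefree n → G n = ∏ p ∈ n.primeFactors, G p)
    (hz : ∀ n, ¬ Squarefree n → G n = 0) (N : ℕ) :
    ∑ n ∈ Icc 1 N, G n ≤ Real.exp (∑ p ∈ (Icc 1 N).filter Nat.Prime, G p) := by
  have h1 : ∑ n ∈ Icc 1 N, G n = ∑ n ∈ (Icc 1 N).filter Squarefree, ∏ p ∈ n.primeFactors, G p := by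
    rw [Finset.sum_filter]
    refine Finset.sum_congr rfl fun n _ => ?_
    split_ifs with h
    · exact hmul n h
    · exact hz n h
  have h2 : ∑ n ∈ (Icc 1 N).filter Squarefree, ∏ p ∈ n.primeFactors, G p ≤
      ∑ S ∈ ((Icc 1 N).filter Nat.Prime).powerset, ∏ p ∈ S, G p := by
    rw [← Finset.sum_image (f := fun S : Finset ℕ => ∏ p ∈ S, G p) (g := Nat.primeFactors)]
    · refine Finset.sum_le_sum_of_subset_of_nonneg ?_ fun S _ _ => Finset.prod_nonneg fun p _ => hG p
      intro S hS
      obtain ⟨n, hn, rfl⟩ := Finset.mem_image.1 hS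
      obtain ⟨hn1, hn2⟩ := Finset.mem_Icc.1 (Finset.mem_filter.1 hn).1
      rw [Finset.mem_powerset]
      intro p hp
      have := Nat.prime_of_mem_primeFactors hp
      simp only [Finset.mem_filter, Finset.mem_Icc]
      exact ⟨⟨this.pos, (Nat.le_of_mem_primeFactors hp).trans hn2⟩, this⟩
    · intro m hm n hn h
      rw [← Nat.prod_primeFactors_of_squarefree (Finset.mem_filter.1 hm).2,
        ← Nat.prod_primeFactors_of_squarefree (Finset.mem_filter.1 hn).2, h]
  rw [h1]
  refine h2.trans ?_
  rw [← Finset.prod_one_add, Real.exp_sum]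
  refine Finset.prod_le_prod (fun p _ => by have := hG p; linarith) fun p _ => ?_
  have := Real.add_one_le_exp (G p)
  linarith

theorem abs_jordan_neg_le {ε : ℝ} (hε : 0 ≤ ε) {p : ℕ} (hp : p.Prime) :
    |jordan (-ε) p| ≤ ε * Real.log p := by
  have h := jordan_prime_pow (-ε) hp 0
  simp only [zero_add, pow_one, pow_zero, Nat.cast_one, Real.one_rpow] at h
  have hp1 : (1 : ℝ) ≤ p := by exact_mod_cast hp.one_le
  have h1 : (p : ℝ) ^ (-ε) ≤ 1 := Real.rpow_le_one_of_one_le_of_nonpos hp1 (by linarith)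
  rw [h, abs_of_nonpos (by linarith), Real.rpow_def_of_pos (by linarith)]
  have := Real.add_one_le_exp (Real.log p * -ε)
  linarith

theorem sum_abs_jordan_dens_le {N : ℕ} (hN : 2 ≤ N) {ε : ℝ} (hε : 0 ≤ ε)
    (hε1 : ε * Real.log N ≤ 1) :
    ∑ e ∈ Icc 1 N, |jordan (-ε) e| * dens e ≤ Real.exp 3 := by
  have hN1 : 1 ≤ N := by omega
  refine (sum_squarefree_le_prod (G := fun e => |jordan (-ε) e| * dens e)
    (fun n => mul_nonneg (abs_nonneg _) (dens_nonneg n)) ?_ ?_ N).trans ?_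
  · intro n hn
    have h1 := (jordan_isMultiplicative (-ε)).map_prod_of_subset_primeFactors n n.primeFactors subset_rfl
    have h2 := halfPow_isMultiplicative.map_prod_of_subset_primeFactors n n.primeFactors subset_rfl
    rw [Nat.prod_primeFactors_of_squarefree hn] at h1 h2
    have h3 : (n : ℝ) = ∏ p ∈ n.primeFactors, (p : ℝ) := by
      rw [← Nat.cast_prod, Nat.prod_primeFactors_of_squarefree hn]
    simp only [dens, h1, h2, h3, Finset.abs_prod, Finset.prod_mul_distrib, Finset.prod_div_distrib]
  · intro n hn
    simp [dens, halfPow_apply, hn]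
  · refine Real.exp_le_exp.2 ?_
    have h1 : ∑ p ∈ (Icc 1 N).filter Nat.Prime, |jordan (-ε) p| * dens p ≤
        ε * ∑ p ∈ (Icc 1 N).filter Nat.Prime, Real.log p / p := by
      rw [Finset.mul_sum]
      refine Finset.sum_le_sum fun p hp => ?_
      have := (Finset.mem_filter.1 hp).2
      calc _ ≤ (ε * Real.log p) * (1 / p) :=
            mul_le_mul (abs_jordan_neg_le hε this) (dens_le p) (dens_nonneg p)
              (mul_nonneg hε (Real.log_natCast_nonneg p))
        _ = _ := by ring
    have h2 := mul_le_mul_of_nonneg_left (sum_log_div_prime_le hN1) hε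
    have h3 : Real.log 4 ≤ 2 * Real.log N := by
      have : Real.log 4 = 2 * Real.log 2 := by
        rw [show (4 : ℝ) = 2 ^ 2 by norm_num, Real.log_pow]; norm_num
      rw [this]
      have : Real.log 2 ≤ Real.log N := Real.log_le_log (by norm_num) (by exact_mod_cast hN)
      linarith
    nlinarith [mul_le_mul_of_nonneg_left h3 hε]

end PrimeSums

end Selberg

namespace Selberg

open ArithmeticFunction Finset

section QuadraticForm

/-- Twisted divisor sums of the mollifier. -/
noncomputable def mollTwist (N : ℕ) (ε : ℝ) (d : ℕ) : ℝ :=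
  ∑ κ ∈ Icc 1 N, if d ∣ κ then moll N κ * (κ : ℝ) ^ (-ε) else 0

theorem abs_mollTwist_le {N : ℕ} (hN : 2 ≤ N) {ε : ℝ} (hε : 0 ≤ ε)
    (hε1 : ε * Real.log N ≤ 1) {d : ℕ} (hd : d ≠ 0) :
    |mollTwist N ε d| ≤ Real.exp 3 * (dens d / mass N) := by
  have hN1 : 1 ≤ N := by omega
  have hB : 0 < mass N := zero_lt_one.trans_le (one_le_mass hN1)
  have hd1 : (1 : ℝ) ≤ d := by exact_mod_cast Nat.one_le_iff_ne_zero.2 hd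
  have e : mollTwist N ε d =
      (d : ℝ) ^ (-ε) * ∑ e ∈ Icc 1 N, jordan (-ε) e * mollDvd N (d * e) := by
    simp only [mollTwist, mollDvd, Finset.mul_sum]
    rw [Finset.sum_comm]
    refine Finset.sum_congr rfl fun κ hκ => ?_
    obtain ⟨hk1, hk2⟩ := Finset.mem_Icc.1 hκ
    split_ifs with h
    · obtain ⟨m, rfl⟩ := h
      have hm : m ≠ 0 := by rintro rfl; simp at hk1
      have h1 : ∀ e ∈ Icc 1 N, (d : ℝ) ^ (-ε) * (jordan (-ε) e *
          if d * e ∣ d * m then moll N (d * m) else 0) =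
          if e ∣ m then (d : ℝ) ^ (-ε) * moll N (d * m) * jordan (-ε) e else 0 := by
        intro e _
        simp only [Nat.mul_dvd_mul_iff_left (Nat.pos_of_ne_zero hd)]
        split_ifs <;> ring
      rw [Finset.sum_congr rfl h1, ← Finset.sum_filter, ← Finset.mul_sum]
      have h2 : (Icc 1 N).filter (· ∣ m) = m.divisors := by
        ext x
        simp only [Finset.mem_filter, Finset.mem_Icc, Nat.mem_divisors]
        constructor
        · rintro ⟨_, h⟩; exact ⟨h, hm⟩
        · rintro ⟨h, _⟩
          have := Nat.le_of_dvd (Nat.pos_of_ne_zero hm) h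
          exact ⟨⟨Nat.pos_of_dvd_of_pos h (Nat.pos_of_ne_zero hm), by nlinarith [Nat.pos_of_ne_zero hd]⟩, h⟩
      rw [h2, sum_jordan (-ε) hm, Nat.cast_mul, Real.mul_rpow (by positivity) (by positivity)]
      ring
    · symm
      refine Finset.sum_eq_zero fun e _ => ?_
      rw [if_neg (fun h' => h ((Dvd.intro _ rfl).trans h'))]
      simp
  have hpow : (d : ℝ) ^ (-ε) ≤ 1 := Real.rpow_le_one_of_one_le_of_nonpos hd1 (by linarith)
  rw [e, abs_mul, abs_of_nonneg (Real.rpow_nonneg (by positivity) _)]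
  refine (mul_le_of_le_one_left (abs_nonneg _) hpow).trans ((Finset.abs_sum_le_sum_abs _ _).trans ?_)
  calc ∑ e ∈ Icc 1 N, |jordan (-ε) e * mollDvd N (d * e)|
      ≤ ∑ e ∈ Icc 1 N, (|jordan (-ε) e| * dens e) * (dens d / mass N) := by
        refine Finset.sum_le_sum fun e _ => ?_
        rw [abs_mul, mul_assoc]
        refine mul_le_mul_of_nonneg_left ((abs_mollDvd_le hN1 _).trans ?_) (abs_nonneg _)
        rw [mul_div_assoc']
        gcongr
        rw [mul_comm (dens e)]
        exact dens_mul_le d e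
    _ ≤ _ := by
        rw [← Finset.sum_mul]
        exact mul_le_mul_of_nonneg_right (sum_abs_jordan_dens_le hN hε hε1)
          (div_nonneg (dens_nonneg d) hB.le)

/-- The convolution sums that diagonalise the quadratic form. -/
noncomputable def mollConv (N : ℕ) (ε : ℝ) (ρ : ℕ) : ℝ :=
  ∑ κ ∈ Icc 1 N, ∑ ν ∈ Icc 1 N, if ρ ∣ κ * ν then moll N κ * (κ : ℝ) ^ (-ε) * moll N ν else 0

/-- `σ₋₁`. -/
noncomputable def invDivisorSum (ρ : ℕ) : ℝ := ∑ e ∈ ρ.divisors, (1 : ℝ) / e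

/-- `g ↦ W(ρ / g)` as an arithmetic function. -/
noncomputable def mollCo (N ρ : ℕ) : ArithmeticFunction ℝ :=
  ⟨fun g => if g = 0 then 0 else mollDvd N (ρ / g), by simp⟩

theorem mollConv_eq {N : ℕ} (ε : ℝ) {ρ : ℕ} (hρ : ρ ≠ 0) :
    mollConv N ε ρ = ∑ d ∈ ρ.divisors,
      ((moebius : ArithmeticFunction ℝ) * mollCo N ρ) d * mollTwist N ε d := by
  have h1 : ∀ κ ∈ Icc 1 N, (∑ ν ∈ Icc 1 N,
      if ρ ∣ κ * ν then moll N κ * (κ : ℝ) ^ (-ε) * moll N ν else 0) =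
      ∑ d ∈ ρ.divisors, ((moebius : ArithmeticFunction ℝ) * mollCo N ρ) d *
        (if d ∣ κ then moll N κ * (κ : ℝ) ^ (-ε) else 0) := by
    intro κ hκ
    have hk := (Finset.mem_Icc.1 hκ).1
    have hg0 : Nat.gcd ρ κ ≠ 0 := by rw [Ne, Nat.gcd_eq_zero_iff]; omega
    have e1 : ∀ ν, (ρ ∣ κ * ν ↔ ρ / Nat.gcd ρ κ ∣ ν) := by
      intro ν
      constructor
      · intro h
        have h2 : ρ / Nat.gcd ρ κ ∣ (κ / Nat.gcd ρ κ) * ν := by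
          rw [← Nat.mul_div_right_comm (Nat.gcd_dvd_right ρ κ)]
          exact Nat.div_dvd_div (Nat.gcd_dvd_left ρ κ) h
        exact (Nat.coprime_div_gcd_div_gcd (Nat.pos_of_ne_zero hg0)).dvd_of_dvd_mul_left h2
      · intro h
        have h2 : ρ = ρ / Nat.gcd ρ κ * Nat.gcd ρ κ := (Nat.div_mul_cancel (Nat.gcd_dvd_left ρ κ)).symm
        rw [h2, mul_comm κ]
        exact mul_dvd_mul h (Nat.gcd_dvd_right ρ κ)
    have e2 : (∑ ν ∈ Icc 1 N, if ρ ∣ κ * ν then moll N κ * (κ : ℝ) ^ (-ε) * moll N ν else 0) =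
        moll N κ * (κ : ℝ) ^ (-ε) * mollCo N ρ (Nat.gcd ρ κ) := by
      simp only [mollCo, coe_mk, if_neg hg0, mollDvd, Finset.mul_sum]
      refine Finset.sum_congr rfl fun ν _ => ?_
      simp only [e1]
      split_ifs <;> simp
    have e3 : mollCo N ρ (Nat.gcd ρ κ) =
        ∑ d ∈ (Nat.gcd ρ κ).divisors, ((moebius : ArithmeticFunction ℝ) * mollCo N ρ) d := by
      rw [← coe_zeta_mul_apply, ← mul_assoc, coe_zeta_mul_coe_moebius, one_mul]
    have e4 : ρ.divisors.filter (· ∣ κ) = (Nat.gcd ρ κ).divisors := by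
      ext x
      simp only [Finset.mem_filter, Nat.mem_divisors, Nat.dvd_gcd_iff]
      tauto
    rw [e2, e3, ← e4, Finset.mul_sum, Finset.sum_filter]
    refine Finset.sum_congr rfl fun d _ => ?_
    split_ifs <;> ring
  rw [mollConv, Finset.sum_congr rfl h1, Finset.sum_comm]
  simp only [mollTwist, Finset.mul_sum]

theorem abs_mollConv_le {N : ℕ} (hN : 2 ≤ N) {ε : ℝ} (hε : 0 ≤ ε)
    (hε1 : ε * Real.log N ≤ 1) {ρ : ℕ} (hρ : ρ ≠ 0) :
    |mollConv N ε ρ| ≤ Real.exp 3 * invDivisorSum ρ / (mass N ^ 2 * ρ) := by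
  have hN1 : 1 ≤ N := by omega
  have hB : 0 < mass N := zero_lt_one.trans_le (one_le_mass hN1)
  have h1 : |mollConv N ε ρ| ≤ ∑ d ∈ ρ.divisors, ∑ x ∈ d.divisorsAntidiagonal,
      (dens (ρ / x.2) / mass N) * (Real.exp 3 * ((1 / x.1) * dens x.2 / mass N)) := by
    rw [mollConv_eq ε hρ]
    refine (Finset.abs_sum_le_sum_abs _ _).trans (Finset.sum_le_sum fun d hd => ?_)
    have hd0 : d ≠ 0 := by rintro rfl; simp at hd
    rw [ArithmeticFunction.mul_apply, Finset.sum_mul]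
    refine (Finset.abs_sum_le_sum_abs _ _).trans (Finset.sum_le_sum fun x hx => ?_)
    obtain ⟨hx1, hx2⟩ := Nat.mem_divisorsAntidiagonal.1 hx
    have hx20 : x.2 ≠ 0 := by rintro h; rw [h] at hx1; omega
    rw [abs_mul, abs_mul]
    refine mul_le_mul ?_ ((abs_mollTwist_le hN hε hε1 hd0).trans ?_) (abs_nonneg _)
      (div_nonneg (dens_nonneg _) hB.le)
    · simp only [mollCo, coe_mk, if_neg hx20]
      exact (mul_le_of_le_one_left (abs_nonneg _) (abs_moebius_le_one_real _)).trans
        (abs_mollDvd_le hN1 _)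
    · gcongr
      rw [← hx1]
      exact (dens_mul_le _ _).trans (mul_le_mul_of_nonneg_right (dens_le _) (dens_nonneg _))
  refine h1.trans ?_
  have h2 : ∑ d ∈ ρ.divisors, ∑ x ∈ d.divisorsAntidiagonal,
      (dens (ρ / x.2) / mass N) * (Real.exp 3 * ((1 / x.1) * dens x.2 / mass N)) ≤
      ∑ x ∈ ρ.divisors ×ˢ ρ.divisors,
        (dens (ρ / x.2) / mass N) * (Real.exp 3 * ((1 / x.1) * dens x.2 / mass N)) := by
    rw [← Finset.sum_biUnion]
    · refine Finset.sum_le_sum_of_subset_of_nonneg ?_ fun x _ _ => ?_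
      · intro x hx
        obtain ⟨d, hd, hx⟩ := Finset.mem_biUnion.1 hx
        have hx1 := (Nat.mem_divisorsAntidiagonal.1 hx).1
        have hdd := Nat.dvd_of_mem_divisors hd
        simp only [Finset.mem_product, Nat.mem_divisors]
        exact ⟨⟨(Dvd.intro _ hx1).trans hdd, hρ⟩, (Dvd.intro_left _ hx1).trans hdd, hρ⟩
      · have := dens_nonneg (ρ / x.2)
        have := dens_nonneg x.2
        positivity
    · intro a _ b _ hab
      refine Finset.disjoint_left.2 fun x hx hx' => hab ?_
      rw [← (Nat.mem_divisorsAntidiagonal.1 hx).1, ← (Nat.mem_divisorsAntidiagonal.1 hx').1]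
  refine h2.trans ?_
  have h3 : ∑ x ∈ ρ.divisors ×ˢ ρ.divisors,
        (dens (ρ / x.2) / mass N) * (Real.exp 3 * ((1 / x.1) * dens x.2 / mass N)) =
      Real.exp 3 / mass N ^ 2 * (invDivisorSum ρ * ∑ g ∈ ρ.divisors, dens g * dens (ρ / g)) := by
    rw [invDivisorSum, Finset.sum_mul_sum, ← Finset.sum_product', Finset.mul_sum]
    refine Finset.sum_congr rfl fun x _ => ?_
    field_simp
  rw [h3, sum_dens_mul_dens]
  have h4 : (halfPow * halfPow) ρ / ρ ≤ 1 / ρ :=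
    div_le_div_of_nonneg_right (halfPow_sq_le_one ρ) (by positivity)
  have h5 : 0 ≤ invDivisorSum ρ := Finset.sum_nonneg fun _ _ => by positivity
  calc _ ≤ Real.exp 3 / mass N ^ 2 * (invDivisorSum ρ * (1 / ρ)) := by gcongr
    _ = _ := by
      have : (ρ : ℝ) ≠ 0 := by exact_mod_cast hρ
      field_simp

/-- The mean of squares of `σ₋₁` with logarithmic weights. -/
theorem exists_sum_invDivisorSum_sq_le : ∃ C : ℝ, 0 < C ∧ ∀ M : ℕ, 1 ≤ M →
    ∑ ρ ∈ Icc 1 M, invDivisorSum ρ ^ 2 / ρ ≤ C * (1 + Real.log M) := by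
  set a : ℕ → ℝ := fun n => 1 / (n : ℝ) ^ (3 / 2 : ℝ) with ha
  have hs : Summable a := Real.summable_one_div_nat_rpow.2 (by norm_num)
  have ha0 : ∀ n, 0 ≤ a n := fun n => by positivity
  set A : ℝ := ∑' n, a n with hA
  have hA1 : 1 ≤ A := by
    calc (1 : ℝ) = a 1 := by simp [ha]
      _ ≤ A := hs.le_tsum 1 fun n _ => ha0 n
  have hle : ∀ S : Finset ℕ, ∑ n ∈ S, a n ≤ A := fun S => hs.sum_le_tsum S fun n _ => ha0 n
  refine ⟨A * A, by positivity, fun M hM => ?_⟩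
  have h1 : ∀ ρ ∈ Icc 1 M, invDivisorSum ρ ^ 2 / ρ ≤
      A * ∑ e ∈ Icc 1 M, if e ∣ ρ then (1 / (e : ℝ) ^ (1 / 2 : ℝ)) * (1 / ρ) else 0 := by
    intro ρ hρ
    obtain ⟨hρ1, hρ2⟩ := Finset.mem_Icc.1 hρ
    have hf : (Icc 1 M).filter (· ∣ ρ) = ρ.divisors := by
      ext x
      simp only [Finset.mem_filter, Finset.mem_Icc, Nat.mem_divisors]
      constructor
      · rintro ⟨_, h⟩; exact ⟨h, by omega⟩
      · rintro ⟨h, _⟩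
        exact ⟨⟨Nat.pos_of_dvd_of_pos h hρ1, (Nat.le_of_dvd hρ1 h).trans hρ2⟩, h⟩
    rw [← Finset.sum_filter, hf, ← Finset.sum_mul]
    have hcs : invDivisorSum ρ ^ 2 ≤
        (∑ e ∈ ρ.divisors, a e) * ∑ e ∈ ρ.divisors, 1 / (e : ℝ) ^ (1 / 2 : ℝ) := by
      refine Finset.sum_sq_le_sum_mul_sum_of_sq_le_mul _ (fun e _ => ha0 e) (fun e _ => by positivity) ?_
      intro e he
      refine le_of_eq ?_
      have he0 : (0 : ℝ) < e := by exact_mod_cast Nat.pos_of_mem_divisors he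
      simp only [ha]
      rw [one_div_mul_one_div, ← Real.rpow_add he0, div_pow, one_pow, ← Real.rpow_natCast]
      norm_num
    have hp : 0 ≤ ∑ e ∈ ρ.divisors, 1 / (e : ℝ) ^ (1 / 2 : ℝ) :=
      Finset.sum_nonneg fun _ _ => by positivity
    calc invDivisorSum ρ ^ 2 / ρ ≤ (A * ∑ e ∈ ρ.divisors, 1 / (e : ℝ) ^ (1 / 2 : ℝ)) / ρ := by
          gcongr
          exact hcs.trans (mul_le_mul_of_nonneg_right (hle _) hp)
      _ = _ := by ring
  refine (Finset.sum_le_sum h1).trans ?_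
  rw [← Finset.mul_sum, Finset.sum_comm, mul_assoc]
  refine mul_le_mul_of_nonneg_left ?_ (by linarith)
  have hL : 0 ≤ 1 + Real.log M := by
    have := Real.log_natCast_nonneg M
    linarith
  have h2 : ∀ e ∈ Icc 1 M, (∑ ρ ∈ Icc 1 M,
      if e ∣ ρ then (1 / (e : ℝ) ^ (1 / 2 : ℝ)) * (1 / ρ) else 0) ≤ a e * (1 + Real.log M) := by
    intro e he
    obtain ⟨he1, he2⟩ := Finset.mem_Icc.1 he
    have he0 : (0 : ℝ) < e := by exact_mod_cast he1
    rw [← Finset.sum_filter]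
    have hsub : (Icc 1 M).filter (e ∣ ·) ⊆ (Icc 1 M).image (e * ·) := by
      intro x hx
      obtain ⟨hx1, k, rfl⟩ := Finset.mem_filter.1 hx
      obtain ⟨hx1, hx2⟩ := Finset.mem_Icc.1 hx1
      refine Finset.mem_image.2 ⟨k, Finset.mem_Icc.2 ⟨Nat.pos_of_mul_pos_left hx1, ?_⟩, rfl⟩
      nlinarith
    refine (Finset.sum_le_sum_of_subset_of_nonneg hsub fun _ _ _ => by positivity).trans ?_
    rw [Finset.sum_image (fun x _ y _ h => Nat.eq_of_mul_eq_mul_left he1 h)]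
    have : ∀ k ∈ Icc 1 M, (1 / (e : ℝ) ^ (1 / 2 : ℝ)) * (1 / ((e * k : ℕ) : ℝ)) = a e * (1 / k) := by
      intro k hk
      have h32 : (e : ℝ) ^ (3 / 2 : ℝ) = (e : ℝ) ^ (1 / 2 : ℝ) * e := by
        rw [← Real.rpow_add_one he0.ne']; norm_num
      simp only [ha]
      rw [h32, Nat.cast_mul, one_div_mul_one_div, one_div_mul_one_div, mul_assoc]
    rw [Finset.sum_congr rfl this, ← Finset.mul_sum]
    exact mul_le_mul_of_nonneg_left sum_inv_le (ha0 e)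
  refine (Finset.sum_le_sum h2).trans ?_
  rw [← Finset.sum_mul]
  exact mul_le_mul_of_nonneg_right (hle _) hL

/-- The quadratic form attached to the diagonal terms. -/
noncomputable def quadForm (N : ℕ) (ε : ℝ) : ℝ :=
  ∑ κ ∈ Icc 1 N, ∑ ν ∈ Icc 1 N, ∑ μ ∈ Icc 1 N, ∑ l ∈ Icc 1 N,
    moll N κ * moll N ν * (moll N μ * moll N l) *
      ((Nat.gcd (κ * ν) (μ * l) : ℝ) ^ (1 + ε) * ((κ : ℝ) ^ (-ε) * (μ : ℝ) ^ (-ε)))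

theorem quadForm_eq (N : ℕ) (ε : ℝ) :
    quadForm N ε = ∑ ρ ∈ Icc 1 (N * N), jordan (1 + ε) ρ * mollConv N ε ρ ^ 2 := by
  have h : ∀ κ ∈ Icc 1 N, ∀ ν ∈ Icc 1 N, ∀ μ ∈ Icc 1 N, ∀ l ∈ Icc 1 N,
      (Nat.gcd (κ * ν) (μ * l) : ℝ) ^ (1 + ε) = ∑ ρ ∈ Icc 1 (N * N),
        jordan (1 + ε) ρ * ((if ρ ∣ κ * ν then 1 else 0) * (if ρ ∣ μ * l then 1 else 0)) := by
    intro κ hκ ν hν μ hμ l hl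
    rw [Finset.mem_Icc] at hκ hν
    have hpos : 0 < κ * ν := Nat.mul_pos hκ.1 hν.1
    have hg : Nat.gcd (κ * ν) (μ * l) ≠ 0 := (Nat.gcd_pos_of_pos_left _ hpos).ne'
    rw [← sum_jordan _ hg]
    have : (Nat.gcd (κ * ν) (μ * l)).divisors =
        (Icc 1 (N * N)).filter (fun ρ => ρ ∣ κ * ν ∧ ρ ∣ μ * l) := by
      ext x
      simp only [Finset.mem_filter, Finset.mem_Icc, Nat.mem_divisors, Nat.dvd_gcd_iff]
      constructor
      · rintro ⟨h, _⟩
        exact ⟨⟨Nat.pos_of_dvd_of_pos h.1 hpos, (Nat.le_of_dvd hpos h.1).trans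
          (Nat.mul_le_mul hκ.2 hν.2)⟩, h⟩
      · rintro ⟨_, h⟩; exact ⟨h, hg⟩
    rw [this, Finset.sum_filter]
    refine Finset.sum_congr rfl fun ρ _ => ?_
    by_cases h1 : ρ ∣ κ * ν <;> by_cases h2 : ρ ∣ μ * l <;> simp [h1, h2]
  have h1 : quadForm N ε = ∑ κ ∈ Icc 1 N, ∑ ν ∈ Icc 1 N, ∑ μ ∈ Icc 1 N, ∑ l ∈ Icc 1 N,
      ∑ ρ ∈ Icc 1 (N * N), jordan (1 + ε) ρ *
        ((if ρ ∣ κ * ν then moll N κ * (κ : ℝ) ^ (-ε) * moll N ν else 0) *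
         (if ρ ∣ μ * l then moll N μ * (μ : ℝ) ^ (-ε) * moll N l else 0)) := by
    refine Finset.sum_congr rfl fun κ hκ => Finset.sum_congr rfl fun ν hν =>
      Finset.sum_congr rfl fun μ hμ => Finset.sum_congr rfl fun l hl => ?_
    rw [h κ hκ ν hν μ hμ l hl, Finset.sum_mul, Finset.mul_sum]
    refine Finset.sum_congr rfl fun ρ _ => ?_
    split_ifs <;> ring
  have h2 : ∀ ρ, jordan (1 + ε) ρ * mollConv N ε ρ ^ 2 =
      ∑ κ ∈ Icc 1 N, ∑ ν ∈ Icc 1 N, ∑ μ ∈ Icc 1 N, ∑ l ∈ Icc 1 N, jordan (1 + ε) ρ *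
        ((if ρ ∣ κ * ν then moll N κ * (κ : ℝ) ^ (-ε) * moll N ν else 0) *
         (if ρ ∣ μ * l then moll N μ * (μ : ℝ) ^ (-ε) * moll N l else 0)) := by
    intro ρ
    rw [sq, mollConv]
    simp only [Finset.sum_mul, Finset.mul_sum]
    refine Finset.sum_congr rfl fun κ _ => Finset.sum_congr rfl fun ν _ =>
      Finset.sum_congr rfl fun μ _ => Finset.sum_congr rfl fun l _ => ?_
    ring
  rw [h1, Finset.sum_congr rfl fun ρ _ => h2 ρ]
  symm
  rw [Finset.sum_comm]
  refine Finset.sum_congr rfl fun κ hκ => ?_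
  rw [Finset.sum_comm]
  refine Finset.sum_congr rfl fun ν hν => ?_
  rw [Finset.sum_comm]
  refine Finset.sum_congr rfl fun μ hμ => ?_
  rw [Finset.sum_comm]

theorem quadForm_nonneg (N : ℕ) {ε : ℝ} (hε : 0 ≤ ε) : 0 ≤ quadForm N ε := by
  rw [quadForm_eq]
  exact Finset.sum_nonneg fun ρ _ => mul_nonneg (jordan_nonneg (by linarith) ρ) (sq_nonneg _)

theorem exists_quadForm_le : ∃ C : ℝ, 0 < C ∧ ∀ (N : ℕ) (ε : ℝ), 2 ≤ N → 0 ≤ ε →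
    ε * Real.log N ≤ 1 → quadForm N ε ≤ C / Real.log N := by
  obtain ⟨C, hC, h⟩ := exists_sum_invDivisorSum_sq_le
  refine ⟨Real.exp 2 * Real.exp 3 ^ 2 * C * 16, by positivity, fun N ε hN hε hε1 => ?_⟩
  have hN1 : 1 ≤ N := by omega
  have hB : 0 < mass N := zero_lt_one.trans_le (one_le_mass hN1)
  have hL : 1 / 2 < Real.log N := by
    have h1 := Real.log_two_gt_d9
    have : Real.log 2 ≤ Real.log N := Real.log_le_log (by norm_num) (by exact_mod_cast hN)
    linarith
  have h1 : quadForm N ε ≤ Real.exp 2 * Real.exp 3 ^ 2 / mass N ^ 4 *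
      ∑ ρ ∈ Icc 1 (N * N), invDivisorSum ρ ^ 2 / ρ := by
    rw [quadForm_eq, Finset.mul_sum]
    refine Finset.sum_le_sum fun ρ hρ => ?_
    obtain ⟨hρ1, hρ2⟩ := Finset.mem_Icc.1 hρ
    have hρ0 : ρ ≠ 0 := by omega
    have hρp : (0 : ℝ) < ρ := by exact_mod_cast hρ1
    have e1 : jordan (1 + ε) ρ ≤ ρ * Real.exp 2 := by
      refine (jordan_le (by linarith) hρ0).trans ?_
      rw [Real.rpow_add hρp, Real.rpow_one]
      refine mul_le_mul_of_nonneg_left ?_ hρp.le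
      rw [Real.rpow_def_of_pos hρp, Real.exp_le_exp]
      have : Real.log ρ ≤ 2 * Real.log N := by
        have h2 : Real.log ρ ≤ Real.log ((N : ℝ) * N) :=
          Real.log_le_log hρp (by exact_mod_cast hρ2)
        rw [Real.log_mul (by positivity) (by positivity)] at h2
        linarith
      nlinarith
    have e2 : mollConv N ε ρ ^ 2 ≤ (Real.exp 3 * invDivisorSum ρ / (mass N ^ 2 * ρ)) ^ 2 := by
      rw [← sq_abs]
      exact pow_le_pow_left₀ (abs_nonneg _) (abs_mollConv_le hN hε hε1 hρ0) 2
    calc _ ≤ (ρ * Real.exp 2) * (Real.exp 3 * invDivisorSum ρ / (mass N ^ 2 * ρ)) ^ 2 :=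
          mul_le_mul e1 e2 (sq_nonneg _) (by positivity)
      _ = _ := by field_simp
  have h2 := h (N * N) (Nat.mul_pos hN1 hN1)
  have h3 : Real.log ((N * N : ℕ) : ℝ) = 2 * Real.log N := by
    have : (N : ℝ) ≠ 0 := by positivity
    rw [Nat.cast_mul, Real.log_mul this this]; ring
  rw [h3] at h2
  have h4 : (Real.log N / 2) ^ 2 ≤ mass N ^ 4 := by
    have := log_le_mass_sq hN1
    have h5 : Real.log N / 2 ≤ mass N ^ 2 := by linarith
    calc _ ≤ (mass N ^ 2) ^ 2 := pow_le_pow_left₀ (by linarith) h5 2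
      _ = _ := by ring
  calc quadForm N ε ≤ Real.exp 2 * Real.exp 3 ^ 2 / mass N ^ 4 * (C * (1 + 2 * Real.log N)) :=
        h1.trans (by gcongr)
    _ ≤ Real.exp 2 * Real.exp 3 ^ 2 / (Real.log N / 2) ^ 2 * (C * (4 * Real.log N)) := by
        gcongr
        linarith
    _ = _ := by
        field_simp
        norm_num

end QuadraticForm

end Selberg

namespace Selberg

open Complex Set MeasureTheory Filter Topology

section GammaIntegral

theorem norm_cpow_mul_cexp {s z : ℂ} {t : ℝ} (ht : 0 < t) :
    ‖(t : ℂ) ^ (s - 1) * cexp (-(z * t))‖ = t ^ (s.re - 1) * Real.exp (-(z.re * t)) := by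
  rw [norm_mul, norm_cpow_eq_rpow_re_of_pos ht, norm_exp]
  simp

theorem continuousOn_cpow_mul_cexp (s z : ℂ) :
    ContinuousOn (fun t : ℝ => (t : ℂ) ^ (s - 1) * cexp (-(z * t))) (Ioi 0) := by
  refine ContinuousOn.mul (fun t ht => ?_) (by fun_prop)
  exact (continuousAt_ofReal_cpow_const t _ (Or.inr (ne_of_gt ht))).continuousWithinAt

theorem integrableOn_rpow_mul_exp {a r : ℝ} (ha : 0 < a) (hr : 0 < r) :
    IntegrableOn (fun t : ℝ => t ^ (a - 1) * Real.exp (-(r * t))) (Ioi 0) := by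
  have := integrableOn_rpow_mul_exp_neg_mul_rpow (s := a - 1) (p := 1) (b := r) (by linarith) one_pos hr
  refine this.congr_fun (fun t _ => ?_) measurableSet_Ioi
  simp

theorem integrableOn_cpow_mul_cexp {s z : ℂ} (hs : 0 < s.re) (hz : 0 < z.re) :
    IntegrableOn (fun t : ℝ => (t : ℂ) ^ (s - 1) * cexp (-(z * t))) (Ioi 0) := by
  refine Integrable.mono' (integrableOn_rpow_mul_exp hs hz)
    ((continuousOn_cpow_mul_cexp s z).aestronglyMeasurable measurableSet_Ioi) ?_
  refine (ae_restrict_iff' measurableSet_Ioi).2 (ae_of_all _ fun t ht => ?_)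
  rw [norm_cpow_mul_cexp ht]

theorem isPreconnected_re_pos : IsPreconnected {z : ℂ | 0 < z.re} :=
  (convex_halfSpace_re_gt 0).isPreconnected

theorem isOpen_re_pos : IsOpen {z : ℂ | 0 < z.re} := isOpen_lt continuous_const continuous_re

theorem cpow_neg_eq_inv {z : ℂ} (s : ℂ) (hz : 0 < z.re) : (1 / z) ^ s = z ^ (-s) := by
  rw [one_div, inv_cpow, cpow_neg]
  intro h
  have := (abs_arg_lt_pi_div_two_iff (z := z)).2 (Or.inl hz)
  rw [h, abs_of_pos Real.pi_pos] at this
  linarith [Real.pi_pos]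

/-- Euler's integral along a complex direction. -/
theorem integral_cpow_mul_cexp {s z : ℂ} (hs : 0 < s.re) (hz : 0 < z.re) :
    ∫ t : ℝ in Ioi 0, (t : ℂ) ^ (s - 1) * cexp (-(z * t)) = z ^ (-s) * Gamma s := by
  have hd : DifferentiableOn ℂ
      (fun z : ℂ => ∫ t : ℝ in Ioi 0, (t : ℂ) ^ (s - 1) * cexp (-(z * t))) {z : ℂ | 0 < z.re} := by
    intro w hw
    have hw' : 0 < w.re := hw
    refine (DifferentiableAt.differentiableWithinAt ?_)
    have hball : {z : ℂ | w.re / 2 < z.re} ∈ 𝓝 w :=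
      (isOpen_lt continuous_const continuous_re).mem_nhds (by show w.re / 2 < w.re; linarith)
    refine (hasDerivAt_integral_of_dominated_loc_of_deriv_le
      (μ := volume.restrict (Ioi 0))
      (F := fun (z : ℂ) (t : ℝ) => (t : ℂ) ^ (s - 1) * cexp (-(z * t)))
      (F' := fun (z : ℂ) (t : ℝ) => (t : ℂ) ^ (s - 1) * (cexp (-(z * t)) * -t))
      (bound := fun t => t ^ ((s.re + 1) - 1) * Real.exp (-(w.re / 2 * t))) hball ?_
      (integrableOn_cpow_mul_cexp hs hw') ?_ ?_ (integrableOn_rpow_mul_exp (by linarith) (by linarith))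
      ?_).2.differentiableAt
    · exact Eventually.of_forall fun z =>
        (continuousOn_cpow_mul_cexp s z).aestronglyMeasurable measurableSet_Ioi
    · refine ContinuousOn.aestronglyMeasurable ?_ measurableSet_Ioi
      refine ((continuousOn_cpow_mul_cexp s w).mul (f := fun t : ℝ => (t : ℂ) ^ (s - 1) * cexp (-(w * t)))
        (g := fun t : ℝ => -(t : ℂ)) (by fun_prop)).congr fun t _ => ?_
      simp only [Pi.mul_apply]
      ring
    · refine (ae_restrict_iff' measurableSet_Ioi).2 (ae_of_all _ fun t ht z hz => ?_)
      have ht' : (0 : ℝ) < t := ht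
      have hz' : w.re / 2 < z.re := hz
      rw [← mul_assoc, norm_mul, norm_cpow_mul_cexp ht', norm_neg, norm_real, Real.norm_of_nonneg ht'.le,
        mul_right_comm]
      have : t ^ (s.re - 1) * t = t ^ (s.re + 1 - 1) := by
        rw [← Real.rpow_add_one ht'.ne']; ring_nf
      rw [this]
      gcongr
    · refine (ae_restrict_iff' measurableSet_Ioi).2 (ae_of_all _ fun t ht z hz => ?_)
      refine HasDerivAt.const_mul _ (HasDerivAt.cexp ?_)
      have := (hasDerivAt_mul_const (x := z) (t : ℂ)).neg
      exact this
  have hd2 : DifferentiableOn ℂ (fun z : ℂ => z ^ (-s) * Gamma s) {z : ℂ | 0 < z.re} := by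
    intro w hw
    refine DifferentiableWithinAt.mul_const ?_ _
    exact (differentiableAt_id.cpow_const (Or.inl hw)).differentiableWithinAt
  have hfreq : ∃ᶠ w in 𝓝[≠] (1 : ℂ),
      ∫ t : ℝ in Ioi 0, (t : ℂ) ^ (s - 1) * cexp (-(w * t)) = w ^ (-s) * Gamma s := by
    have htend : Tendsto (fun n : ℕ => ((1 + 1 / ((n : ℝ) + 1) : ℝ) : ℂ)) atTop (𝓝[≠] (1 : ℂ)) := by
      refine tendsto_nhdsWithin_iff.2 ⟨?_, Eventually.of_forall fun n => ?_⟩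
      · have : Tendsto (fun n : ℕ => (1 + 1 / ((n : ℝ) + 1) : ℝ)) atTop (𝓝 (1 + 0)) :=
          tendsto_const_nhds.add tendsto_one_div_add_atTop_nhds_zero_nat
        rw [add_zero] at this
        exact_mod_cast (continuous_ofReal.tendsto 1).comp this
      · simp only [mem_compl_iff, mem_singleton_iff]
        intro h
        have h' : (1 + 1 / ((n : ℝ) + 1) : ℝ) = 1 := by exact_mod_cast h
        have : (0 : ℝ) < 1 / ((n : ℝ) + 1) := by positivity
        linarith
    refine htend.frequently (Eventually.frequently (Eventually.of_forall fun n => ?_))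
    have hr : (0 : ℝ) < 1 + 1 / ((n : ℝ) + 1) := by positivity
    rw [integral_cpow_mul_exp_neg_mul_Ioi hs hr, cpow_neg_eq_inv s (by rw [ofReal_re]; exact hr)]
  exact (hd.analyticOnNhd isOpen_re_pos).eqOn_of_preconnected_of_frequently_eq
    (hd2.analyticOnNhd isOpen_re_pos) isPreconnected_re_pos (z₀ := 1) (by simp) hfreq hz

end GammaIntegral

end Selberg

namespace Selberg

open Complex Set MeasureTheory Filter Topology

section Theta

/-- `Σ_{n ≥ 1} exp(-π n² w)`. -/
noncomputable def theta (w : ℂ) : ℂ := ∑' n : ℕ+, cexp (-Real.pi * w * (n : ℂ) ^ 2)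

/-- The real version of `theta`. -/
noncomputable def thetaR (a : ℝ) : ℝ := ∑' n : ℕ+, Real.exp (-Real.pi * a * (n : ℝ) ^ 2)

theorem norm_theta_term (w : ℂ) (n : ℕ+) :
    ‖cexp (-Real.pi * w * (n : ℂ) ^ 2)‖ = Real.exp (-Real.pi * w.re * (n : ℝ) ^ 2) := by
  rw [norm_exp]
  congr 1
  have : (-Real.pi * w * (n : ℂ) ^ 2) = ((-Real.pi * (n : ℝ) ^ 2 : ℝ) : ℂ) * w := by
    push_cast; ring
  rw [this, re_ofReal_mul]
  ring

theorem thetaR_term_le {a : ℝ} (ha : 0 < a) (n : ℕ) :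
    Real.exp (-Real.pi * a * ((n + 1 : ℕ) : ℝ) ^ 2) ≤
      Real.exp (-Real.pi * a) * Real.exp (-Real.pi * a) ^ n := by
  rw [← pow_succ', ← Real.exp_nat_mul, Real.exp_le_exp]
  have h1 : (0 : ℝ) < Real.pi * a := mul_pos Real.pi_pos ha
  have h2 : ((n + 1 : ℕ) : ℝ) ≤ ((n + 1 : ℕ) : ℝ) ^ 2 := by
    have : (1 : ℝ) ≤ ((n + 1 : ℕ) : ℝ) := by exact_mod_cast Nat.succ_pos n
    nlinarith
  nlinarith

theorem exp_neg_pi_lt_one {a : ℝ} (ha : 0 < a) : Real.exp (-Real.pi * a) < 1 := by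
  rw [Real.exp_lt_one_iff]
  nlinarith [Real.pi_pos]

theorem summable_thetaR {a : ℝ} (ha : 0 < a) :
    Summable fun n : ℕ+ => Real.exp (-Real.pi * a * (n : ℝ) ^ 2) := by
  rw [summable_pnat_iff_summable_succ (f := fun n : ℕ => Real.exp (-Real.pi * a * (n : ℝ) ^ 2))]
  exact Summable.of_nonneg_of_le (fun _ => (Real.exp_pos _).le) (thetaR_term_le ha)
    ((summable_geometric_of_lt_one (Real.exp_pos _).le (exp_neg_pi_lt_one ha)).mul_left _)

theorem thetaR_nonneg (a : ℝ) : 0 ≤ thetaR a := tsum_nonneg fun _ => (Real.exp_pos _).le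

theorem thetaR_le {a : ℝ} (ha : 0 < a) : thetaR a ≤ 1 / a := by
  have h0 := summable_geometric_of_lt_one (Real.exp_pos _).le (exp_neg_pi_lt_one ha)
  rw [thetaR, tsum_pnat_eq_tsum_succ (f := fun n : ℕ => Real.exp (-Real.pi * a * (n : ℝ) ^ 2))]
  have hs : Summable fun n : ℕ => Real.exp (-Real.pi * a * ((n + 1 : ℕ) : ℝ) ^ 2) :=
    Summable.of_nonneg_of_le (fun _ => (Real.exp_pos _).le) (thetaR_term_le ha) (h0.mul_left _)
  refine (hs.tsum_le_tsum (thetaR_term_le ha) (h0.mul_left _)).trans ?_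
  rw [tsum_mul_left, tsum_geometric_of_lt_one (Real.exp_pos _).le (exp_neg_pi_lt_one ha)]
  have h1 : 0 < 1 - Real.exp (-Real.pi * a) := by linarith [exp_neg_pi_lt_one ha]
  rw [← div_eq_mul_inv, div_le_div_iff₀ h1 ha]
  have h2 := Real.add_one_le_exp (Real.pi * a)
  have h3 : Real.exp (Real.pi * a) * Real.exp (-Real.pi * a) = 1 := by
    rw [← Real.exp_add]; simp
  have h4 := Real.exp_pos (-Real.pi * a)
  have h5 : a ≤ Real.pi * a := by nlinarith [Real.pi_gt_three]
  nlinarith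

theorem thetaR_le_exp {a : ℝ} (ha : 0 < a) :
    thetaR a ≤ Real.exp (-(Real.pi * a / 2)) * (2 / a) := by
  have h : thetaR a ≤ Real.exp (-(Real.pi * a / 2)) * thetaR (a / 2) := by
    rw [thetaR, thetaR, ← tsum_mul_left]
    refine (summable_thetaR ha).tsum_le_tsum (fun n => ?_) ((summable_thetaR (half_pos ha)).mul_left _)
    rw [← Real.exp_add, Real.exp_le_exp]
    have h1 : (1 : ℝ) ≤ (n : ℝ) ^ 2 := one_le_pow₀ (by exact_mod_cast n.2)
    nlinarith [mul_pos Real.pi_pos ha]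
  refine h.trans (mul_le_mul_of_nonneg_left ((thetaR_le (half_pos ha)).trans (le_of_eq ?_))
    (Real.exp_pos _).le)
  field_simp

theorem summable_theta {w : ℂ} (hw : 0 < w.re) :
    Summable fun n : ℕ+ => cexp (-Real.pi * w * (n : ℂ) ^ 2) := by
  refine Summable.of_norm ?_
  simp only [norm_theta_term]
  exact summable_thetaR hw

theorem norm_theta_le {w : ℂ} (hw : 0 < w.re) : ‖theta w‖ ≤ thetaR w.re := by
  refine (norm_tsum_le_tsum_norm ?_).trans (le_of_eq ?_)
  · simp only [norm_theta_term]; exact summable_thetaR hw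
  · simp only [norm_theta_term]; rfl

theorem theta_ofReal (a : ℝ) : theta a = thetaR a := by
  rw [theta, thetaR, ofReal_tsum]
  simp

theorem continuousOn_theta : ContinuousOn theta {w : ℂ | 0 < w.re} := by
  intro w hw
  have hw' : 0 < w.re := hw
  have hU : IsOpen {z : ℂ | w.re / 2 < z.re} := isOpen_lt continuous_const continuous_re
  have hmem : w ∈ {z : ℂ | w.re / 2 < z.re} := by show w.re / 2 < w.re; linarith
  have : ContinuousOn theta {z : ℂ | w.re / 2 < z.re} := by
    refine continuousOn_tsum (u := fun n : ℕ+ => Real.exp (-Real.pi * (w.re / 2) * (n : ℝ) ^ 2))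
      (fun n => by fun_prop) (summable_thetaR (half_pos hw')) fun n x hx => ?_
    have hx' : w.re / 2 < x.re := hx
    rw [norm_theta_term, Real.exp_le_exp]
    have : (0 : ℝ) ≤ Real.pi * (n : ℝ) ^ 2 := by positivity
    nlinarith
  exact (this.continuousAt (hU.mem_nhds hmem)).continuousWithinAt

/-- The theta function with its singular part at `0` removed. -/
noncomputable def thetaReg (w : ℂ) : ℂ := theta w - 1 / (2 * w ^ (1 / 2 : ℂ))

theorem two_mul_theta_add_one {w : ℂ} (hw : 0 < w.re) :
    2 * theta w + 1 = ∑' n : ℤ, cexp (-Real.pi * w * (n : ℂ) ^ 2) := by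
  have hev : Function.Even fun n : ℤ => cexp (-Real.pi * w * (n : ℂ) ^ 2) := by
    intro n; simp
  have hs : Summable fun n : ℤ => cexp (-Real.pi * w * (n : ℂ) ^ 2) := by
    have h1 : Summable fun n : ℕ => cexp (-Real.pi * w * (n : ℂ) ^ 2) :=
      summable_pnat_iff_summable_nat.1 (summable_theta hw)
    refine Summable.of_nat_of_neg (by simpa using h1) (by simpa using h1)
  rw [tsum_int_eq_zero_add_two_mul_tsum_pnat hev hs]
  simp [theta]
  ring

theorem re_one_div_pos {w : ℂ} (hw : 0 < w.re) : 0 < (1 / w).re := by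
  rw [one_div, inv_re]
  exact div_pos hw (normSq_pos.2 fun h => by simp [h] at hw)

theorem theta_modular {w : ℂ} (hw : 0 < w.re) :
    2 * theta w + 1 = 1 / w ^ (1 / 2 : ℂ) * (2 * theta (1 / w) + 1) := by
  rw [two_mul_theta_add_one hw, two_mul_theta_add_one (re_one_div_pos hw),
    Complex.tsum_exp_neg_mul_int_sq hw]
  congr 2
  funext n
  congr 1
  ring

theorem ne_zero_of_re_pos {w : ℂ} (hw : 0 < w.re) : w ≠ 0 := fun h => by simp [h] at hw

theorem cpow_half_ne_zero {w : ℂ} (hw : 0 < w.re) : w ^ (1 / 2 : ℂ) ≠ 0 := by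
  rw [Ne, cpow_eq_zero_iff]
  exact fun h => ne_zero_of_re_pos hw h.1

theorem thetaReg_eq {w : ℂ} (hw : 0 < w.re) :
    thetaReg w = 1 / w ^ (1 / 2 : ℂ) * theta (1 / w) - 1 / 2 := by
  have h := theta_modular hw
  have h1 := cpow_half_ne_zero hw
  rw [thetaReg]
  field_simp at h ⊢
  linear_combination h

theorem thetaReg_inv {w : ℂ} (hw : 0 < w.re) :
    thetaReg w = 1 / w ^ (1 / 2 : ℂ) * thetaReg (1 / w) := by
  have h1 := cpow_half_ne_zero hw
  rw [thetaReg_eq hw, thetaReg, cpow_neg_eq_inv _ hw, cpow_neg]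
  field_simp

theorem continuousOn_thetaReg : ContinuousOn thetaReg {w : ℂ | 0 < w.re} := by
  refine continuousOn_theta.sub (ContinuousOn.div continuousOn_const ?_ fun w hw =>
    mul_ne_zero two_ne_zero (cpow_half_ne_zero hw))
  refine continuousOn_const.mul fun w hw => ?_
  exact (continuousAt_cpow_const (Or.inl hw)).continuousWithinAt

theorem norm_cpow_half (w : ℂ) : ‖w ^ (1 / 2 : ℂ)‖ = Real.sqrt ‖w‖ := by
  have : (1 / 2 : ℂ) = ((1 / 2 : ℝ) : ℂ) := by push_cast; ring
  rw [this, norm_cpow_real, Real.sqrt_eq_rpow]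

/-- Near `0` the regularised theta function is bounded along rays. -/
theorem norm_thetaReg_le {w : ℂ} (hw : 0 < w.re) :
    ‖thetaReg w‖ ≤ 1 / 2 + Real.sqrt ‖w‖ ^ 3 / w.re := by
  have hn : 0 < ‖w‖ := norm_pos_iff.2 (ne_zero_of_re_pos hw)
  rw [thetaReg_eq hw]
  refine (norm_sub_le _ _).trans ?_
  rw [norm_mul, norm_div, norm_cpow_half]
  have h1 : ‖theta (1 / w)‖ ≤ ‖w‖ ^ 2 / w.re := by
    refine (norm_theta_le (re_one_div_pos hw)).trans ((thetaR_le (re_one_div_pos hw)).trans ?_)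
    rw [one_div w, inv_re, normSq_eq_norm_sq, one_div, inv_div]
  have h2 : Real.sqrt ‖w‖ ^ 2 = ‖w‖ := Real.sq_sqrt hn.le
  have h3 : 0 < Real.sqrt ‖w‖ := Real.sqrt_pos.2 hn
  have h4 : 1 / Real.sqrt ‖w‖ * (‖w‖ ^ 2 / w.re) = Real.sqrt ‖w‖ ^ 3 / w.re := by
    rw [← h2, Real.sqrt_sq h3.le]
    field_simp
  have h5 : ‖(1 : ℂ)‖ / Real.sqrt ‖w‖ * ‖theta (1 / w)‖ ≤ Real.sqrt ‖w‖ ^ 3 / w.re := by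
    rw [← h4, norm_one]
    gcongr
  have h6 : ‖(1 / 2 : ℂ)‖ = 1 / 2 := by simp
  rw [h6]
  linarith

/-- At infinity the regularised theta function has square root decay along rays. -/
theorem norm_thetaReg_le' {w : ℂ} (hw : 0 < w.re) :
    ‖thetaReg w‖ ≤ 1 / w.re + 1 / (2 * Real.sqrt ‖w‖) := by
  refine (norm_sub_le _ _).trans (add_le_add ((norm_theta_le hw).trans (thetaR_le hw)) (le_of_eq ?_))
  rw [norm_div, norm_mul, norm_cpow_half]
  simp

end Theta

end Selberg

namespace Selberg

open Complex Set MeasureTheory Filter Topology Asymptotics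

section Mellin

theorem mul_ofReal_cpow {z : ℂ} (hz : z ≠ 0) {t : ℝ} (ht : 0 < t) (s : ℂ) :
    (z * t) ^ s = z ^ s * (t : ℂ) ^ s := by
  have ht' : (t : ℂ) ≠ 0 := ofReal_ne_zero.2 ht.ne'
  rw [cpow_def_of_ne_zero (mul_ne_zero hz ht'), cpow_def_of_ne_zero hz, cpow_def_of_ne_zero ht',
    ← Complex.exp_add, mul_comm z, Complex.log_ofReal_mul ht hz, ← ofReal_log ht.le]
  ring_nf

theorem re_mul_ofReal_pos {z : ℂ} (hz : 0 < z.re) {t : ℝ} (ht : 0 < t) : 0 < (z * t).re := by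
  rw [re_mul_ofReal]; positivity

theorem continuousOn_theta_ray {z : ℂ} (hz : 0 < z.re) :
    ContinuousOn (fun t : ℝ => theta (z * t)) (Ioi 0) :=
  continuousOn_theta.comp (by fun_prop) fun _ ht => re_mul_ofReal_pos hz ht

theorem hasMellin_const_smul {f : ℝ → ℂ} {s m : ℂ} (h : HasMellin f s m) (c : ℂ) :
    HasMellin (fun t => c • f t) s (c • m) :=
  ⟨h.1.const_smul c, by rw [mellin_const_smul, h.2]⟩

theorem mellin_theta_ray {z s : ℂ} (hz : 0 < z.re) (hs : 1 / 2 < s.re) :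
    mellin (fun t : ℝ => theta (z * t)) s = completedRiemannZeta (2 * s) * z ^ (-s) := by
  have hs0 : 0 < s.re := by linarith
  have hr (n : ℕ+) : 0 < Real.pi * (n : ℝ) ^ 2 := by positivity
  have hre (n : ℕ+) : 0 < ((z * (Real.pi * (n : ℝ) ^ 2 : ℝ)) : ℂ).re := re_mul_ofReal_pos hz (hr n)
  set F : ℕ+ → ℝ → ℂ := fun n t =>
    (t : ℂ) ^ (s - 1) * cexp (-(z * (Real.pi * (n : ℝ) ^ 2 : ℝ) * t)) with hF
  have hnorm (n : ℕ+) : ∫ t in Ioi (0 : ℝ), ‖F n t‖ =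
      (1 / (z.re * Real.pi)) ^ s.re * Real.Gamma s.re * (1 / (n : ℝ) ^ (2 * s.re)) := by
    have h1 : ∀ t ∈ Ioi (0 : ℝ), ‖F n t‖ =
        t ^ (s.re - 1) * Real.exp (-(z.re * (Real.pi * (n : ℝ) ^ 2) * t)) := by
      intro t ht
      rw [hF]
      simp only
      rw [norm_cpow_mul_cexp ht, re_mul_ofReal]
    rw [setIntegral_congr_fun measurableSet_Ioi h1,
      Real.integral_rpow_mul_exp_neg_mul_Ioi hs0 (mul_pos hz (hr n))]
    have hn : (0 : ℝ) < n := by positivity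
    have h2 : (1 / (z.re * (Real.pi * (n : ℝ) ^ 2))) =
        (1 / (z.re * Real.pi)) * (1 / (n : ℝ) ^ 2) := by field_simp
    rw [h2, Real.mul_rpow (by positivity) (by positivity), Real.div_rpow zero_le_one (by positivity),
      Real.one_rpow, Real.one_rpow |> fun _ => Real.div_rpow zero_le_one (by positivity), Real.one_rpow,
      Real.rpow_mul hn.le, Real.rpow_two]
    ring
  have hsum : Summable fun n : ℕ+ => ∫ t in Ioi (0 : ℝ), ‖F n t‖ := by
    simp only [hnorm]
    refine Summable.mul_left _ ?_
    exact (Real.summable_one_div_nat_rpow.2 (by linarith : 1 < 2 * s.re)).comp_injective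
      PNat.coe_injective
  have key := hasSum_integral_of_summable_integral_norm (μ := volume.restrict (Ioi (0 : ℝ)))
    (F := F) (fun n => integrableOn_cpow_mul_cexp hs0 (hre n)) hsum
  have hintv (t : ℝ) : ∑' n, F n t = (t : ℂ) ^ (s - 1) • theta (z * t) := by
    rw [theta, smul_eq_mul, ← tsum_mul_left]
    congr 1
    funext n
    rw [hF]
    simp only
    congr 2
    push_cast; ring
  simp only [hintv] at key
  rw [mellin, ← key.tsum_eq, completedZeta_eq_tsum_of_one_lt_re (by simp; linarith)]
  have hzero : (1 : ℂ) / ((0 : ℕ) : ℂ) ^ (2 * s) = 0 := by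
    have : 2 * s ≠ 0 := fun h => by
      have := congrArg re h
      simp at this
      linarith
    simp [zero_cpow this]
  have hterm (n : ℕ+) : ∫ t in Ioi (0 : ℝ), F n t =
      (Real.pi : ℂ) ^ (-(2 * s) / 2) * Gamma (2 * s / 2) * z ^ (-s) * (1 / (n : ℂ) ^ (2 * s)) := by
    rw [hF]
    simp only
    rw [integral_cpow_mul_cexp hs0 (hre n), mul_ofReal_cpow (ne_zero_of_re_pos hz) (hr n)]
    have hn : (0 : ℝ) < n := by positivity
    have h3 : ((Real.pi * (n : ℝ) ^ 2 : ℝ) : ℂ) ^ (-s) = (Real.pi : ℂ) ^ (-s) * (1 / (n : ℂ) ^ (2 * s)) := by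
      rw [ofReal_mul, mul_ofReal_cpow (by exact_mod_cast Real.pi_ne_zero) (by positivity)]
      congr 1
      have h4 : (((n : ℝ) ^ 2 : ℝ) : ℂ) = ((n : ℝ) : ℂ) * ((n : ℝ) : ℂ) := by push_cast; ring
      have hn0 : (n : ℂ) ≠ 0 := by exact_mod_cast n.ne_zero
      rw [h4, mul_ofReal_cpow (by exact_mod_cast hn.ne') hn, ofReal_natCast,
        ← cpow_add _ _ hn0, one_div, ← cpow_neg]
      congr 1; ring
    rw [h3, show -(2 * s) / 2 = -s by ring, show 2 * s / 2 = s by ring]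
    ring
  simp only [hterm]
  rw [tsum_mul_left, tsum_pnat_eq_tsum_succ (f := fun n : ℕ => 1 / (n : ℂ) ^ (2 * s))]
  have hsm : Summable fun n : ℕ => 1 / (n : ℂ) ^ (2 * s) :=
    Complex.summable_one_div_nat_cpow.2 (by simp; linarith)
  rw [hsm.tsum_eq_zero_add, hzero, zero_add]
  push_cast
  ring

/-- The theta function along a ray, with its singularity removed on `(0, 1]` only. -/
noncomputable def thetaCut (z : ℂ) (t : ℝ) : ℂ :=
  theta (z * t) - 1 / (2 * z ^ (1 / 2 : ℂ)) *
    (Ioc (0 : ℝ) 1).indicator (fun t : ℝ => (t : ℂ) ^ (-(1 / 2) : ℂ)) t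

theorem one_div_two_mul_cpow_half {z : ℂ} (hz : z ≠ 0) {t : ℝ} (ht : 0 < t) :
    1 / (2 * (z * t) ^ (1 / 2 : ℂ)) = 1 / (2 * z ^ (1 / 2 : ℂ)) * (t : ℂ) ^ (-(1 / 2) : ℂ) := by
  rw [mul_ofReal_cpow hz ht, cpow_neg]
  field_simp

theorem hasMellin_cpow_neg_half {s : ℂ} (hs : 1 / 2 < s.re) :
    HasMellin ((Ioc (0 : ℝ) 1).indicator fun t : ℝ => (t : ℂ) ^ (-(1 / 2) : ℂ)) s
      (1 / (s - 1 / 2)) := by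
  have := hasMellin_cpow_Ioc (-(1 / 2) : ℂ) (s := s) (by simp; linarith)
  rwa [← sub_eq_add_neg] at this

theorem locallyIntegrableOn_theta_ray {z : ℂ} (hz : 0 < z.re) :
    LocallyIntegrableOn (fun t : ℝ => theta (z * t)) (Ioi 0) :=
  (continuousOn_theta_ray hz).locallyIntegrableOn measurableSet_Ioi

theorem locallyIntegrableOn_thetaCut {z : ℂ} (hz : 0 < z.re) :
    LocallyIntegrableOn (thetaCut z) (Ioi 0) := by
  refine (locallyIntegrableOn_theta_ray hz).sub ?_
  have h := (hasMellin_cpow_neg_half (s := 1) (by norm_num)).1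
  have h1 : IntegrableOn ((Ioc (0 : ℝ) 1).indicator fun t : ℝ => (t : ℂ) ^ (-(1 / 2) : ℂ)) (Ioi 0) := by
    refine IntegrableOn.congr_fun h (fun t _ => ?_) measurableSet_Ioi
    simp
  exact IntegrableOn.locallyIntegrableOn (h1.const_mul _)

theorem isBigO_theta_atTop {z : ℂ} (hz : 0 < z.re) (a : ℝ) :
    (fun t : ℝ => theta (z * t)) =O[atTop] fun t : ℝ => t ^ (-a) := by
  have h1 : (fun t : ℝ => theta (z * t)) =O[atTop]
      fun t : ℝ => Real.exp (-(Real.pi * z.re / 2) * t) := by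
    refine IsBigO.of_bound (2 / z.re) ?_
    filter_upwards [eventually_ge_atTop 1] with t ht
    have ht0 : 0 < t := by linarith
    refine (norm_theta_le (re_mul_ofReal_pos hz ht0)).trans ?_
    refine (thetaR_le_exp (re_mul_ofReal_pos hz ht0)).trans ?_
    rw [re_mul_ofReal, Real.norm_of_nonneg (Real.exp_pos _).le, mul_comm]
    refine mul_le_mul ?_ (le_of_eq (by congr 1; ring)) (Real.exp_pos _).le (by positivity)
    exact div_le_div_of_nonneg_left (by norm_num) hz (by nlinarith)
  exact h1.trans (isLittleO_exp_neg_mul_rpow_atTop (by have := Real.pi_pos; positivity) _).isBigO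

theorem isBigO_thetaCut_atTop {z : ℂ} (hz : 0 < z.re) (a : ℝ) :
    thetaCut z =O[atTop] fun t : ℝ => t ^ (-a) := by
  refine (isBigO_theta_atTop hz a).congr' ?_ EventuallyEq.rfl
  filter_upwards [eventually_gt_atTop 1] with t ht
  rw [thetaCut, indicator_of_notMem (by simp [ht]), mul_zero, sub_zero]

theorem thetaCut_of_le {z : ℂ} (hz : 0 < z.re) {t : ℝ} (ht : 0 < t) (h1 : t ≤ 1) :
    thetaCut z t = thetaReg (z * t) := by
  rw [thetaCut, thetaReg, indicator_of_mem (show t ∈ Ioc (0 : ℝ) 1 from ⟨ht, h1⟩),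
    one_div_two_mul_cpow_half (ne_zero_of_re_pos hz) ht]

theorem isBigO_thetaCut_zero {z : ℂ} (hz : 0 < z.re) :
    thetaCut z =O[𝓝[>] 0] fun t : ℝ => t ^ (-(0 : ℝ)) := by
  refine IsBigO.of_bound (1 / 2 + Real.sqrt ‖z‖ ^ 3 / z.re) ?_
  filter_upwards [Ioc_mem_nhdsGT (zero_lt_one' ℝ)] with t ht
  rw [thetaCut_of_le hz ht.1 ht.2]
  refine (norm_thetaReg_le (re_mul_ofReal_pos hz ht.1)).trans ?_
  rw [neg_zero, Real.rpow_zero, norm_one, mul_one, re_mul_ofReal, norm_mul, norm_real,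
    Real.norm_of_nonneg ht.1.le, Real.sqrt_mul (norm_nonneg _), mul_pow]
  gcongr 1 / 2 + ?_
  have h3 : Real.sqrt t ^ 3 ≤ t := by
    have h4 := Real.sq_sqrt ht.1.le
    have h5 : Real.sqrt t ≤ 1 := Real.sqrt_le_one.2 ht.2
    have h6 := Real.sqrt_nonneg t
    nlinarith
  rw [div_le_div_iff₀ (mul_pos hz ht.1) hz]
  have : 0 ≤ Real.sqrt ‖z‖ ^ 3 * z.re := by positivity
  nlinarith

theorem mellinConvergent_thetaCut {z s : ℂ} (hz : 0 < z.re) (hs : 0 < s.re) :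
    MellinConvergent (thetaCut z) s :=
  mellinConvergent_of_isBigO_rpow (locallyIntegrableOn_thetaCut hz)
    (isBigO_thetaCut_atTop hz (s.re + 1)) (by linarith) (isBigO_thetaCut_zero hz) hs

theorem mellin_thetaCut_of_half_lt {z s : ℂ} (hz : 0 < z.re) (hs : 1 / 2 < s.re) :
    mellin (thetaCut z) s = completedRiemannZeta (2 * s) * z ^ (-s) -
      1 / (2 * z ^ (1 / 2 : ℂ)) * (1 / (s - 1 / 2)) := by
  have h1 := mellinConvergent_thetaCut hz (s := s) (by linarith)
  have h2 := hasMellin_cpow_neg_half hs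
  have h3 := hasMellin_const_smul h2 (1 / (2 * z ^ (1 / 2 : ℂ)))
  have h4 := hasMellin_add h1 h3.1
  have h5 : (fun t => thetaCut z t + (1 / (2 * z ^ (1 / 2 : ℂ))) •
      (Ioc (0 : ℝ) 1).indicator (fun t : ℝ => (t : ℂ) ^ (-(1 / 2) : ℂ)) t) =
      fun t : ℝ => theta (z * t) := by
    funext t; rw [thetaCut, smul_eq_mul]; ring
  rw [h5] at h4
  have h6 := h4.2
  rw [mellin_theta_ray hz hs, h3.2, smul_eq_mul] at h6
  rw [h6]; ring

theorem mellin_thetaCut {z s : ℂ} (hz : 0 < z.re) (hs : 0 < s.re) (hs' : s ≠ 1 / 2) :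
    mellin (thetaCut z) s = completedRiemannZeta (2 * s) * z ^ (-s) -
      1 / (2 * z ^ (1 / 2 : ℂ)) * (1 / (s - 1 / 2)) := by
  have hz0 := ne_zero_of_re_pos hz
  have hU : IsOpen {s : ℂ | 0 < s.re} := isOpen_re_pos
  set f : ℂ → ℂ := fun s => (s - 1 / 2) * mellin (thetaCut z) s with hf
  set g : ℂ → ℂ := fun s => ((s - 1 / 2) * (completedRiemannZeta₀ (2 * s) - 1 / (2 * s)) + 1 / 2) *
    z ^ (-s) - 1 / (2 * z ^ (1 / 2 : ℂ)) with hg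
  have hga (w : ℂ) (hw : w ≠ 1 / 2) : g w = (w - 1 / 2) * (completedRiemannZeta (2 * w) * z ^ (-w) -
      1 / (2 * z ^ (1 / 2 : ℂ)) * (1 / (w - 1 / 2))) := by
    have h1 : w - 1 / 2 ≠ 0 := sub_ne_zero.2 hw
    have h2 : (1 : ℂ) / (1 - 2 * w) = -(1 / 2) * (1 / (w - 1 / 2)) := by
      have h3 : (1 - 2 * w) = -2 * (w - 1 / 2) := by ring
      rw [h3]; field_simp
    rw [hg]
    simp only
    rw [completedRiemannZeta_eq, h2]
    have h4 : (w - 1 / 2) * (1 / (w - 1 / 2)) = 1 := mul_one_div_cancel h1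
    linear_combination (1 / (2 * z ^ (1 / 2 : ℂ)) - 1 / 2 * z ^ (-w)) * h4
  have hfd : DifferentiableOn ℂ f {s : ℂ | 0 < s.re} := by
    intro w hw
    have hw' : 0 < w.re := hw
    refine (DifferentiableAt.mul (by fun_prop) ?_).differentiableWithinAt
    exact mellin_differentiableAt_of_isBigO_rpow (locallyIntegrableOn_thetaCut hz)
      (isBigO_thetaCut_atTop hz (w.re + 1)) (by linarith) (isBigO_thetaCut_zero hz) hw'
  have hgd : DifferentiableOn ℂ g {s : ℂ | 0 < s.re} := by
    intro w hw
    have hw0 : w ≠ 0 := ne_zero_of_re_pos hw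
    have h0 : DifferentiableAt ℂ (fun s => completedRiemannZeta₀ (2 * s)) w :=
      (differentiable_completedZeta₀ (2 * w)).comp w (by fun_prop)
    have h1 : DifferentiableAt ℂ (fun s : ℂ => 1 / (2 * s)) w :=
      DifferentiableAt.div (by fun_prop) (by fun_prop) (by simpa using hw0)
    have h2 : DifferentiableAt ℂ (fun s : ℂ => z ^ (-s)) w :=
      DifferentiableAt.const_cpow (by fun_prop) (Or.inl hz0)
    exact (((((by fun_prop : DifferentiableAt ℂ (fun s : ℂ => s - 1 / 2) w).mul
      (h0.sub h1)).add_const _).mul h2).sub_const _).differentiableWithinAt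
  have heq : EqOn f g {s : ℂ | 0 < s.re} := by
    refine (hfd.analyticOnNhd hU).eqOn_of_preconnected_of_eventuallyEq (hgd.analyticOnNhd hU)
      isPreconnected_re_pos (z₀ := 1) (by simp) ?_
    have : {w : ℂ | 1 / 2 < w.re} ∈ 𝓝 (1 : ℂ) :=
      (isOpen_lt continuous_const continuous_re).mem_nhds (by simp; norm_num)
    filter_upwards [this] with w hw
    have hw' : 1 / 2 < w.re := hw
    have hne : w ≠ 1 / 2 := fun h => by rw [h] at hw'; norm_num at hw'
    rw [hga w hne, hf]
    simp only
    rw [mellin_thetaCut_of_half_lt hz hw']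
  have := heq hs
  rw [hga s hs', hf] at this
  exact mul_left_cancel₀ (sub_ne_zero.2 hs') this

/-- The Mellin transform of the regularised theta function along a ray. -/
theorem hasMellin_thetaReg {z s : ℂ} (hz : 0 < z.re) (hs : 0 < s.re) (hs' : s.re < 1 / 2) :
    HasMellin (fun t : ℝ => thetaReg (z * t)) s (completedRiemannZeta (2 * s) * z ^ (-s)) := by
  have hne : s ≠ 1 / 2 := fun h => by rw [h] at hs'; norm_num at hs'
  have hre : (s - 1 + -(1 / 2)).re < -1 := by simp; linarith
  set u : ℝ → ℂ := (Ioi (1 : ℝ)).indicator fun t : ℝ => (t : ℂ) ^ (-(1 / 2) : ℂ) with hu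
  have hind : (fun t : ℝ => (t : ℂ) ^ (s - 1) • u t) =
      (Ioi (1 : ℝ)).indicator fun t : ℝ => (t : ℂ) ^ (s - 1 + -(1 / 2)) := by
    funext t
    rw [hu]
    by_cases ht : t ∈ Ioi (1 : ℝ)
    · have ht0 : (t : ℂ) ≠ 0 := ofReal_ne_zero.2 (zero_lt_one.trans ht).ne'
      rw [indicator_of_mem ht, indicator_of_mem ht, cpow_add _ _ ht0, smul_eq_mul]
    · rw [indicator_of_notMem ht, indicator_of_notMem ht, smul_zero]
  have hsub : Ioi (1 : ℝ) ∩ Ioi 0 = Ioi 1 := inter_eq_left.2 (Ioi_subset_Ioi zero_le_one)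
  have h2 : HasMellin u s (-(1 / (s - 1 / 2))) := by
    refine ⟨?_, ?_⟩
    · rw [MellinConvergent, hind]
      exact ((integrableOn_Ioi_cpow_of_lt hre one_pos).integrable_indicator
        measurableSet_Ioi).integrableOn
    · rw [mellin, hind, setIntegral_indicator measurableSet_Ioi, inter_comm, hsub,
        integral_Ioi_cpow_of_lt hre one_pos]
      simp
      rw [neg_div, one_div]
      ring
  have h1 := mellinConvergent_thetaCut hz hs
  have h3 := hasMellin_const_smul h2 (1 / (2 * z ^ (1 / 2 : ℂ)))
  have h4 := hasMellin_sub h1 h3.1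
  rw [h3.2, mellin_thetaCut hz hs hne] at h4
  have h5 : ∀ t ∈ Ioi (0 : ℝ), thetaCut z t - (1 / (2 * z ^ (1 / 2 : ℂ))) • u t =
      thetaReg (z * t) := by
    intro t ht
    rw [thetaCut, thetaReg, one_div_two_mul_cpow_half (ne_zero_of_re_pos hz) ht, hu, smul_eq_mul]
    by_cases h : t ≤ 1
    · rw [indicator_of_mem (show t ∈ Ioc (0 : ℝ) 1 from ⟨ht, h⟩),
        indicator_of_notMem (show t ∉ Ioi (1 : ℝ) from not_lt.2 h)]
      ring
    · rw [indicator_of_notMem (show t ∉ Ioc (0 : ℝ) 1 from fun h' => h h'.2),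
        indicator_of_mem (show t ∈ Ioi (1 : ℝ) from not_le.1 h)]
      ring
  refine ⟨?_, ?_⟩
  · refine IntegrableOn.congr_fun h4.1 (fun t ht => ?_) measurableSet_Ioi
    simp only [h5 t ht]
  · rw [mellin, ← setIntegral_congr_fun (f := fun t : ℝ => (t : ℂ) ^ (s - 1) •
      (thetaCut z t - (1 / (2 * z ^ (1 / 2 : ℂ))) • u t)) measurableSet_Ioi
      (fun t ht => by simp only [h5 t ht])]
    refine h4.2.trans ?_
    rw [smul_eq_mul]
    ring

end Mellin

end Selberg

namespace Selberg

open Complex Set MeasureTheory Filter Topology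
open scoped FourierTransform

section Parseval

theorem integral_norm_sq_fourier {f : ℝ → ℂ} (hc : Continuous f) (hf : Integrable f)
    (hF : Integrable (𝓕 f)) : ∫ ξ, ‖𝓕 f ξ‖ ^ 2 = ∫ x, ‖f x‖ ^ 2 := by
  have h := VectorFourier.integral_sesq_fourierIntegral_eq_neg_flip (μ := volume) (ν := volume)
    (innerSL ℂ) (L := innerₗ ℝ) Real.continuous_fourierChar continuous_inner hf hF
  have h1 (x : ℝ) : VectorFourier.fourierIntegral Real.fourierChar volume (-(innerₗ ℝ).flip) (𝓕 f) x =
      f x := by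
    rw [← congrFun (hc.fourierInv_fourier_eq hf hF) x]
    rw [Real.fourierInv_eq, VectorFourier.fourierIntegral]
    simp
  have h0 (x : ℝ) : VectorFourier.fourierIntegral Real.fourierChar volume (innerₗ ℝ) f x = 𝓕 f x :=
    rfl
  simp only [h1, h0] at h
  have h2 : ∫ ξ, ((‖𝓕 f ξ‖ ^ 2 : ℝ) : ℂ) = ∫ x, ((‖f x‖ ^ 2 : ℝ) : ℂ) := by
    refine Eq.trans ?_ (h.trans ?_)
    · refine integral_congr_ae (ae_of_all _ fun ξ => ?_)
      have := inner_self_eq_norm_sq_to_K (𝕜 := ℂ) (𝓕 f ξ)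
      push_cast; exact this.symm
    · refine integral_congr_ae (ae_of_all _ fun ξ => ?_)
      have := inner_self_eq_norm_sq_to_K (𝕜 := ℂ) (f ξ)
      push_cast; exact this
  rw [integral_complex_ofReal, integral_complex_ofReal] at h2
  exact_mod_cast h2

/-- The Fourier integral `∫ f(v) e^{itv} dv`. -/
noncomputable def four (f : ℝ → ℂ) (t : ℝ) : ℂ := ∫ v : ℝ, cexp (I * t * v) * f v

theorem four_eq (f : ℝ → ℂ) (t : ℝ) : four f t = 𝓕 f (t * (-(2 * Real.pi))⁻¹) := by
  rw [four, Real.fourier_real_eq_integral_exp_smul]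
  congr 1
  funext v
  rw [smul_eq_mul]
  congr 2
  have : (Real.pi : ℂ) ≠ 0 := by exact_mod_cast Real.pi_ne_zero
  push_cast
  field_simp

theorem parseval {f : ℝ → ℂ} (hc : Continuous f) (hf : Integrable f) (hF : Integrable (four f)) :
    ∫ t, ‖four f t‖ ^ 2 = 2 * Real.pi * ∫ x, ‖f x‖ ^ 2 := by
  have hne : (-(2 * Real.pi))⁻¹ ≠ 0 := inv_ne_zero (neg_ne_zero.2 Real.two_pi_pos.ne')
  have h0 : four f = fun t => 𝓕 f (t * (-(2 * Real.pi))⁻¹) := funext (four_eq f)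
  rw [h0] at hF ⊢
  rw [integrable_comp_mul_right_iff _ hne] at hF
  rw [Measure.integral_comp_mul_right (fun ξ => ‖𝓕 f ξ‖ ^ 2), integral_norm_sq_fourier hc hf hF,
    smul_eq_mul, inv_inv, abs_neg, abs_of_pos Real.two_pi_pos]

/-- The kernel `∫_0^H e^{ixv} dx`. -/
noncomputable def window (H v : ℝ) : ℂ := ∫ x in (0 : ℝ)..H, cexp (I * x * v)

theorem norm_cexp_I_mul_mul (x v : ℝ) : ‖cexp (I * x * v)‖ = 1 := by
  rw [mul_assoc, mul_comm, ← ofReal_mul, norm_exp_ofReal_mul_I]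

theorem norm_window_le {H : ℝ} (hH : 0 ≤ H) (v : ℝ) : ‖window H v‖ ≤ H := by
  have := intervalIntegral.norm_integral_le_of_norm_le_const (a := 0) (b := H) (C := 1)
    (f := fun x : ℝ => cexp (I * x * v)) fun x _ => (norm_cexp_I_mul_mul x v).le
  rwa [one_mul, sub_zero, abs_of_nonneg hH] at this

theorem norm_window_le_div (H : ℝ) {v : ℝ} (hv : v ≠ 0) : ‖window H v‖ ≤ 2 / |v| := by
  have hv' : I * (v : ℂ) ≠ 0 := mul_ne_zero I_ne_zero (ofReal_ne_zero.2 hv)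
  have h : window H v = (cexp (I * v * H) - cexp (I * v * (0 : ℝ))) / (I * v) := by
    rw [window, ← integral_exp_mul_complex hv']
    congr 1
    funext x
    congr 1; ring
  rw [h, norm_div, norm_mul, norm_I, one_mul, norm_real, Real.norm_eq_abs]
  gcongr
  refine (norm_sub_le _ _).trans ?_
  rw [norm_cexp_I_mul_mul, norm_cexp_I_mul_mul]
  norm_num

theorem continuous_window (H : ℝ) : Continuous (window H) := by
  unfold window
  exact intervalIntegral.continuous_parametric_intervalIntegral_of_continuous' (by fun_prop) 0 H

theorem four_mul_window {f : ℝ → ℂ} (hf : Integrable f) {H : ℝ} (hH : 0 ≤ H)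
    (t : ℝ) : four (fun v => f v * window H v) t = ∫ x in t..(t + H), four f x := by
  have h1 : ∫ x in t..(t + H), four f x = ∫ x in (0 : ℝ)..H, four f (t + x) := by
    rw [intervalIntegral.integral_comp_add_left (four f) t, add_zero]
  rw [h1, intervalIntegral.integral_of_le hH]
  unfold four
  rw [integral_integral_swap]
  · congr 1
    funext v
    show cexp (I * t * v) * (f v * ∫ x in (0 : ℝ)..H, cexp (I * x * v)) = _
    rw [intervalIntegral.integral_of_le hH, ← integral_const_mul, ← integral_const_mul]
    congr 1
    funext x
    push_cast
    rw [show I * (t + x) * v = I * t * v + I * x * v by ring, Complex.exp_add]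
    ring
  · have h2 : Integrable (fun p : ℝ × ℝ => (1 : ℂ) * f p.2)
        ((volume.restrict (Ioc 0 H)).prod volume) :=
      Integrable.mul_prod (f := fun _ : ℝ => (1 : ℂ)) (integrable_const _) hf
    have h3 : Continuous fun p : ℝ × ℝ => cexp (I * ((t + p.1 : ℝ) : ℂ) * (p.2 : ℂ)) := by fun_prop
    refine (h2.bdd_mul h3.aestronglyMeasurable (c := 1)
      (ae_of_all _ fun p => (norm_cexp_I_mul_mul _ _).le)).congr (ae_of_all _ fun p => ?_)
    simp [Function.uncurry]

theorem parseval_window {f : ℝ → ℂ} (hc : Continuous f) (hf : Integrable f) {H : ℝ} (hH : 0 ≤ H)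
    (hF : Integrable fun t => ∫ x in t..(t + H), four f x) :
    ∫ t, ‖∫ x in t..(t + H), four f x‖ ^ 2 =
      2 * Real.pi * ∫ v, ‖f v‖ ^ 2 * ‖window H v‖ ^ 2 := by
  have h : four (fun v => f v * window H v) = fun t => ∫ x in t..(t + H), four f x :=
    funext (four_mul_window hf hH)
  have h2 := parseval (f := fun v => f v * window H v) (hc.mul (continuous_window H))
    (hf.mul_bdd (c := H) (continuous_window H).aestronglyMeasurable
      (ae_of_all _ (norm_window_le hH))) (by rw [h]; exact hF)
  rw [h] at h2
  simpa [mul_pow] using h2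

end Parseval

end Selberg

namespace Selberg

open Complex Set MeasureTheory Filter Topology

section FourierSide

/-- The regularised theta function along a ray in logarithmic coordinates. -/
noncomputable def rayTheta (z : ℂ) (v : ℝ) : ℂ :=
  (Real.exp (v / 2) : ℂ) * thetaReg (z * (Real.exp (2 * v) : ℝ))

theorem continuous_rayTheta {z : ℂ} (hz : 0 < z.re) : Continuous (rayTheta z) := by
  unfold rayTheta
  refine Continuous.mul (by fun_prop) ?_
  exact continuousOn_thetaReg.comp_continuous (by fun_prop)
    fun v => re_mul_ofReal_pos hz (Real.exp_pos _)

theorem norm_rayTheta_le {z : ℂ} (hz : 0 < z.re) :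
    ∃ C, 0 < C ∧ ∀ v, ‖rayTheta z v‖ ≤ C * Real.exp (-(1 / 2) * |v|) := by
  have hn : 0 < ‖z‖ := norm_pos_iff.2 (ne_zero_of_re_pos hz)
  have hs : 0 < Real.sqrt ‖z‖ := Real.sqrt_pos.2 hn
  set C1 := 1 / 2 + Real.sqrt ‖z‖ ^ 3 / z.re with hC1
  set C2 := 1 / z.re + 1 / (2 * Real.sqrt ‖z‖) with hC2
  have hC1' : 0 < C1 := by positivity
  have hC2' : 0 < C2 := by positivity
  refine ⟨C1 + C2, by positivity, fun v => ?_⟩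
  have hsq : Real.sqrt (‖z‖ * Real.exp (2 * v)) = Real.sqrt ‖z‖ * Real.exp v := by
    rw [Real.sqrt_mul hn.le, show 2 * v = v + v by ring, Real.exp_add,
      Real.sqrt_mul_self (Real.exp_pos _).le]
  have hnorm : ‖z * (Real.exp (2 * v) : ℝ)‖ = ‖z‖ * Real.exp (2 * v) := by
    rw [norm_mul, norm_real, Real.norm_of_nonneg (Real.exp_pos _).le]
  have hpos := re_mul_ofReal_pos hz (Real.exp_pos (2 * v))
  rw [rayTheta, norm_mul, norm_real, Real.norm_of_nonneg (Real.exp_pos _).le]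
  rcases le_total v 0 with hv | hv
  · have h := norm_thetaReg_le hpos
    rw [hnorm, hsq, re_mul_ofReal] at h
    have h1 : (Real.sqrt ‖z‖ * Real.exp v) ^ 3 / (z.re * Real.exp (2 * v)) =
        Real.sqrt ‖z‖ ^ 3 / z.re * Real.exp v := by
      rw [show 2 * v = v + v by ring, Real.exp_add]
      field_simp
    have h2 : Real.exp v ≤ 1 := Real.exp_le_one_iff.2 hv
    have h3 : ‖thetaReg (z * (Real.exp (2 * v) : ℝ))‖ ≤ C1 := by
      rw [h1] at h
      refine h.trans ?_
      have : 0 ≤ Real.sqrt ‖z‖ ^ 3 / z.re := by positivity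
      rw [hC1]
      nlinarith
    rw [abs_of_nonpos hv, show -(1 / 2) * -v = v / 2 by ring, mul_comm]
    gcongr
    linarith
  · have h := norm_thetaReg_le' hpos
    rw [hnorm, hsq, re_mul_ofReal] at h
    have h1 : 1 / (z.re * Real.exp (2 * v)) + 1 / (2 * (Real.sqrt ‖z‖ * Real.exp v)) ≤
        C2 * Real.exp (-v) := by
      rw [hC2, add_mul, Real.exp_neg]
      have h2 : 1 / (z.re * Real.exp (2 * v)) ≤ 1 / z.re * (Real.exp v)⁻¹ := by
        rw [← one_div (Real.exp v), one_div_mul_one_div]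
        apply one_div_le_one_div_of_le (by positivity)
        gcongr
        linarith
      refine add_le_add h2 (le_of_eq ?_)
      field_simp
    calc Real.exp (v / 2) * ‖thetaReg (z * (Real.exp (2 * v) : ℝ))‖
        ≤ Real.exp (v / 2) * (C2 * Real.exp (-v)) := by gcongr; exact h.trans h1
      _ = C2 * Real.exp (-(1 / 2) * |v|) := by
          rw [abs_of_nonneg hv, mul_left_comm, ← Real.exp_add]
          congr 2; ring
      _ ≤ _ := by gcongr; linarith

theorem integrable_exp_neg_abs {c : ℝ} (hc : 0 < c) :
    Integrable fun v : ℝ => Real.exp (-c * |v|) := by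
  rw [← integrableOn_univ, ← Iic_union_Ioi (a := (0 : ℝ)), integrableOn_union]
  constructor
  · refine (integrableOn_exp_mul_Iic hc 0).congr_fun (fun v hv => ?_) measurableSet_Iic
    have hv' : v ≤ 0 := hv
    simp only
    rw [abs_of_nonpos hv']
    ring_nf
  · refine (integrableOn_exp_mul_Ioi (neg_lt_zero.2 hc) 0).congr_fun (fun v hv => ?_)
      measurableSet_Ioi
    have hv' : 0 < v := hv
    simp only
    rw [abs_of_pos hv']

theorem integrable_of_norm_le_exp {f : ℝ → ℂ} (hf : Continuous f) {C c : ℝ} (hc : 0 < c)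
    (h : ∀ v, ‖f v‖ ≤ C * Real.exp (-c * |v|)) : Integrable f :=
  ((integrable_exp_neg_abs hc).const_mul C).mono' hf.aestronglyMeasurable (ae_of_all _ h)

theorem integrable_rayTheta {z : ℂ} (hz : 0 < z.re) : Integrable (rayTheta z) := by
  obtain ⟨C, _, h⟩ := norm_rayTheta_le hz
  exact integrable_of_norm_le_exp (continuous_rayTheta hz) (by norm_num) h

theorem mellin_eq_integral_exp (h : ℝ → ℂ) (s : ℂ) :
    mellin h s = ∫ v : ℝ, 2 * (cexp (2 * s * v) * h (Real.exp (2 * v))) := by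
  have himg : (fun v : ℝ => Real.exp (2 * v)) '' univ = Ioi 0 := by
    rw [image_univ]
    ext x
    constructor
    · rintro ⟨v, rfl⟩; exact Real.exp_pos _
    · intro hx
      refine ⟨Real.log x / 2, ?_⟩
      simp only
      rw [mul_div_cancel₀ _ (two_ne_zero), Real.exp_log hx]
  have hder : ∀ v ∈ univ, HasDerivWithinAt (fun v : ℝ => Real.exp (2 * v)) (Real.exp (2 * v) * 2)
      univ v := fun v _ => by
    have := ((hasDerivAt_id v).const_mul 2).exp
    rw [mul_one] at this
    exact this.hasDerivWithinAt
  have hinj : InjOn (fun v : ℝ => Real.exp (2 * v)) univ := fun a _ b _ hab => by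
    simpa using Real.exp_injective hab
  rw [mellin, ← himg, integral_image_eq_integral_abs_deriv_smul MeasurableSet.univ hder hinj,
    setIntegral_univ]
  congr 1
  funext v
  rw [abs_of_pos (by positivity), real_smul, smul_eq_mul]
  have h1 : ((Real.exp (2 * v) : ℝ) : ℂ) ^ (s - 1) = cexp (2 * v * (s - 1)) := by
    rw [cpow_def_of_ne_zero (by exact_mod_cast (Real.exp_pos _).ne'), ← ofReal_log (Real.exp_pos _).le,
      Real.log_exp]
    push_cast; ring_nf
  rw [h1]
  have h2 : cexp (2 * s * v) = cexp (2 * v) * cexp (2 * v * (s - 1)) := by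
    rw [← Complex.exp_add]; ring_nf
  rw [h2]
  push_cast
  ring

theorem four_rayTheta {z : ℂ} (hz : 0 < z.re) (t : ℝ) :
    four (rayTheta z) t =
      1 / 2 * (completedRiemannZeta (1 / 2 + I * t) * z ^ (-(1 / 4 + I * t / 2) : ℂ)) := by
  have hs : (1 / 4 + I * t / 2 : ℂ).re = 1 / 4 := by simp
  have h := (hasMellin_thetaReg hz (s := 1 / 4 + I * t / 2) (by rw [hs]; norm_num)
    (by rw [hs]; norm_num)).2
  rw [mellin_eq_integral_exp, integral_const_mul,
    show (2 : ℂ) * (1 / 4 + I * t / 2) = 1 / 2 + I * t by ring] at h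
  rw [← h, ← mul_assoc, one_div, inv_mul_cancel₀ two_ne_zero, one_mul, four]
  congr 1
  funext v
  rw [rayTheta, ← mul_assoc]
  congr 1
  rw [ofReal_exp, ← Complex.exp_add]
  congr 1
  push_cast
  ring

theorem four_comp_add (f : ℝ → ℂ) (a t : ℝ) :
    four (fun v => f (v + a)) t = cexp (-(I * t * a)) * four f t := by
  rw [four, four, ← integral_const_mul,
    ← integral_add_right_eq_self (fun v : ℝ => cexp (-(I * t * a)) * (cexp (I * t * v) * f v)) a]
  congr 1
  funext v
  rw [← mul_assoc, ← Complex.exp_add]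
  congr 2
  push_cast
  ring

/-- The mollifying Dirichlet polynomial. -/
noncomputable def mollPoly (N : ℕ) (s : ℂ) : ℂ :=
  ∑ n ∈ Finset.Icc 1 N, (moll N n : ℂ) * (n : ℂ) ^ (1 - s)

/-- The mollified theta function in logarithmic coordinates. -/
noncomputable def mollTheta (N : ℕ) (z : ℂ) (v : ℝ) : ℂ :=
  2 * ∑ m ∈ Finset.Icc 1 N, ∑ n ∈ Finset.Icc 1 N,
    ((moll N m * moll N n * (Real.sqrt m * Real.sqrt n) : ℝ) : ℂ) *
      rayTheta z (v + Real.log (m / n))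

theorem mollTheta_eq (N : ℕ) (z : ℂ) (v : ℝ) :
    mollTheta N z v = 2 * ((Real.exp (v / 2) : ℝ) : ℂ) *
      ∑ m ∈ Finset.Icc 1 N, ∑ n ∈ Finset.Icc 1 N, ((moll N m * moll N n * m : ℝ) : ℂ) *
        thetaReg (z * ((Real.exp (2 * v) * ((m : ℝ) / n) ^ 2 : ℝ) : ℂ)) := by
  rw [mollTheta, mul_assoc]
  congr 1
  rw [Finset.mul_sum]
  refine Finset.sum_congr rfl fun m hm => ?_
  rw [Finset.mul_sum]
  refine Finset.sum_congr rfl fun n hn => ?_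
  have hm0 : (0 : ℝ) < m := by exact_mod_cast (Finset.mem_Icc.1 hm).1
  have hn0 : (0 : ℝ) < n := by exact_mod_cast (Finset.mem_Icc.1 hn).1
  have hq : 0 < (m : ℝ) / n := by positivity
  have h1 : Real.exp (2 * (v + Real.log (m / n))) = Real.exp (2 * v) * ((m : ℝ) / n) ^ 2 := by
    rw [mul_add, Real.exp_add, two_mul (Real.log _), Real.exp_add, Real.exp_log hq]
    ring
  have h2 : Real.exp ((v + Real.log (m / n)) / 2) = Real.exp (v / 2) * Real.sqrt (m / n) := by
    rw [add_div, Real.exp_add, ← Real.log_sqrt hq.le, Real.exp_log (Real.sqrt_pos.2 hq)]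
  have h3 : Real.sqrt m * Real.sqrt n * Real.sqrt (m / n) = m := by
    rw [Real.sqrt_div hm0.le]
    have := Real.sqrt_pos.2 hn0
    field_simp
    exact Real.sq_sqrt hm0.le
  rw [rayTheta, h1, h2, ← mul_assoc, ← ofReal_mul, ← mul_assoc ((Real.exp (v / 2) : ℝ) : ℂ), ← ofReal_mul]
  congr 2
  calc _ = moll N m * moll N n * Real.exp (v / 2) * (Real.sqrt m * Real.sqrt n * Real.sqrt (m / n)) := by
        ring
    _ = _ := by rw [h3]; ring

theorem continuous_mollTheta (N : ℕ) {z : ℂ} (hz : 0 < z.re) : Continuous (mollTheta N z) := by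
  unfold mollTheta
  refine continuous_const.mul (continuous_finsetSum _ fun m _ => continuous_finsetSum _ fun n _ =>
    continuous_const.mul ?_)
  exact (continuous_rayTheta hz).comp (by fun_prop)

theorem norm_mollTheta_le (N : ℕ) {z : ℂ} (hz : 0 < z.re) :
    ∃ C, 0 ≤ C ∧ ∀ v, ‖mollTheta N z v‖ ≤ C * Real.exp (-(1 / 2) * |v|) := by
  obtain ⟨C, hC, h⟩ := norm_rayTheta_le hz
  refine ⟨2 * ∑ m ∈ Finset.Icc 1 N, ∑ n ∈ Finset.Icc 1 N,
    |moll N m * moll N n * (Real.sqrt m * Real.sqrt n)| *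
      (C * Real.exp (1 / 2 * |Real.log ((m : ℝ) / n)|)), by positivity, fun v => ?_⟩
  rw [mollTheta, norm_mul, norm_ofNat, mul_assoc, Finset.sum_mul]
  gcongr
  refine (norm_sum_le _ _).trans (Finset.sum_le_sum fun m _ => ?_)
  rw [Finset.sum_mul]
  refine (norm_sum_le _ _).trans (Finset.sum_le_sum fun n _ => ?_)
  rw [norm_mul, norm_real, Real.norm_eq_abs, mul_assoc |moll N m * moll N n * (Real.sqrt m * Real.sqrt n)|, mul_assoc C, ← Real.exp_add]
  gcongr
  refine (h _).trans ?_
  gcongr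
  have := abs_sub_abs_le_abs_sub v (-Real.log ((m : ℝ) / n))
  rw [abs_neg, sub_neg_eq_add] at this
  linarith

theorem integrable_mollTheta (N : ℕ) {z : ℂ} (hz : 0 < z.re) : Integrable (mollTheta N z) := by
  obtain ⟨C, _, h⟩ := norm_mollTheta_le N hz
  exact integrable_of_norm_le_exp (continuous_mollTheta N hz) (by norm_num) h

theorem natCast_cpow_half_sub {n : ℕ} (hn : 0 < n) (t : ℝ) :
    (n : ℂ) ^ (1 - (1 / 2 + I * t)) = (Real.sqrt n : ℂ) * cexp (-(I * t * Real.log n)) := by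
  have hn0 : (n : ℂ) ≠ 0 := by exact_mod_cast hn.ne'
  have hn1 : (0 : ℝ) < n := by exact_mod_cast hn
  rw [show 1 - (1 / 2 + I * (t : ℂ)) = 1 / 2 + -(I * t) by ring, cpow_add _ _ hn0, cpow_def_of_ne_zero hn0 (-(I * t)),
    Real.sqrt_eq_rpow, ofReal_cpow hn1.le, natCast_log]
  push_cast
  ring_nf

theorem four_mollTheta (N : ℕ) {z : ℂ} (hz : 0 < z.re) (t : ℝ) :
    four (mollTheta N z) t = completedRiemannZeta (1 / 2 + I * t) *
      ((‖mollPoly N (1 / 2 + I * t)‖ ^ 2 : ℝ) : ℂ) * z ^ (-(1 / 4 + I * t / 2) : ℂ) := by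
  have hintv (a : ℝ) (c : ℂ) : Integrable fun v : ℝ => cexp (I * t * v) * (c * rayTheta z (v + a)) := by
    refine (((integrable_rayTheta hz).comp_add_right a).const_mul c).bdd_mul (c := 1)
      (Continuous.aestronglyMeasurable (by fun_prop))
      (ae_of_all _ fun v => (norm_cexp_I_mul_mul t v).le)
  have h1 : four (mollTheta N z) t = 2 * ∑ m ∈ Finset.Icc 1 N, ∑ n ∈ Finset.Icc 1 N,
      ((moll N m * moll N n * (Real.sqrt m * Real.sqrt n) : ℝ) : ℂ) *
        four (fun v => rayTheta z (v + Real.log (m / n))) t := by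
    have h2 : ∀ v : ℝ, cexp (I * t * v) * mollTheta N z v = 2 * ∑ m ∈ Finset.Icc 1 N,
        ∑ n ∈ Finset.Icc 1 N, cexp (I * t * v) *
          (((moll N m * moll N n * (Real.sqrt m * Real.sqrt n) : ℝ) : ℂ) *
            rayTheta z (v + Real.log (m / n))) := by
      intro v
      rw [mollTheta, mul_left_comm, Finset.mul_sum]
      simp only [Finset.mul_sum]
    rw [four]
    simp only [h2]
    rw [integral_const_mul, integral_finsetSum _ fun m _ => integrable_finsetSum _ fun n _ => hintv _ _]
    congr 1
    refine Finset.sum_congr rfl fun m _ => ?_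
    rw [integral_finsetSum _ fun n _ => hintv _ _]
    refine Finset.sum_congr rfl fun n _ => ?_
    rw [four, ← integral_const_mul]
    congr 1
    funext v
    ring
  have h3 : ((‖mollPoly N (1 / 2 + I * t)‖ ^ 2 : ℝ) : ℂ) = ∑ m ∈ Finset.Icc 1 N, ∑ n ∈ Finset.Icc 1 N,
      ((moll N m * moll N n * (Real.sqrt m * Real.sqrt n) : ℝ) : ℂ) *
        cexp (-(I * t * Real.log (m / n))) := by
    rw [ofReal_pow, ← Complex.mul_conj', mollPoly, map_sum, Finset.sum_mul_sum]
    refine Finset.sum_congr rfl fun m hm => Finset.sum_congr rfl fun n hn => ?_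
    have hm0 : (0 : ℝ) < m := by exact_mod_cast (Finset.mem_Icc.1 hm).1
    have hn0 : (0 : ℝ) < n := by exact_mod_cast (Finset.mem_Icc.1 hn).1
    rw [natCast_cpow_half_sub (Finset.mem_Icc.1 hm).1, natCast_cpow_half_sub (Finset.mem_Icc.1 hn).1,
      map_mul, map_mul, conj_ofReal, conj_ofReal, ← exp_conj, map_neg, map_mul, map_mul, conj_I,
      conj_ofReal, conj_ofReal, Real.log_div hm0.ne' hn0.ne', ofReal_sub,
      show -(I * t * ((Real.log m : ℂ) - Real.log n)) =
        -(I * t * Real.log m) + -(-I * t * Real.log n) by ring, Complex.exp_add]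
    push_cast
    ring
  rw [h1, h3]
  simp only [four_comp_add, four_rayTheta hz, Finset.mul_sum, Finset.sum_mul]
  refine Finset.sum_congr rfl fun m _ => Finset.sum_congr rfl fun n _ => ?_
  ring

end FourierSide

end Selberg

namespace Selberg

open Complex Set MeasureTheory Filter Topology ComplexConjugate

section Hardy

theorem conj_theta (w : ℂ) : theta (conj w) = conj (theta w) := by
  rw [theta, theta, conj_tsum]
  congr 1
  funext n
  rw [← exp_conj]
  simp

theorem conj_cpow_half {w : ℂ} (hw : 0 < w.re) : (conj w) ^ (1 / 2 : ℂ) = conj (w ^ (1 / 2 : ℂ)) := by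
  have h : w.arg ≠ Real.pi := fun h => by
    have := (Complex.arg_eq_pi_iff.1 h).1
    linarith
  have h' : (conj w).arg ≠ Real.pi := fun h => by
    have := (Complex.arg_eq_pi_iff.1 h).1
    rw [conj_re] at this
    linarith
  have := cpow_conj (conj w) (1 / 2) h'
  rw [conj_conj] at this
  rw [← this]
  congr 1
  simp [map_ofNat]

theorem conj_thetaReg {w : ℂ} (hw : 0 < w.re) : thetaReg (conj w) = conj (thetaReg w) := by
  rw [thetaReg, thetaReg, conj_theta, conj_cpow_half hw, map_sub, map_div₀, map_mul, map_one,
    map_ofNat]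

/-- The point of the unit circle with argument `α`. -/
noncomputable def ray (α : ℝ) : ℂ := cexp (α * I)

theorem ray_re (α : ℝ) : (ray α).re = Real.cos α := exp_ofReal_mul_I_re α

theorem norm_ray (α : ℝ) : ‖ray α‖ = 1 := norm_exp_ofReal_mul_I α

theorem rayTheta_neg {z : ℂ} (hz : 0 < z.re) (h1 : ‖z‖ = 1) (v : ℝ) :
    rayTheta z (-v) = 1 / z ^ (1 / 2 : ℂ) * conj (rayTheta z v) := by
  have hz0 := ne_zero_of_re_pos hz
  have he : ((Real.exp (2 * -v) : ℝ) : ℂ) ≠ 0 := by exact_mod_cast (Real.exp_pos _).ne'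
  have hinv : 1 / (z * (Real.exp (2 * -v) : ℝ)) = conj (z * (Real.exp (2 * v) : ℝ)) := by
    have h2 : z⁻¹ = conj z := by
      rw [inv_def, normSq_eq_norm_sq, h1]; simp
    rw [one_div, mul_inv, h2, map_mul, conj_ofReal, ← ofReal_inv, ← Real.exp_neg]
    congr 3
    ring
  have hroot : ((Real.exp (2 * -v) : ℝ) : ℂ) ^ (1 / 2 : ℂ) = ((Real.exp (-v) : ℝ) : ℂ) := by
    have := ofReal_cpow (Real.exp_pos (2 * -v)).le (1 / 2)
    rw [show (1 / 2 : ℂ) = ((1 / 2 : ℝ) : ℂ) by push_cast; rfl, ← this, ← Real.exp_mul]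
    congr 2
    ring
  rw [rayTheta, rayTheta, thetaReg_inv (re_mul_ofReal_pos hz (Real.exp_pos _)), hinv,
    conj_thetaReg (re_mul_ofReal_pos hz (Real.exp_pos _)), mul_ofReal_cpow hz0 (Real.exp_pos _),
    hroot, map_mul, conj_ofReal]
  have h3 : ((Real.exp (-v / 2) : ℝ) : ℂ) = ((Real.exp (v / 2) : ℝ) : ℂ) * ((Real.exp (-v) : ℝ) : ℂ) := by
    rw [← ofReal_mul, ← Real.exp_add]
    congr 2
    ring
  rw [h3]
  have h4 : ((Real.exp (-v) : ℝ) : ℂ) ≠ 0 := by exact_mod_cast (Real.exp_pos _).ne'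
  have h5 := cpow_half_ne_zero hz
  field_simp

theorem norm_mollTheta_neg (N : ℕ) {z : ℂ} (hz : 0 < z.re) (h1 : ‖z‖ = 1) (v : ℝ) :
    ‖mollTheta N z (-v)‖ = ‖mollTheta N z v‖ := by
  have h : mollTheta N z (-v) = 1 / z ^ (1 / 2 : ℂ) * conj (mollTheta N z v) := by
    rw [mollTheta, Finset.sum_comm, mollTheta, map_mul, map_ofNat, map_sum, mul_left_comm]
    congr 1
    rw [Finset.mul_sum]
    refine Finset.sum_congr rfl fun m _ => ?_
    rw [map_sum, Finset.mul_sum]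
    refine Finset.sum_congr rfl fun n _ => ?_
    have h2 : -v + Real.log ((n : ℝ) / m) = -(v + Real.log (m / n)) := by
      rw [← inv_div, Real.log_inv]; ring
    rw [h2, rayTheta_neg hz h1, map_mul, conj_ofReal, mul_left_comm]
    congr 2
    congr 1
    ring
  rw [h, norm_mul, norm_div, norm_cpow_half, h1]
  simp

theorem norm_mollTheta_abs (N : ℕ) {z : ℂ} (hz : 0 < z.re) (h1 : ‖z‖ = 1) (v : ℝ) :
    ‖mollTheta N z |v|‖ = ‖mollTheta N z v‖ := by
  rcases abs_cases v with h | h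
  · rw [h.1]
  · rw [h.1, norm_mollTheta_neg N hz h1]

/-- The completed zeta function on the critical line. -/
noncomputable def xi (t : ℝ) : ℝ := (completedRiemannZeta (1 / 2 + I * t)).re

theorem half_add_ne_zero (t : ℝ) : (1 / 2 + I * t : ℂ) ≠ 0 := fun h => by
  have := congrArg re h
  norm_num at this

theorem half_add_ne_one (t : ℝ) : (1 / 2 + I * t : ℂ) ≠ 1 := fun h => by
  have := congrArg re h
  norm_num at this

theorem completedRiemannZeta_eq_mul {s : ℂ} (hs : 0 < s.re) :
    completedRiemannZeta s = riemannZeta s * Gammaℝ s := by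
  rw [riemannZeta_def_of_ne_zero (ne_zero_of_re_pos hs),
    div_mul_cancel₀ _ (Gammaℝ_ne_zero_of_re_pos hs)]

theorem ofReal_xi (t : ℝ) : (xi t : ℂ) = completedRiemannZeta (1 / 2 + I * t) := by
  have hre : (0 : ℝ) < (1 / 2 + I * t : ℂ).re := by simp
  have hconj : conj (1 / 2 + I * t : ℂ) = 1 - (1 / 2 + I * t) := by
    rw [map_add, map_mul, conj_I, conj_ofReal, map_div₀, map_one, map_ofNat]
    ring
  have hG : Gammaℝ (conj (1 / 2 + I * t : ℂ)) = conj (Gammaℝ (1 / 2 + I * t)) := by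
    have hpi : (Real.pi : ℂ).arg ≠ Real.pi := by
      rw [arg_ofReal_of_nonneg Real.pi_pos.le]; exact Real.pi_ne_zero.symm
    rw [Gammaℝ_def, Gammaℝ_def, map_mul, ← Gamma_conj, map_div₀, map_ofNat]
    congr 1
    rw [show -conj (1 / 2 + I * t : ℂ) / 2 = conj (-(1 / 2 + I * t) / 2) by
      rw [map_div₀, map_neg, map_ofNat], cpow_conj _ _ hpi, conj_ofReal]
  have h : conj (completedRiemannZeta (1 / 2 + I * t)) = completedRiemannZeta (1 / 2 + I * t) := by
    rw [completedRiemannZeta_eq_mul hre, map_mul, ← riemannZeta_conj, ← hG,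
      ← completedRiemannZeta_eq_mul (by rwa [conj_re]), hconj, completedRiemannZeta_one_sub,
      completedRiemannZeta_eq_mul hre]
  rw [xi]
  exact Complex.conj_eq_iff_re.1 h

theorem continuous_xi : Continuous xi := by
  refine continuous_re.comp (continuous_iff_continuousAt.2 fun t => ?_)
  exact (differentiableAt_completedZeta (half_add_ne_zero t) (half_add_ne_one t)).continuousAt.comp
    (f := fun t : ℝ => (1 / 2 + I * t : ℂ)) (by fun_prop)

theorem continuous_mollPoly (N : ℕ) : Continuous fun t : ℝ => mollPoly N (1 / 2 + I * t) := by
  unfold mollPoly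
  refine continuous_finsetSum _ fun n hn => ?_
  have hn0 : (n : ℂ) ≠ 0 := by exact_mod_cast (Nat.pos_of_ne_zero (by
    have := (Finset.mem_Icc.1 hn).1; omega)).ne'
  exact continuous_const.mul (Continuous.const_cpow (by fun_prop) (Or.inl hn0))

/-- The mollified Hardy function, weighted by `e^{αt/2}`. -/
noncomputable def hardy (N : ℕ) (α t : ℝ) : ℝ :=
  xi t * ‖mollPoly N (1 / 2 + I * t)‖ ^ 2 * Real.exp (α * t / 2)

theorem continuous_hardy (N : ℕ) (α : ℝ) : Continuous (hardy N α) :=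
  (continuous_xi.mul ((continuous_mollPoly N).norm.pow 2)).mul (by fun_prop)

theorem ray_cpow {α : ℝ} (h : |α| < Real.pi) (s : ℂ) : ray α ^ s = cexp (α * I * s) := by
  rw [ray, cpow_def_of_ne_zero (exp_ne_zero _), log_exp]
  · simpa using (abs_lt.1 h).1
  · simpa using (abs_lt.1 h).2.le

theorem ray_re_pos {α : ℝ} (h : |α| < Real.pi / 2) : 0 < (ray α).re := by
  rw [ray_re]
  exact Real.cos_pos_of_mem_Ioo (abs_lt.1 h)

theorem four_mollTheta_ray (N : ℕ) {α : ℝ} (h : |α| < Real.pi / 2) (t : ℝ) :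
    four (mollTheta N (ray α)) t = cexp (((-(α / 4) : ℝ) : ℂ) * I) * (hardy N α t : ℂ) := by
  rw [four_mollTheta N (ray_re_pos h), ray_cpow (h.trans (by linarith [Real.pi_pos])), hardy,
    ← ofReal_xi, show (α : ℂ) * I * -(1 / 4 + I * t / 2) = ((-(α / 4) : ℝ) : ℂ) * I +
      ((α * t / 2 : ℝ) : ℂ) by
        push_cast
        linear_combination (-(α * t / 2) : ℂ) * I_mul_I, Complex.exp_add]
  push_cast
  ring

theorem norm_four_mollTheta_ray (N : ℕ) {α : ℝ} (h : |α| < Real.pi / 2) (t : ℝ) :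
    ‖four (mollTheta N (ray α)) t‖ = |hardy N α t| := by
  rw [four_mollTheta_ray N h, norm_mul, norm_exp_ofReal_mul_I, one_mul, norm_real, Real.norm_eq_abs]

theorem abs_hardy_le (N : ℕ) {α : ℝ} (h : |α| < Real.pi / 2) :
    ∃ C, ∀ t, |hardy N α t| ≤ C := by
  refine ⟨∫ v, ‖mollTheta N (ray α) v‖, fun t => ?_⟩
  rw [← norm_four_mollTheta_ray N h, four]
  refine (norm_integral_le_integral_norm _).trans (le_of_eq ?_)
  simp only [norm_mul, norm_cexp_I_mul_mul, one_mul]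

theorem hardy_eq_mul (N : ℕ) (α β t : ℝ) :
    hardy N α t = hardy N β t * Real.exp ((α - β) * t / 2) := by
  rw [hardy, hardy, mul_assoc _ (Real.exp _), ← Real.exp_add]
  congr 2
  ring

theorem abs_hardy_le_exp (N : ℕ) {α : ℝ} (h0 : 0 < α) (h : α < Real.pi / 2) :
    ∃ C c, 0 ≤ C ∧ 0 < c ∧ ∀ t, |hardy N α t| ≤ C * Real.exp (-c * |t|) := by
  set β := (α + Real.pi / 2) / 2 with hβ
  obtain ⟨C1, h1⟩ := abs_hardy_le N (α := 0) (by simpa using Real.pi_div_two_pos)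
  obtain ⟨C2, h2⟩ := abs_hardy_le N (α := β) (by rw [abs_of_pos (by linarith)]; linarith)
  have hC1 : 0 ≤ C1 := (abs_nonneg _).trans (h1 0)
  have hC2 : 0 ≤ C2 := (abs_nonneg _).trans (h2 0)
  refine ⟨C1 + C2, min (α / 2) ((β - α) / 2), by positivity,
    lt_min (by linarith) (by linarith), fun t => ?_⟩
  rcases le_total 0 t with ht | ht
  · rw [hardy_eq_mul N α β, abs_mul, abs_of_pos (Real.exp_pos _), abs_of_nonneg ht]
    have := min_le_right (α / 2) ((β - α) / 2)
    refine mul_le_mul ((h2 t).trans (by linarith)) (Real.exp_le_exp.2 (by nlinarith))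
      (Real.exp_pos _).le (by positivity)
  · rw [hardy_eq_mul N α 0, abs_mul, abs_of_pos (Real.exp_pos _), abs_of_nonpos ht]
    have := min_le_left (α / 2) ((β - α) / 2)
    refine mul_le_mul ((h1 t).trans (by linarith)) (Real.exp_le_exp.2 (by nlinarith))
      (Real.exp_pos _).le (by positivity)

theorem four_mollTheta_ray_fun (N : ℕ) {α : ℝ} (h : |α| < Real.pi / 2) :
    four (mollTheta N (ray α)) =
      fun t => cexp (((-(α / 4) : ℝ) : ℂ) * I) * (hardy N α t : ℂ) :=
  funext (four_mollTheta_ray N h)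

theorem integrable_hardy (N : ℕ) {α : ℝ} (h0 : 0 < α) (h : α < Real.pi / 2) :
    Integrable (hardy N α) := by
  obtain ⟨C, c, _, hc, hb⟩ := abs_hardy_le_exp N h0 h
  exact ((integrable_exp_neg_abs hc).const_mul C).mono' (continuous_hardy N α).aestronglyMeasurable
    (ae_of_all _ hb)

theorem integrable_mollTheta_sq (N : ℕ) {z : ℂ} (hz : 0 < z.re) :
    Integrable fun v => ‖mollTheta N z v‖ ^ 2 := by
  obtain ⟨C, hC, h⟩ := norm_mollTheta_le N hz
  refine ((integrable_exp_neg_abs one_pos).const_mul (C ^ 2)).mono'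
    ((continuous_mollTheta N hz).norm.pow 2).aestronglyMeasurable (ae_of_all _ fun v => ?_)
  rw [Real.norm_of_nonneg (by positivity)]
  refine (pow_le_pow_left₀ (norm_nonneg _) (h v) 2).trans (le_of_eq ?_)
  rw [mul_pow, ← Real.exp_nat_mul]
  congr 2
  push_cast; ring

theorem integral_hardy_sq (N : ℕ) {α : ℝ} (h0 : 0 < α) (h : α < Real.pi / 2) :
    ∫ t, hardy N α t ^ 2 = 4 * Real.pi * ∫ v in Ioi 0, ‖mollTheta N (ray α) v‖ ^ 2 := by
  have h' : |α| < Real.pi / 2 := by rwa [abs_of_pos h0]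
  have hz := ray_re_pos h'
  have h1 := parseval (continuous_mollTheta N hz) (integrable_mollTheta N hz)
    (by rw [four_mollTheta_ray_fun N h']; exact (integrable_hardy N h0 h).ofReal.const_mul _)
  simp only [norm_four_mollTheta_ray N h', sq_abs] at h1
  have h2 := integral_comp_abs (f := fun v => ‖mollTheta N (ray α) v‖ ^ 2)
  simp only [norm_mollTheta_abs N hz (norm_ray α)] at h2
  rw [h1, h2]
  ring

theorem integrable_hardy_sq (N : ℕ) {α : ℝ} (h0 : 0 < α) (h : α < Real.pi / 2) :
    Integrable fun t => hardy N α t ^ 2 := by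
  obtain ⟨C, hb⟩ := abs_hardy_le N (α := α) (by rwa [abs_of_pos h0])
  refine ((integrable_hardy N h0 h).bdd_mul (c := C) (continuous_hardy N α).aestronglyMeasurable
    (ae_of_all _ hb)).congr (ae_of_all _ fun t => ?_)
  simp only
  ring

theorem abs_intervalIntegral_hardy_le (N : ℕ) {α : ℝ} (h0 : 0 < α) (h : α < Real.pi / 2)
    {H : ℝ} (hH : 0 ≤ H) : ∃ C c, 0 ≤ C ∧ 0 < c ∧
      ∀ t, |∫ x in t..(t + H), hardy N α x| ≤ C * Real.exp (-c * |t|) := by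
  obtain ⟨C, c, hC, hc, hb⟩ := abs_hardy_le_exp N h0 h
  refine ⟨C * Real.exp (c * H) * H, c, by positivity, hc, fun t => ?_⟩
  have := intervalIntegral.norm_integral_le_of_norm_le_const (a := t) (b := t + H)
    (C := C * Real.exp (c * H) * Real.exp (-c * |t|)) (f := hardy N α) fun x hx => ?_
  · rw [Real.norm_eq_abs, add_sub_cancel_left, abs_of_nonneg hH] at this
    linarith
  · rw [uIoc_of_le (by linarith)] at hx
    refine (hb x).trans ?_
    rw [mul_assoc, ← Real.exp_add]
    gcongr
    have : |t| ≤ |x| + H := by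
      have h3 := abs_sub_abs_le_abs_sub t x
      have h4 : |t - x| ≤ H := abs_le.2 ⟨by linarith [hx.2], by linarith [hx.1]⟩
      linarith
    nlinarith

theorem continuous_intervalIntegral_add {f : ℝ → ℝ} (hf : Continuous f) (H : ℝ) :
    Continuous fun t => ∫ x in t..(t + H), f x := by
  have h (t : ℝ) : ∫ x in t..(t + H), f x = (∫ x in (0 : ℝ)..(t + H), f x) - ∫ x in (0 : ℝ)..t, f x :=
    (intervalIntegral.integral_interval_sub_left (hf.intervalIntegrable _ _)
      (hf.intervalIntegrable _ _)).symm
  simp only [h]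
  have hp := intervalIntegral.continuous_primitive (fun a b => hf.intervalIntegrable (μ := volume) a b) 0
  exact (hp.comp (by fun_prop)).sub hp

theorem integrable_intervalIntegral_hardy (N : ℕ) {α : ℝ} (h0 : 0 < α) (h : α < Real.pi / 2)
    {H : ℝ} (hH : 0 ≤ H) : Integrable fun t => ∫ x in t..(t + H), hardy N α x := by
  obtain ⟨C, c, _, hc, hb⟩ := abs_intervalIntegral_hardy_le N h0 h hH
  exact ((integrable_exp_neg_abs hc).const_mul C).mono'
    (continuous_intervalIntegral_add (continuous_hardy N α) H).aestronglyMeasurable (ae_of_all _ hb)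

theorem integrable_intervalIntegral_hardy_sq (N : ℕ) {α : ℝ} (h0 : 0 < α) (h : α < Real.pi / 2)
    {H : ℝ} (hH : 0 ≤ H) : Integrable fun t => (∫ x in t..(t + H), hardy N α x) ^ 2 := by
  obtain ⟨C, c, hC, hc, hb⟩ := abs_intervalIntegral_hardy_le N h0 h hH
  refine ((integrable_intervalIntegral_hardy N h0 h hH).bdd_mul (c := C)
    (continuous_intervalIntegral_add (continuous_hardy N α) H).aestronglyMeasurable
    (ae_of_all _ fun t => (hb t).trans ?_)).congr (ae_of_all _ fun t => ?_)
  · exact mul_le_of_le_one_right hC (Real.exp_le_one_iff.2 (by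
      have := abs_nonneg t
      nlinarith))
  · simp only
    ring

theorem integral_intervalIntegral_hardy_sq_le (N : ℕ) {α : ℝ} (h0 : 0 < α) (h : α < Real.pi / 2)
    {H V : ℝ} (hH : 0 ≤ H) (hV : 0 < V) :
    ∫ t, (∫ x in t..(t + H), hardy N α x) ^ 2 ≤
      4 * Real.pi * (H ^ 2 * (∫ v in (0 : ℝ)..V, ‖mollTheta N (ray α) v‖ ^ 2) +
        4 / V ^ 2 * ∫ v in Ioi 0, ‖mollTheta N (ray α) v‖ ^ 2) := by
  have h' : |α| < Real.pi / 2 := by rwa [abs_of_pos h0]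
  have hz := ray_re_pos h'
  set c0 : ℂ := cexp (((-(α / 4) : ℝ) : ℂ) * I) with hc0
  have hc0n : ‖c0‖ = 1 := norm_exp_ofReal_mul_I _
  have hintv (t : ℝ) : ∫ x in t..(t + H), four (mollTheta N (ray α)) x =
      c0 * ((∫ x in t..(t + H), hardy N α x : ℝ) : ℂ) := by
    rw [four_mollTheta_ray_fun N h', intervalIntegral.integral_const_mul,
      intervalIntegral.integral_ofReal]
  have h1 := parseval_window (continuous_mollTheta N hz) (integrable_mollTheta N hz) hH
    (by simp only [hintv]; exact (integrable_intervalIntegral_hardy N h0 h hH).ofReal.const_mul _)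
  simp only [hintv, norm_mul, hc0n, one_mul, norm_real, Real.norm_eq_abs, sq_abs] at h1
  set g : ℝ → ℝ := fun v => ‖mollTheta N (ray α) v‖ ^ 2 with hg
  have hgint : Integrable g := integrable_mollTheta_sq N hz
  set k : ℝ → ℝ := fun v => if v ≤ V then H ^ 2 else 4 / V ^ 2 with hk
  have hkm : Measurable k := Measurable.ite measurableSet_Iic measurable_const measurable_const
  have hkb (v : ℝ) : ‖k v‖ ≤ H ^ 2 + 4 / V ^ 2 := by
    have h3 : 0 ≤ H ^ 2 := by positivity
    have h4 : 0 ≤ 4 / V ^ 2 := by positivity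
    simp only [hk]
    split_ifs
    · rw [Real.norm_of_nonneg h3]; linarith
    · rw [Real.norm_of_nonneg h4]; linarith
  have hgk : Integrable fun v => g v * k |v| :=
    hgint.mul_bdd (hkm.comp measurable_abs).aestronglyMeasurable (ae_of_all _ fun v => hkb _)
  have hgk' : Integrable fun v => g v * k v :=
    hgint.mul_bdd hkm.aestronglyMeasurable (ae_of_all _ fun v => hkb _)
  have hwk (v : ℝ) : ‖window H v‖ ^ 2 ≤ k |v| := by
    simp only [hk]
    split_ifs with hv
    · exact pow_le_pow_left₀ (norm_nonneg _) (norm_window_le hH v) 2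
    · have hv' := not_le.1 hv
      have hv0 : v ≠ 0 := abs_pos.1 (hV.trans hv')
      calc ‖window H v‖ ^ 2 ≤ (2 / |v|) ^ 2 :=
            pow_le_pow_left₀ (norm_nonneg _) (norm_window_le_div H hv0) 2
        _ ≤ (2 / V) ^ 2 := by gcongr
        _ = _ := by rw [div_pow]; norm_num
  have h2 : ∫ v, ‖mollTheta N (ray α) v‖ ^ 2 * ‖window H v‖ ^ 2 ≤ ∫ v, g |v| * k |v| := by
    have he : (fun v => g |v| * k |v|) = fun v => g v * k |v| := by
      funext v
      simp only [hg]
      rw [norm_mollTheta_abs N hz (norm_ray α)]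
    rw [he]
    refine integral_mono_of_nonneg (ae_of_all _ fun v => by positivity) hgk (ae_of_all _ fun v => ?_)
    exact mul_le_mul_of_nonneg_left (hwk v) (by positivity)
  rw [integral_comp_abs (f := fun v => g v * k v), ← Ioc_union_Ioi_eq_Ioi hV.le,
    setIntegral_union (Ioc_disjoint_Ioi le_rfl) measurableSet_Ioi hgk'.integrableOn
      hgk'.integrableOn] at h2
  have h3 : ∫ v in Ioc 0 V, g v * k v = H ^ 2 * ∫ v in (0 : ℝ)..V, g v := by
    rw [intervalIntegral.integral_of_le hV.le, ← integral_const_mul]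
    refine setIntegral_congr_fun measurableSet_Ioc fun v hv => ?_
    simp only [hk]
    rw [if_pos hv.2]
    ring
  have h4 : ∫ v in Ioi V, g v * k v ≤ 4 / V ^ 2 * ∫ v in Ioi 0, g v := by
    have h5 : ∫ v in Ioi V, g v * k v = 4 / V ^ 2 * ∫ v in Ioi V, g v := by
      rw [← integral_const_mul]
      refine setIntegral_congr_fun measurableSet_Ioi fun v hv => ?_
      simp only [hk]
      rw [if_neg (not_le.2 hv)]
      ring
    rw [h5]
    refine mul_le_mul_of_nonneg_left (setIntegral_mono_set hgint.integrableOn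
      (ae_of_all _ fun v => ?_) (Ioi_subset_Ioi hV.le).eventuallyLE) (by positivity)
    simp only [hg, Pi.zero_apply]
    positivity
  rw [h1]
  have := Real.pi_pos
  nlinarith

end Hardy

end Selberg

namespace Selberg

open Complex Set MeasureTheory Filter Topology ComplexConjugate

section OffDiagonal

theorem norm_cexp_neg_mul_exp_le {c : ℂ} (hc : 0 ≤ c.re) {v : ℝ} (hv : 0 ≤ v) :
    ‖cexp (-c * (Real.exp (2 * v) : ℝ))‖ ≤ Real.exp (-c.re) := by
  rw [norm_exp, re_mul_ofReal, neg_re]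
  have : 1 ≤ Real.exp (2 * v) := Real.one_le_exp (by linarith)
  exact Real.exp_le_exp.2 (by nlinarith)

theorem norm_integral_exp_mul_cexp_le {c : ℂ} (hc : 0 ≤ c.re) (hc0 : c ≠ 0) {ε V : ℝ}
    (hε : ε ≤ 1) (hV : 0 ≤ V) :
    ‖∫ v in (0 : ℝ)..V, ((Real.exp ((1 + ε) * v) : ℝ) : ℂ) * cexp (-c * (Real.exp (2 * v) : ℝ))‖ ≤
      Real.exp (-c.re) / ‖c‖ := by
  set γ : ℝ := ε - 1 with hγ
  have hγ0 : γ ≤ 0 := by linarith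
  have hu (x : ℝ) : HasDerivAt (fun v : ℝ => ((Real.exp (γ * v) : ℝ) : ℂ))
      ((γ * Real.exp (γ * x) : ℝ) : ℂ) x := by
    refine HasDerivAt.ofReal_comp ?_
    have := ((hasDerivAt_id x).const_mul γ).exp
    simp only [id, mul_one] at this
    rwa [mul_comm] at this
  have hE (x : ℝ) : HasDerivAt (fun v : ℝ => cexp (-c * (Real.exp (2 * v) : ℝ)))
      (-(2 * c) * ((Real.exp (2 * x) : ℝ) : ℂ) * cexp (-c * (Real.exp (2 * x) : ℝ))) x := by
    have h1 : HasDerivAt (fun v : ℝ => ((Real.exp (2 * v) : ℝ) : ℂ))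
        ((Real.exp (2 * x) * 2 : ℝ) : ℂ) x := by
      refine HasDerivAt.ofReal_comp ?_
      have := ((hasDerivAt_id x).const_mul 2).exp
      simpa only [id, mul_one] using this
    refine ((h1.const_mul (-c)).cexp).congr_deriv ?_
    push_cast
    ring
  have hi := intervalIntegral.integral_mul_deriv_eq_deriv_mul (a := 0) (b := V) (fun x _ => hu x)
    (fun x _ => hE x)
    (Continuous.intervalIntegrable (by fun_prop) _ _)
    (Continuous.intervalIntegrable (by fun_prop) _ _)
  have hl : ∫ x in (0 : ℝ)..V, ((Real.exp (γ * x) : ℝ) : ℂ) *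
      (-(2 * c) * ((Real.exp (2 * x) : ℝ) : ℂ) * cexp (-c * (Real.exp (2 * x) : ℝ))) =
      -(2 * c) * ∫ v in (0 : ℝ)..V, ((Real.exp ((1 + ε) * v) : ℝ) : ℂ) *
        cexp (-c * (Real.exp (2 * v) : ℝ)) := by
    rw [← intervalIntegral.integral_const_mul]
    congr 1
    funext x
    rw [show (1 + ε) * x = γ * x + 2 * x by rw [hγ]; ring, Real.exp_add]
    push_cast
    ring
  have hγi : ∫ x in (0 : ℝ)..V, -(γ * Real.exp (γ * x)) = 1 - Real.exp (γ * V) := by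
    have h2 (x : ℝ) : HasDerivAt (fun v : ℝ => -Real.exp (γ * v)) (-(γ * Real.exp (γ * x))) x := by
      have := (((hasDerivAt_id x).const_mul γ).exp).neg
      simp only [id, mul_one] at this
      rwa [mul_comm (Real.exp _)] at this
    rw [intervalIntegral.integral_eq_sub_of_hasDerivAt (fun x _ => h2 x)
      (Continuous.intervalIntegrable (by fun_prop) _ _)]
    simp
    ring
  have hb : ‖∫ x in (0 : ℝ)..V, ((γ * Real.exp (γ * x) : ℝ) : ℂ) *
      cexp (-c * (Real.exp (2 * x) : ℝ))‖ ≤ Real.exp (-c.re) * (1 - Real.exp (γ * V)) := by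
    rw [← hγi, ← intervalIntegral.integral_const_mul]
    refine intervalIntegral.norm_integral_le_of_norm_le hV ?_
      (Continuous.intervalIntegrable (by fun_prop) _ _)
    refine ae_of_all _ fun x hx => ?_
    rw [norm_mul, norm_real, Real.norm_eq_abs, abs_of_nonpos
      (mul_nonpos_of_nonpos_of_nonneg hγ0 (Real.exp_pos _).le), mul_comm]
    exact mul_le_mul_of_nonneg_right (norm_cexp_neg_mul_exp_le hc hx.1.le)
      (neg_nonneg.2 (mul_nonpos_of_nonpos_of_nonneg hγ0 (Real.exp_pos _).le))
  rw [hl] at hi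
  set J := ∫ v in (0 : ℝ)..V, ((Real.exp ((1 + ε) * v) : ℝ) : ℂ) *
        cexp (-c * (Real.exp (2 * v) : ℝ)) with hJ
  have hn : 2 * ‖c‖ * ‖J‖ ≤ 2 * Real.exp (-c.re) := by
    have h3 : ‖-(2 * c) * J‖ = 2 * ‖c‖ * ‖J‖ := by simp
    rw [← h3, hi]
    refine (norm_sub_le _ _).trans ((add_le_add (norm_sub_le _ _) hb).trans ?_)
    have h4 : ‖((Real.exp (γ * V) : ℝ) : ℂ) * cexp (-c * (Real.exp (2 * V) : ℝ))‖ ≤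
        Real.exp (γ * V) * Real.exp (-c.re) := by
      rw [norm_mul, norm_real, Real.norm_of_nonneg (Real.exp_pos _).le]
      exact mul_le_mul_of_nonneg_left (norm_cexp_neg_mul_exp_le hc hV) (Real.exp_pos _).le
    have h5 : ‖((Real.exp (γ * 0) : ℝ) : ℂ) * cexp (-c * (Real.exp (2 * 0) : ℝ))‖ ≤
        Real.exp (-c.re) := by
      rw [norm_mul, mul_zero, Real.exp_zero, ofReal_one, norm_one, one_mul]
      exact norm_cexp_neg_mul_exp_le hc le_rfl
    linarith
  rw [le_div_iff₀ (norm_pos_iff.2 hc0)]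
  linarith

/-- A summable majorant of the off-diagonal terms. -/
noncomputable def offKernel (x : ℤ × ℕ) : ℝ := |(x.1 : ℝ)| ^ (-(3 / 2) : ℝ) * (x.2 : ℝ) ^ (-(5 / 4) : ℝ)

theorem summable_offKernel : Summable offKernel :=
  Summable.mul_of_nonneg (Real.summable_abs_int_rpow (by norm_num))
    (Real.summable_nat_rpow.2 (by norm_num)) (fun _ => by simp only [Pi.zero_apply]; positivity)
    (fun _ => by simp only [Pi.zero_apply]; positivity)

theorem offKernel_nonneg (x : ℤ × ℕ) : 0 ≤ offKernel x := by
  rw [offKernel]; positivity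

theorem exp_neg_le_rpow {x : ℝ} (hx : 0 < x) : Real.exp (-x) ≤ x ^ (-(3 / 8) : ℝ) := by
  rw [Real.rpow_neg hx.le, Real.exp_neg]
  refine inv_anti₀ (by positivity) ?_
  calc x ^ (3 / 8 : ℝ) ≤ (Real.exp x) ^ (3 / 8 : ℝ) :=
        Real.rpow_le_rpow hx.le (by linarith [Real.add_one_le_exp x]) (by norm_num)
    _ = Real.exp (x * (3 / 8)) := (Real.exp_mul _ _).symm
    _ ≤ _ := Real.exp_le_exp.2 (by linarith)

theorem exp_div_abs_sub_le {η : ℝ} (hη : 0 < η) {a b : ℕ} (hb : 0 < b) (hab : a ≠ b) :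
    Real.exp (-(η * ((a : ℝ) ^ 2 + (b : ℝ) ^ 2))) / |(a : ℝ) ^ 2 - (b : ℝ) ^ 2| ≤
      η ^ (-(3 / 8) : ℝ) * offKernel ((a : ℤ) - b, b) := by
  have hb0 : (0 : ℝ) < b := by exact_mod_cast hb
  have ha0 : (0 : ℝ) ≤ a := by positivity
  have hne : (a : ℝ) - b ≠ 0 := sub_ne_zero.2 (by exact_mod_cast hab)
  set d : ℝ := |(a : ℝ) - b| with hd
  have hd0 : 0 < d := abs_pos.2 hne
  have hs : |(a : ℝ) ^ 2 - (b : ℝ) ^ 2| = d * (a + b) := by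
    rw [sq_sub_sq, abs_mul, abs_of_pos (by positivity : (0 : ℝ) < a + b), mul_comm]
  have hsum : d ^ (1 / 2 : ℝ) * (b : ℝ) ^ (1 / 2 : ℝ) ≤ a + b := by
    have h1 : d ≤ a + b := abs_le.2 ⟨by linarith, by linarith⟩
    have h2 : (b : ℝ) ≤ a + b := by linarith
    calc _ ≤ ((a : ℝ) + b) ^ (1 / 2 : ℝ) * ((a : ℝ) + b) ^ (1 / 2 : ℝ) := by gcongr
      _ = _ := by
        rw [← Real.rpow_add (by positivity)]
        norm_num
  have he : Real.exp (-(η * ((a : ℝ) ^ 2 + (b : ℝ) ^ 2))) ≤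
      η ^ (-(3 / 8) : ℝ) * (b : ℝ) ^ (-(3 / 4) : ℝ) := by
    calc _ ≤ Real.exp (-(η * (b : ℝ) ^ 2)) := Real.exp_le_exp.2 (by
            have : 0 ≤ η * (a : ℝ) ^ 2 := by positivity
            linarith)
      _ ≤ (η * (b : ℝ) ^ 2) ^ (-(3 / 8) : ℝ) := exp_neg_le_rpow (by positivity)
      _ = _ := by
        rw [Real.mul_rpow hη.le (by positivity), ← Real.rpow_natCast, ← Real.rpow_mul hb0.le]
        norm_num
  rw [hs, offKernel]
  simp only [Int.cast_sub, Int.cast_natCast]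
  rw [← hd]
  calc _ ≤ η ^ (-(3 / 8) : ℝ) * (b : ℝ) ^ (-(3 / 4) : ℝ) /
        (d * (d ^ (1 / 2 : ℝ) * (b : ℝ) ^ (1 / 2 : ℝ))) := by gcongr
    _ = _ := by
      have e1 : d ^ (-(3 / 2) : ℝ) = (d * d ^ (1 / 2 : ℝ))⁻¹ := by
        rw [Real.rpow_neg hd0.le]
        congr 1
        nth_rw 2 [← Real.rpow_one d]
        rw [← Real.rpow_add hd0]
        norm_num
      have e2 : (b : ℝ) ^ (-(5 / 4) : ℝ) = (b : ℝ) ^ (-(3 / 4) : ℝ) * ((b : ℝ) ^ (1 / 2 : ℝ))⁻¹ := by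
        rw [← Real.rpow_neg hb0.le, ← Real.rpow_add hb0]
        norm_num
      rw [e1, e2]
      field_simp

end OffDiagonal

end Selberg

namespace Selberg

open Complex Set MeasureTheory Filter Topology ComplexConjugate

section ThetaProduct

/-- The coefficient of `-exp (2 v)` in the exponent of a term of a product of theta series. -/
noncomputable def pairCoeff (z : ℂ) (A B D : ℕ) (p : ℕ+ × ℕ+) : ℂ :=
  (Real.pi / (D : ℝ) ^ 2 : ℝ) * (z * ((A * p.1 : ℕ) : ℂ) ^ 2 + conj z * ((B * p.2 : ℕ) : ℂ) ^ 2)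

theorem pairCoeff_re (z : ℂ) (A B D : ℕ) (p : ℕ+ × ℕ+) : (pairCoeff z A B D p).re =
    Real.pi * z.re / (D : ℝ) ^ 2 * (((A * p.1 : ℕ) : ℝ) ^ 2 + ((B * p.2 : ℕ) : ℝ) ^ 2) := by
  rw [pairCoeff, re_ofReal_mul, add_re, ← ofReal_natCast, ← ofReal_natCast, ← ofReal_pow,
    ← ofReal_pow, re_mul_ofReal, re_mul_ofReal, conj_re]
  ring

theorem pairCoeff_im (z : ℂ) (A B D : ℕ) (p : ℕ+ × ℕ+) : (pairCoeff z A B D p).im =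
    Real.pi * z.im / (D : ℝ) ^ 2 * (((A * p.1 : ℕ) : ℝ) ^ 2 - ((B * p.2 : ℕ) : ℝ) ^ 2) := by
  rw [pairCoeff, im_ofReal_mul, add_im, ← ofReal_natCast, ← ofReal_natCast, ← ofReal_pow,
    ← ofReal_pow, im_mul_ofReal, im_mul_ofReal, conj_im]
  ring

theorem cexp_pairCoeff (z : ℂ) (A B D : ℕ) (p : ℕ+ × ℕ+) (v : ℝ) :
    cexp (-pairCoeff z A B D p * (Real.exp (2 * v) : ℝ)) =
      cexp (-Real.pi * (z * ((Real.exp (2 * v) * ((A : ℝ) / D) ^ 2 : ℝ) : ℂ)) * p.1 ^ 2) *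
        conj (cexp (-Real.pi * (z * ((Real.exp (2 * v) * ((B : ℝ) / D) ^ 2 : ℝ) : ℂ)) * p.2 ^ 2)) := by
  rw [← exp_conj, ← exp_add, pairCoeff]
  congr 1
  simp only [map_mul, map_neg, conj_ofReal, map_pow, map_natCast]
  push_cast
  ring

theorem re_mul_exp_pos {z : ℂ} (hz : 0 < z.re) {A D : ℕ} (hA : 0 < A) (hD : 0 < D) (v : ℝ) :
    0 < (z * ((Real.exp (2 * v) * ((A : ℝ) / D) ^ 2 : ℝ) : ℂ)).re :=
  re_mul_ofReal_pos hz (by positivity)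

theorem hasSum_theta_mul_conj {z : ℂ} (hz : 0 < z.re) {A B D : ℕ} (hA : 0 < A) (hB : 0 < B)
    (hD : 0 < D) (v : ℝ) :
    HasSum (fun p => cexp (-pairCoeff z A B D p * (Real.exp (2 * v) : ℝ)))
      (theta (z * ((Real.exp (2 * v) * ((A : ℝ) / D) ^ 2 : ℝ) : ℂ)) *
        conj (theta (z * ((Real.exp (2 * v) * ((B : ℝ) / D) ^ 2 : ℝ) : ℂ)))) := by
  have hs1 := summable_thetaR (re_mul_exp_pos hz hA hD v)
  have hs2 := summable_thetaR (re_mul_exp_pos hz hB hD v)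
  simp only [← norm_theta_term] at hs1 hs2
  have hs2' : Summable fun n : ℕ+ => ‖conj (cexp (-Real.pi *
      (z * ((Real.exp (2 * v) * ((B : ℝ) / D) ^ 2 : ℝ) : ℂ)) * n ^ 2))‖ := by
    simpa only [RCLike.norm_conj] using hs2
  have h1 := tsum_mul_tsum_of_summable_norm hs1 hs2'
  have h2 := (summable_mul_of_summable_norm hs1 hs2').hasSum
  rw [← h1, ← conj_tsum] at h2
  simp only [cexp_pairCoeff]
  exact h2

theorem hasSum_theta_diagonal {z : ℂ} (hz : 0 < z.re) {A B D : ℕ} (hA : 0 < A) (hB : 0 < B)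
    (hD : 0 < D) (v : ℝ) :
    HasSum (fun p : ℕ+ × ℕ+ => if A * p.1 = B * p.2 then
        cexp (-pairCoeff z A B D p * (Real.exp (2 * v) : ℝ)) else 0)
      (thetaR (2 * z.re * Real.exp (2 * v) * ((A * B : ℝ) / (Nat.gcd A B * D)) ^ 2) : ℂ) := by
  set q := Nat.gcd A B with hq
  have hq0 : 0 < q := Nat.gcd_pos_of_pos_left _ hA
  have hA' : 0 < A / q := Nat.div_pos (Nat.le_of_dvd hA (Nat.gcd_dvd_left A B)) hq0
  have hB' : 0 < B / q := Nat.div_pos (Nat.le_of_dvd hB (Nat.gcd_dvd_right A B)) hq0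
  have hAq : A / q * q = A := Nat.div_mul_cancel (Nat.gcd_dvd_left A B)
  have hBq : B / q * q = B := Nat.div_mul_cancel (Nat.gcd_dvd_right A B)
  set a : ℕ+ := ⟨A / q, hA'⟩ with ha
  set b : ℕ+ := ⟨B / q, hB'⟩ with hb
  have hcop : Nat.Coprime (A / q) (B / q) := Nat.coprime_div_gcd_div_gcd hq0
  let g : ℕ+ → ℕ+ × ℕ+ := fun h => (b * h, a * h)
  have hg : Function.Injective g := fun h h' hh => by
    have : b * h = b * h' := congrArg Prod.fst hh
    exact mul_left_cancel this
  rw [← hg.hasSum_iff]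
  · have hx : 0 < 2 * z.re * Real.exp (2 * v) * ((A * B : ℝ) / (q * D)) ^ 2 := by positivity
    have h1 := hasSum_ofReal.2 (summable_thetaR hx).hasSum
    refine h1.congr_fun fun h => ?_
    have e : A * ((b * h : ℕ+) : ℕ) = B * ((a * h : ℕ+) : ℕ) := by
      rw [PNat.mul_coe, PNat.mul_coe, ha, hb, PNat.mk_coe, PNat.mk_coe]
      conv_lhs => rw [← hAq]
      conv_rhs => rw [← hBq]
      ring
    simp only [Function.comp_apply, g]
    rw [if_pos e, pairCoeff, ← e]
    have e2 : ((A * ((b * h : ℕ+) : ℕ) : ℕ) : ℝ) = (A * B : ℝ) / q * h := by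
      rw [PNat.mul_coe, hb, PNat.mk_coe]
      push_cast
      rw [Nat.cast_div (Nat.gcd_dvd_right A B) (by positivity)]
      ring
    rw [← ofReal_natCast, e2, ← add_mul, add_conj, ← ofReal_pow, ← ofReal_mul, ← ofReal_mul,
      ← ofReal_neg, ← ofReal_mul, ← ofReal_exp]
    congr 2
    have : (q : ℝ) ≠ 0 := by positivity
    have : (D : ℝ) ≠ 0 := by positivity
    field_simp
  · intro p hp
    refine if_neg fun hp2 => hp ?_
    have h1 : A / q * p.1 = B / q * p.2 := by
      apply Nat.eq_of_mul_eq_mul_right hq0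
      calc A / q * p.1 * q = (A / q * q) * p.1 := by ring
        _ = (B / q * q) * p.2 := by rw [hAq, hBq, hp2]
        _ = _ := by ring
    obtain ⟨k, hk⟩ : B / q ∣ (p.1 : ℕ) :=
      hcop.symm.dvd_of_dvd_mul_left (h1 ▸ dvd_mul_right _ _)
    have hk0 : 0 < k := Nat.pos_of_ne_zero fun h => by
      rw [h, mul_zero] at hk
      exact p.1.ne_zero hk
    refine ⟨⟨k, hk0⟩, Prod.ext (PNat.eq ?_) (PNat.eq ?_)⟩
    · exact hk.symm
    · change A / q * k = p.2
      apply Nat.eq_of_mul_eq_mul_left hB'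
      rw [← h1, hk]
      ring

theorem norm_integral_offDiagonal_term_le {z : ℂ} (hz : 0 < z.re) (hz' : 1 / 2 ≤ z.im)
    {A B D : ℕ} (hB : 0 < B) (hD : 0 < D) {ε V : ℝ} (hε : ε ≤ 1) (hV : 0 ≤ V) (p : ℕ+ × ℕ+)
    (hp : A * p.1 ≠ B * p.2) :
    ‖∫ v in (0 : ℝ)..V, ((Real.exp ((1 + ε) * v) : ℝ) : ℂ) *
        cexp (-pairCoeff z A B D p * (Real.exp (2 * v) : ℝ))‖ ≤
      (D : ℝ) ^ 4 * z.re ^ (-(3 / 8) : ℝ) *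
        offKernel (((A * p.1 : ℕ) : ℤ) - (B * p.2 : ℕ), B * p.2) := by
  set c := pairCoeff z A B D p with hc
  set a := A * p.1 with ha
  set b := B * p.2 with hb
  have hD0 : (1 : ℝ) ≤ D := by exact_mod_cast hD
  have hsub : 0 < |(a : ℝ) ^ 2 - (b : ℝ) ^ 2| := by
    refine abs_pos.2 (sub_ne_zero.2 fun h => hp ?_)
    have := (pow_left_inj₀ (Nat.cast_nonneg a) (Nat.cast_nonneg b) two_ne_zero).1 h
    exact_mod_cast this
  have him : |(a : ℝ) ^ 2 - (b : ℝ) ^ 2| / (D : ℝ) ^ 2 ≤ ‖c‖ := by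
    refine le_trans ?_ (abs_im_le_norm c)
    rw [hc, pairCoeff_im, abs_mul, div_eq_inv_mul]
    refine mul_le_mul_of_nonneg_right ?_ (abs_nonneg _)
    rw [abs_of_nonneg (by have := Real.pi_pos; positivity), div_eq_inv_mul]
    refine le_mul_of_one_le_right (by positivity) ?_
    nlinarith [Real.pi_gt_three]
  have hc0 : c ≠ 0 := norm_pos_iff.1 (lt_of_lt_of_le (by positivity) him)
  have hre : c.re = Real.pi * z.re / (D : ℝ) ^ 2 * ((a : ℝ) ^ 2 + (b : ℝ) ^ 2) := pairCoeff_re ..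
  have hη : 0 < Real.pi * z.re / (D : ℝ) ^ 2 := by have := Real.pi_pos; positivity
  refine (norm_integral_exp_mul_cexp_le (by rw [hre]; positivity) hc0 hε hV).trans ?_
  calc Real.exp (-c.re) / ‖c‖ ≤ Real.exp (-c.re) / (|(a : ℝ) ^ 2 - (b : ℝ) ^ 2| / (D : ℝ) ^ 2) := by
        gcongr
    _ = (D : ℝ) ^ 2 * (Real.exp (-c.re) / |(a : ℝ) ^ 2 - (b : ℝ) ^ 2|) := by field_simp
    _ ≤ (D : ℝ) ^ 2 * ((Real.pi * z.re / (D : ℝ) ^ 2) ^ (-(3 / 8) : ℝ) *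
        offKernel ((a : ℤ) - b, b)) := by
        rw [hre]
        gcongr
        exact exp_div_abs_sub_le hη (Nat.mul_pos hB p.2.pos) hp
    _ ≤ (D : ℝ) ^ 2 * ((D : ℝ) ^ 2 * z.re ^ (-(3 / 8) : ℝ) * offKernel ((a : ℤ) - b, b)) := by
        gcongr
        · exact offKernel_nonneg _
        · calc (Real.pi * z.re / (D : ℝ) ^ 2) ^ (-(3 / 8) : ℝ) ≤
                (z.re / (D : ℝ) ^ 2) ^ (-(3 / 8) : ℝ) :=
                Real.rpow_le_rpow_of_nonpos (by positivity)
                  (by gcongr; nlinarith [Real.pi_gt_three]) (by norm_num)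
            _ = ((D : ℝ) ^ 2) ^ (3 / 8 : ℝ) * z.re ^ (-(3 / 8) : ℝ) := by
                rw [Real.div_rpow hz.le (by positivity), Real.rpow_neg (by positivity : (0 : ℝ) ≤ (D : ℝ) ^ 2)]
                field_simp
            _ ≤ _ := by
                gcongr
                exact Real.rpow_le_self_of_one_le (one_le_pow₀ hD0) (by norm_num)
    _ = _ := by ring

theorem norm_integral_offDiagonal_le {z : ℂ} (hz : 0 < z.re) (hz' : 1 / 2 ≤ z.im)
    {A B D : ℕ} (hA : 0 < A) (hB : 0 < B) (hD : 0 < D) {ε V : ℝ} (hε0 : 0 ≤ ε) (hε : ε ≤ 1)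
    (hV : 0 ≤ V) :
    ‖∫ v in (0 : ℝ)..V, ((Real.exp ((1 + ε) * v) : ℝ) : ℂ) *
        (theta (z * ((Real.exp (2 * v) * ((A : ℝ) / D) ^ 2 : ℝ) : ℂ)) *
          conj (theta (z * ((Real.exp (2 * v) * ((B : ℝ) / D) ^ 2 : ℝ) : ℂ))) -
        (thetaR (2 * z.re * Real.exp (2 * v) * ((A * B : ℝ) / (Nat.gcd A B * D)) ^ 2) : ℂ))‖ ≤
      (∑' x, offKernel x) * ((D : ℝ) ^ 4 * z.re ^ (-(3 / 8) : ℝ)) := by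
  set F : ℕ+ × ℕ+ → ℝ → ℂ := fun p v => ((Real.exp ((1 + ε) * v) : ℝ) : ℂ) *
    (if A * p.1 = B * p.2 then 0 else cexp (-pairCoeff z A B D p * (Real.exp (2 * v) : ℝ))) with hF
  have hs := (hasSum_theta_mul_conj hz hA hB hD 0).summable.norm
  have hb0 (p : ℕ+ × ℕ+) : 0 ≤ (pairCoeff z A B D p).re := by
    rw [pairCoeff_re]; have := Real.pi_pos; positivity
  have hI := intervalIntegral.hasSum_integral_of_dominated_convergence (μ := volume) (a := 0)
    (b := V) (F := F)
    (f := fun v => ((Real.exp ((1 + ε) * v) : ℝ) : ℂ) *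
        (theta (z * ((Real.exp (2 * v) * ((A : ℝ) / D) ^ 2 : ℝ) : ℂ)) *
          conj (theta (z * ((Real.exp (2 * v) * ((B : ℝ) / D) ^ 2 : ℝ) : ℂ))) -
        (thetaR (2 * z.re * Real.exp (2 * v) * ((A * B : ℝ) / (Nat.gcd A B * D)) ^ 2) : ℂ)))
    (fun p _ => Real.exp ((1 + ε) * V) * ‖cexp (-pairCoeff z A B D p * (Real.exp (2 * 0) : ℝ))‖)
    (fun p => by
      refine Continuous.aestronglyMeasurable ?_
      simp only [hF]
      split_ifs <;> fun_prop)
    (fun p => ae_of_all _ fun t ht => by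
      rw [uIoc_of_le hV] at ht
      simp only [hF]
      rw [norm_mul, norm_real, Real.norm_of_nonneg (Real.exp_pos _).le]
      refine mul_le_mul (Real.exp_le_exp.2 (by nlinarith [ht.2])) ?_ (norm_nonneg _)
        (Real.exp_pos _).le
      split_ifs
      · rw [norm_zero]; positivity
      · refine (norm_cexp_neg_mul_exp_le (hb0 p) ht.1.le).trans (le_of_eq ?_)
        simp [norm_exp])
    (ae_of_all _ fun t _ => hs.mul_left _) intervalIntegrable_const
    (ae_of_all _ fun t _ => by
      refine HasSum.mul_left _ (((hasSum_theta_mul_conj hz hA hB hD t).sub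
        (hasSum_theta_diagonal hz hA hB hD t)).congr_fun fun p => ?_)
      split_ifs <;> simp)
  rw [← hI.tsum_eq]
  set i : ℕ+ × ℕ+ → ℤ × ℕ := fun p => (((A * p.1 : ℕ) : ℤ) - (B * p.2 : ℕ), B * p.2) with hi
  have hinj : Function.Injective i := fun p p' hpp => by
    have h2 : B * (p.2 : ℕ) = B * p'.2 := congrArg Prod.snd hpp
    have h1 : ((A * p.1 : ℕ) : ℤ) - (B * p.2 : ℕ) = ((A * p'.1 : ℕ) : ℤ) - (B * p'.2 : ℕ) :=
      congrArg Prod.fst hpp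
    rw [h2, sub_left_inj] at h1
    refine Prod.ext (PNat.eq (Nat.eq_of_mul_eq_mul_left hA (by exact_mod_cast h1)))
      (PNat.eq (Nat.eq_of_mul_eq_mul_left hB h2))
  have hk : Summable fun p => (D : ℝ) ^ 4 * z.re ^ (-(3 / 8) : ℝ) * offKernel (i p) :=
    (summable_offKernel.comp_injective hinj).mul_left _
  refine (tsum_of_norm_bounded hk.hasSum fun p => ?_).trans ?_
  · simp only [hF]
    split_ifs with hp
    · simp only [mul_zero, intervalIntegral.integral_zero, norm_zero]
      have := offKernel_nonneg (i p)
      positivity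
    · exact norm_integral_offDiagonal_term_le hz hz' hB hD hε hV p hp
  · rw [tsum_mul_left, mul_comm]
    gcongr
    exact tsum_comp_le_tsum_of_inj summable_offKernel offKernel_nonneg hinj

end ThetaProduct

end Selberg

namespace Selberg

open Complex Set MeasureTheory Filter Topology ComplexConjugate

section MainTheta

/-- The quadruple sum of `g κ l μ ν` against the mollifier coefficients. -/
noncomputable def quadSum (N : ℕ) (g : ℕ → ℕ → ℕ → ℕ → ℝ) : ℝ :=
  ∑ κ ∈ Finset.Icc 1 N, ∑ l ∈ Finset.Icc 1 N, ∑ μ ∈ Finset.Icc 1 N, ∑ ν ∈ Finset.Icc 1 N,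
    moll N κ * moll N l * (moll N μ * moll N ν) * g κ l μ ν

theorem quadSum_congr (N : ℕ) {g h : ℕ → ℕ → ℕ → ℕ → ℝ}
    (H : ∀ κ l μ ν, 0 < κ → 0 < l → 0 < μ → 0 < ν → g κ l μ ν = h κ l μ ν) :
    quadSum N g = quadSum N h := by
  refine Finset.sum_congr rfl fun κ hκ => Finset.sum_congr rfl fun l hl =>
    Finset.sum_congr rfl fun μ hμ => Finset.sum_congr rfl fun ν hν => ?_
  rw [H κ l μ ν (Finset.mem_Icc.1 hκ).1 (Finset.mem_Icc.1 hl).1 (Finset.mem_Icc.1 hμ).1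
    (Finset.mem_Icc.1 hν).1]

theorem quadSum_add (N : ℕ) (g h : ℕ → ℕ → ℕ → ℕ → ℝ) :
    quadSum N (fun κ l μ ν => g κ l μ ν + h κ l μ ν) = quadSum N g + quadSum N h := by
  simp only [quadSum, mul_add, Finset.sum_add_distrib]

theorem quadSum_const_mul (N : ℕ) (c : ℝ) (g : ℕ → ℕ → ℕ → ℕ → ℝ) :
    quadSum N (fun κ l μ ν => c * g κ l μ ν) = c * quadSum N g := by
  simp only [quadSum, Finset.mul_sum, mul_left_comm c]

theorem sum_Icc_le_mul {N : ℕ} {f : ℕ → ℝ} {M : ℝ} (h : ∀ n ∈ Finset.Icc 1 N, f n ≤ M) :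
    ∑ n ∈ Finset.Icc 1 N, f n ≤ N * M := by
  refine (Finset.sum_le_card_nsmul _ _ _ h).trans (le_of_eq ?_)
  rw [Nat.card_Icc, nsmul_eq_mul]
  simp

theorem norm_sum_Icc_le_mul {E : Type*} [SeminormedAddCommGroup E] {N : ℕ} {f : ℕ → E} {M : ℝ}
    (h : ∀ n ∈ Finset.Icc 1 N, ‖f n‖ ≤ M) : ‖∑ n ∈ Finset.Icc 1 N, f n‖ ≤ N * M :=
  (norm_sum_le _ _).trans (sum_Icc_le_mul h)

theorem abs_moll_mul_le_one {N : ℕ} (hN : 1 ≤ N) (κ l μ ν : ℕ) :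
    |moll N κ * moll N l * (moll N μ * moll N ν)| ≤ 1 := by
  rw [abs_mul, abs_mul, abs_mul]
  have h := abs_moll_le_one hN
  exact mul_le_one₀ (mul_le_one₀ (h κ) (abs_nonneg _) (h l)) (by positivity)
    (mul_le_one₀ (h μ) (abs_nonneg _) (h ν))

theorem abs_quadSum_le {N : ℕ} (hN : 1 ≤ N) {g : ℕ → ℕ → ℕ → ℕ → ℝ} {M : ℝ}
    (h : ∀ κ l μ ν, κ ∈ Finset.Icc 1 N → l ∈ Finset.Icc 1 N → μ ∈ Finset.Icc 1 N →
      ν ∈ Finset.Icc 1 N → |g κ l μ ν| ≤ M) : |quadSum N g| ≤ (N : ℝ) ^ 4 * M := by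
  suffices h' : ‖quadSum N g‖ ≤ N * (N * (N * (N * M))) from h'.trans_eq (by ring)
  refine norm_sum_Icc_le_mul fun κ hκ => norm_sum_Icc_le_mul fun l hl =>
    norm_sum_Icc_le_mul fun μ hμ => norm_sum_Icc_le_mul fun ν hν => ?_
  rw [Real.norm_eq_abs, abs_mul]
  exact (mul_le_of_le_one_left (abs_nonneg _) (abs_moll_mul_le_one hN κ l μ ν)).trans
    (h κ l μ ν hκ hl hμ hν)

theorem continuous_quadSum (N : ℕ) {g : ℝ → ℕ → ℕ → ℕ → ℕ → ℝ}
    (hg : ∀ κ l μ ν, 0 < κ → 0 < l → 0 < μ → 0 < ν → Continuous fun v => g v κ l μ ν) :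
    Continuous fun v => quadSum N (g v) := by
  refine continuous_finsetSum _ fun κ hκ => continuous_finsetSum _ fun l hl =>
    continuous_finsetSum _ fun μ hμ => continuous_finsetSum _ fun ν hν => ?_
  exact (hg κ l μ ν (Finset.mem_Icc.1 hκ).1 (Finset.mem_Icc.1 hl).1 (Finset.mem_Icc.1 hμ).1
    (Finset.mem_Icc.1 hν).1).const_mul _

theorem integrable_quadSum (N : ℕ) {g : ℝ → ℕ → ℕ → ℕ → ℕ → ℝ}
    (hg : ∀ κ l μ ν, 0 < κ → 0 < l → 0 < μ → 0 < ν → Integrable fun v => g v κ l μ ν) :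
    Integrable fun v => quadSum N (g v) := by
  refine integrable_finsetSum _ fun κ hκ => integrable_finsetSum _ fun l hl =>
    integrable_finsetSum _ fun μ hμ => integrable_finsetSum _ fun ν hν => ?_
  exact (hg κ l μ ν (Finset.mem_Icc.1 hκ).1 (Finset.mem_Icc.1 hl).1 (Finset.mem_Icc.1 hμ).1
    (Finset.mem_Icc.1 hν).1).const_mul _

theorem integral_quadSum (N : ℕ) {g : ℝ → ℕ → ℕ → ℕ → ℕ → ℝ}
    (hg : ∀ κ l μ ν, 0 < κ → 0 < l → 0 < μ → 0 < ν → Integrable fun v => g v κ l μ ν) :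
    ∫ v, quadSum N (g v) = quadSum N fun κ l μ ν => ∫ v, g v κ l μ ν := by
  have H (κ l μ ν : ℕ) (hκ : κ ∈ Finset.Icc 1 N) (hl : l ∈ Finset.Icc 1 N)
      (hμ : μ ∈ Finset.Icc 1 N) (hν : ν ∈ Finset.Icc 1 N) :
      Integrable fun v => moll N κ * moll N l * (moll N μ * moll N ν) * g v κ l μ ν :=
    (hg κ l μ ν (Finset.mem_Icc.1 hκ).1 (Finset.mem_Icc.1 hl).1 (Finset.mem_Icc.1 hμ).1
      (Finset.mem_Icc.1 hν).1).const_mul _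
  simp only [quadSum]
  rw [integral_finsetSum _ fun κ hκ => integrable_finsetSum _ fun l hl =>
    integrable_finsetSum _ fun μ hμ => integrable_finsetSum _ fun ν hν => H κ l μ ν hκ hl hμ hν]
  refine Finset.sum_congr rfl fun κ hκ => ?_
  rw [integral_finsetSum _ fun l hl =>
    integrable_finsetSum _ fun μ hμ => integrable_finsetSum _ fun ν hν => H κ l μ ν hκ hl hμ hν]
  refine Finset.sum_congr rfl fun l hl => ?_
  rw [integral_finsetSum _ fun μ hμ => integrable_finsetSum _ fun ν hν => H κ l μ ν hκ hl hμ hν]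
  refine Finset.sum_congr rfl fun μ hμ => ?_
  rw [integral_finsetSum _ fun ν hν => H κ l μ ν hκ hl hμ hν]
  exact Finset.sum_congr rfl fun ν hν => integral_const_mul _ _

theorem quadForm_eq_quadSum (N : ℕ) (ε : ℝ) : quadForm N ε = quadSum N fun κ l μ ν =>
    (Nat.gcd (κ * ν) (μ * l) : ℝ) ^ (1 + ε) * ((κ : ℝ) ^ (-ε) * (μ : ℝ) ^ (-ε)) := by
  rw [quadForm, quadSum]
  refine Finset.sum_congr rfl fun κ _ => ?_
  rw [Finset.sum_congr rfl fun ν _ => Finset.sum_comm, Finset.sum_comm]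
  refine Finset.sum_congr rfl fun l _ => ?_
  rw [Finset.sum_comm]
  refine Finset.sum_congr rfl fun μ _ => Finset.sum_congr rfl fun ν _ => ?_
  ring

/-- The part of `mollTheta` coming from the theta series itself. -/
noncomputable def mollMain (N : ℕ) (z : ℂ) (v : ℝ) : ℂ :=
  2 * (Real.exp (v / 2) : ℂ) * ∑ m ∈ Finset.Icc 1 N, ∑ n ∈ Finset.Icc 1 N,
    ((moll N m * moll N n * m : ℝ) : ℂ) * theta (z * ((Real.exp (2 * v) * ((m : ℝ) / n) ^ 2 : ℝ) : ℂ))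

theorem continuous_theta_exp {z : ℂ} (hz : 0 < z.re) {r : ℝ} (hr : 0 < r) :
    Continuous fun v : ℝ => theta (z * ((Real.exp (2 * v) * r ^ 2 : ℝ) : ℂ)) :=
  (continuousOn_theta_ray hz).comp_continuous (f := fun v : ℝ => Real.exp (2 * v) * r ^ 2)
    (by fun_prop) fun v => by
      show 0 < Real.exp (2 * v) * r ^ 2
      positivity

theorem continuous_thetaR_exp {σ r : ℝ} (hσ : 0 < σ) (hr : 0 < r) :
    Continuous fun v : ℝ => thetaR (2 * σ * Real.exp (2 * v) * r ^ 2) := by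
  have h := continuous_re.comp (continuous_theta_exp (z := ((2 * σ : ℝ) : ℂ))
    (by rw [ofReal_re]; positivity) hr)
  refine h.congr fun v => ?_
  rw [Function.comp_apply, ← ofReal_mul, theta_ofReal, ofReal_re]
  congr 1
  ring

theorem continuous_mollMain (N : ℕ) {z : ℂ} (hz : 0 < z.re) : Continuous (mollMain N z) := by
  refine Continuous.mul (by fun_prop) (continuous_finsetSum _ fun m hm =>
    continuous_finsetSum _ fun n hn => continuous_const.mul ?_)
  have := (Finset.mem_Icc.1 hm).1
  have := (Finset.mem_Icc.1 hn).1
  exact continuous_theta_exp hz (by positivity)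

theorem norm_mollTheta_sub_le {N : ℕ} (hN : 1 ≤ N) {z : ℂ} (h1 : ‖z‖ = 1) (v : ℝ) :
    ‖mollTheta N z v - mollMain N z v‖ ≤ Real.exp (-v / 2) * (N : ℝ) ^ 3 := by
  rw [mollTheta_eq, mollMain, ← mul_sub, ← Finset.sum_sub_distrib, norm_mul, norm_mul,
    norm_real, Real.norm_of_nonneg (Real.exp_pos _).le]
  simp only [← Finset.sum_sub_distrib, ← mul_sub]
  have hb : ‖∑ m ∈ Finset.Icc 1 N, ∑ n ∈ Finset.Icc 1 N, ((moll N m * moll N n * m : ℝ) : ℂ) *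
      (thetaReg (z * ((Real.exp (2 * v) * ((m : ℝ) / n) ^ 2 : ℝ) : ℂ)) -
        theta (z * ((Real.exp (2 * v) * ((m : ℝ) / n) ^ 2 : ℝ) : ℂ)))‖ ≤
      N * (N * (N * (Real.exp (-v) / 2))) := by
    refine norm_sum_Icc_le_mul fun m hm => norm_sum_Icc_le_mul fun n hn => ?_
    have hm1 : (0 : ℝ) < m := by exact_mod_cast (Finset.mem_Icc.1 hm).1
    have hn1 : (0 : ℝ) < n := by exact_mod_cast (Finset.mem_Icc.1 hn).1
    have hnN : (n : ℝ) ≤ N := by exact_mod_cast (Finset.mem_Icc.1 hn).2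
    rw [thetaReg, sub_sub_cancel_left, norm_mul, norm_neg, norm_div, norm_one, norm_mul,
      norm_cpow_half, norm_mul, h1, one_mul, norm_real, norm_real]
    have hs : √ ‖Real.exp (2 * v) * ((m : ℝ) / n) ^ 2‖ = Real.exp v * (m / n) := by
      rw [Real.norm_of_nonneg (by positivity), show Real.exp (2 * v) * ((m : ℝ) / n) ^ 2 =
        (Real.exp v * (m / n)) ^ 2 by rw [mul_pow, ← Real.exp_nat_mul]; norm_cast,
        Real.sqrt_sq (by positivity)]
    have hw : ‖moll N m * moll N n * m‖ ≤ m := by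
      rw [norm_mul, norm_mul, Real.norm_of_nonneg hm1.le]
      exact mul_le_of_le_one_left hm1.le (mul_le_one₀ (abs_moll_le_one hN m) (norm_nonneg _)
        (abs_moll_le_one hN n))
    rw [hs]
    calc _ ≤ (m : ℝ) * (1 / (‖(2 : ℂ)‖ * (Real.exp v * (m / n)))) := by gcongr
      _ = n * (Real.exp (-v) / 2) := by
        rw [Complex.norm_ofNat, Real.exp_neg]
        field_simp
      _ ≤ _ := by gcongr
  calc _ ≤ ‖(2 : ℂ)‖ * Real.exp (v / 2) * (N * (N * (N * (Real.exp (-v) / 2)))) := by gcongr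
    _ = _ := by
      have e1 : Real.exp (-v) = Real.exp (-v / 2) * Real.exp (-v / 2) := by
        rw [← Real.exp_add, add_halves]
      have e2 : Real.exp (v / 2) * Real.exp (-v / 2) = 1 := by
        rw [← Real.exp_add, ← Real.exp_zero]
        congr 1
        ring
      rw [Complex.norm_ofNat, e1]
      linear_combination (N : ℝ) ^ 3 * Real.exp (-v / 2) * e2

end MainTheta

end Selberg

namespace Selberg

open Complex Set MeasureTheory Filter Topology ComplexConjugate

section Diagonal

/-- The summand of the diagonal contribution to the mean square. -/
noncomputable def diagTerm (ε σ v : ℝ) (κ l μ ν : ℕ) : ℝ :=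
  κ * μ * (Real.exp ((1 + ε) * v) *
    thetaR (2 * σ * Real.exp (2 * v) * ((κ * μ : ℝ) / Nat.gcd (κ * ν) (μ * l)) ^ 2))

theorem normSq_mollMain (N : ℕ) (z : ℂ) (v : ℝ) :
    ((‖mollMain N z v‖ ^ 2 : ℝ) : ℂ) = 4 * (Real.exp v : ℂ) *
      ∑ κ ∈ Finset.Icc 1 N, ∑ l ∈ Finset.Icc 1 N, ∑ μ ∈ Finset.Icc 1 N, ∑ ν ∈ Finset.Icc 1 N,
        ((moll N κ * moll N l * (moll N μ * moll N ν) * (κ * μ) : ℝ) : ℂ) *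
          (theta (z * ((Real.exp (2 * v) * ((κ : ℝ) / l) ^ 2 : ℝ) : ℂ)) *
            conj (theta (z * ((Real.exp (2 * v) * ((μ : ℝ) / ν) ^ 2 : ℝ) : ℂ)))) := by
  rw [ofReal_pow, ← mul_conj', mollMain]
  simp only [map_mul, map_sum, conj_ofReal, map_ofNat]
  have e : (Real.exp v : ℂ) = (Real.exp (v / 2) : ℂ) * (Real.exp (v / 2) : ℂ) := by
    rw [← ofReal_mul, ← Real.exp_add, add_halves]
  rw [e, mul_mul_mul_comm, Finset.sum_mul]
  congr 1
  · ring
  refine Finset.sum_congr rfl fun κ _ => ?_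
  rw [Finset.sum_mul]
  refine Finset.sum_congr rfl fun l _ => ?_
  rw [Finset.mul_sum]
  refine Finset.sum_congr rfl fun μ _ => ?_
  rw [Finset.mul_sum]
  refine Finset.sum_congr rfl fun ν _ => ?_
  push_cast
  ring

theorem continuous_diagTerm {σ : ℝ} (hσ : 0 < σ) (ε : ℝ) {κ l μ ν : ℕ} (hκ : 0 < κ) (hμ : 0 < μ)
    (hν : 0 < ν) : Continuous fun v => diagTerm ε σ v κ l μ ν := by
  have hq : 0 < Nat.gcd (κ * ν) (μ * l) := Nat.gcd_pos_of_pos_left _ (Nat.mul_pos hκ hν)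
  exact continuous_const.mul (Continuous.mul (by fun_prop)
    (continuous_thetaR_exp hσ (by positivity)))

theorem continuous_quadSum_diagTerm (N : ℕ) {σ : ℝ} (hσ : 0 < σ) (ε : ℝ) :
    Continuous fun v => quadSum N (diagTerm ε σ v) :=
  continuous_quadSum N fun _ _ _ _ hκ _ hμ hν => continuous_diagTerm hσ ε hκ hμ hν

theorem norm_intervalIntegral_sum_Icc_le {N : ℕ} {f : ℕ → ℝ → ℂ} {a b M : ℝ}
    (hf : ∀ n ∈ Finset.Icc 1 N, Continuous (f n))
    (h : ∀ n ∈ Finset.Icc 1 N, ‖∫ v in a..b, f n v‖ ≤ M) :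
    ‖∫ v in a..b, ∑ n ∈ Finset.Icc 1 N, f n v‖ ≤ N * M := by
  rw [intervalIntegral.integral_finsetSum fun n hn => (hf n hn).intervalIntegrable _ _]
  exact norm_sum_Icc_le_mul h

theorem integral_mollMain_sq_le {N : ℕ} (hN : 1 ≤ N) {z : ℂ} (hz : 0 < z.re) (hz' : 1 / 2 ≤ z.im)
    {ε V : ℝ} (hε0 : 0 ≤ ε) (hε : ε ≤ 1) (hV : 0 ≤ V) :
    ∫ v in (0 : ℝ)..V, ‖mollMain N z v‖ ^ 2 ≤
      4 * (∫ v in (0 : ℝ)..V, quadSum N (diagTerm ε z.re v)) +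
        4 * (∑' x, offKernel x) * ((N : ℝ) ^ 14 * z.re ^ (-(3 / 8) : ℝ)) := by
  set C := ∑' x, offKernel x with hC
  have hC0 : 0 ≤ C := tsum_nonneg offKernel_nonneg
  have hc := continuous_mollMain N hz
  have h1 : ∫ v in (0 : ℝ)..V, ‖mollMain N z v‖ ^ 2 ≤
      ∫ v in (0 : ℝ)..V, Real.exp (ε * v) * ‖mollMain N z v‖ ^ 2 := by
    refine intervalIntegral.integral_mono_on hV (Continuous.intervalIntegrable (by fun_prop) _ _)
      (Continuous.intervalIntegrable (by fun_prop) _ _) fun v hv => ?_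
    exact le_mul_of_one_le_left (by positivity) (Real.one_le_exp (mul_nonneg hε0 hv.1))
  set X : ℕ → ℕ → ℕ → ℕ → ℝ → ℂ := fun κ l μ ν v => ((Real.exp ((1 + ε) * v) : ℝ) : ℂ) *
    (theta (z * ((Real.exp (2 * v) * ((κ : ℝ) / l) ^ 2 : ℝ) : ℂ)) *
      conj (theta (z * ((Real.exp (2 * v) * ((μ : ℝ) / ν) ^ 2 : ℝ) : ℂ))) -
      (thetaR (2 * z.re * Real.exp (2 * v) * ((κ * μ : ℝ) / Nat.gcd (κ * ν) (μ * l)) ^ 2) : ℂ))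
    with hX
  have hdiff (v : ℝ) : ((Real.exp (ε * v) * ‖mollMain N z v‖ ^ 2 -
      4 * quadSum N (diagTerm ε z.re v) : ℝ) : ℂ) = 4 * ∑ κ ∈ Finset.Icc 1 N,
      ∑ l ∈ Finset.Icc 1 N, ∑ μ ∈ Finset.Icc 1 N, ∑ ν ∈ Finset.Icc 1 N,
        ((moll N κ * moll N l * (moll N μ * moll N ν) * (κ * μ) : ℝ) : ℂ) * X κ l μ ν v := by
    rw [ofReal_sub, ofReal_mul, normSq_mollMain, ofReal_mul, quadSum]
    simp only [ofReal_sum]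
    rw [show ∀ S : ℂ, ((Real.exp (ε * v) : ℝ) : ℂ) * (4 * (Real.exp v : ℂ) * S) =
      4 * (((Real.exp (ε * v) : ℝ) : ℂ) * (Real.exp v : ℂ) * S) from fun S => by ring,
      show ((4 : ℝ) : ℂ) = 4 by norm_num, ← mul_sub]
    congr 1
    simp only [Finset.mul_sum, ← Finset.sum_sub_distrib]
    refine Finset.sum_congr rfl fun κ _ => Finset.sum_congr rfl fun l _ =>
      Finset.sum_congr rfl fun μ _ => Finset.sum_congr rfl fun ν _ => ?_
    simp only [hX, diagTerm]
    rw [show (1 + ε) * v = ε * v + v by ring, Real.exp_add]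
    push_cast
    ring
  have hXc {κ l μ ν : ℕ} (hκ : 0 < κ) (hl : 0 < l) (hμ : 0 < μ) (hν : 0 < ν) :
      Continuous (X κ l μ ν) := by
    have hq : 0 < Nat.gcd (κ * ν) (μ * l) := Nat.gcd_pos_of_pos_left _ (Nat.mul_pos hκ hν)
    have c1 := continuous_theta_exp hz (r := (κ : ℝ) / l) (by positivity)
    have c2 := continuous_theta_exp hz (r := (μ : ℝ) / ν) (by positivity)
    have c3 := continuous_thetaR_exp hz (r := (κ * μ : ℝ) / Nat.gcd (κ * ν) (μ * l)) (by positivity)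
    exact Continuous.mul (by fun_prop)
      ((c1.mul (continuous_conj.comp c2)).sub (continuous_ofReal.comp c3))
  have hXi {κ l μ ν : ℕ} (hκ : κ ∈ Finset.Icc 1 N) (hl : l ∈ Finset.Icc 1 N)
      (hμ : μ ∈ Finset.Icc 1 N) (hν : ν ∈ Finset.Icc 1 N) : Continuous fun v =>
        ((moll N κ * moll N l * (moll N μ * moll N ν) * (κ * μ) : ℝ) : ℂ) * X κ l μ ν v :=
    (hXc (Finset.mem_Icc.1 hκ).1 (Finset.mem_Icc.1 hl).1 (Finset.mem_Icc.1 hμ).1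
      (Finset.mem_Icc.1 hν).1).const_mul _
  have hXb {κ l μ ν : ℕ} (hκ : 0 < κ) (hl : 0 < l) (hμ : 0 < μ) (hν : 0 < ν) :
      ‖∫ v in (0 : ℝ)..V, X κ l μ ν v‖ ≤
        C * (((l * ν : ℕ) : ℝ) ^ 4 * z.re ^ (-(3 / 8) : ℝ)) := by
    have h := norm_integral_offDiagonal_le hz hz' (Nat.mul_pos hκ hν) (Nat.mul_pos hμ hl)
      (Nat.mul_pos hl hν) hε0 hε hV
    convert h using 4 with v
    have hl' : (l : ℝ) ≠ 0 := by positivity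
    have hν' : (ν : ℝ) ≠ 0 := by positivity
    simp only [hX]
    rw [show ((κ * ν : ℕ) : ℝ) / ((l * ν : ℕ) : ℝ) = (κ : ℝ) / l by push_cast; field_simp,
      show ((μ * l : ℕ) : ℝ) / ((l * ν : ℕ) : ℝ) = (μ : ℝ) / ν by push_cast; field_simp,
      show ((κ * ν : ℕ) : ℝ) * ((μ * l : ℕ) : ℝ) / ((Nat.gcd (κ * ν) (μ * l) : ℝ) * ((l * ν : ℕ) : ℝ))
        = (κ * μ : ℝ) / Nat.gcd (κ * ν) (μ * l) by push_cast; field_simp]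
  have hcd := continuous_quadSum_diagTerm N hz ε
  have h2 : (∫ v in (0 : ℝ)..V, Real.exp (ε * v) * ‖mollMain N z v‖ ^ 2) -
      4 * (∫ v in (0 : ℝ)..V, quadSum N (diagTerm ε z.re v)) ≤
      4 * C * ((N : ℝ) ^ 14 * z.re ^ (-(3 / 8) : ℝ)) := by
    rw [← intervalIntegral.integral_const_mul, ← intervalIntegral.integral_sub
      (Continuous.intervalIntegrable (by fun_prop) _ _)
      (Continuous.intervalIntegrable (by fun_prop) _ _)]
    refine (Real.le_norm_self _).trans ?_
    rw [← norm_real, ← intervalIntegral.integral_ofReal]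
    simp only [hdiff]
    rw [intervalIntegral.integral_const_mul, norm_mul, Complex.norm_ofNat]
    suffices h3 : ‖∫ v in (0 : ℝ)..V, ∑ κ ∈ Finset.Icc 1 N, ∑ l ∈ Finset.Icc 1 N,
        ∑ μ ∈ Finset.Icc 1 N, ∑ ν ∈ Finset.Icc 1 N,
        ((moll N κ * moll N l * (moll N μ * moll N ν) * (κ * μ) : ℝ) : ℂ) * X κ l μ ν v‖ ≤
        N * (N * (N * (N * ((N : ℝ) ^ 2 * (C * ((N : ℝ) ^ 8 * z.re ^ (-(3 / 8) : ℝ))))))) by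
      refine (mul_le_mul_of_nonneg_left h3 (by norm_num)).trans (le_of_eq (by ring))
    refine norm_intervalIntegral_sum_Icc_le (fun κ hκ => continuous_finsetSum _ fun l hl =>
      continuous_finsetSum _ fun μ hμ => continuous_finsetSum _ fun ν hν => hXi hκ hl hμ hν)
      fun κ hκ => ?_
    refine norm_intervalIntegral_sum_Icc_le (fun l hl => continuous_finsetSum _ fun μ hμ =>
      continuous_finsetSum _ fun ν hν => hXi hκ hl hμ hν) fun l hl => ?_
    refine norm_intervalIntegral_sum_Icc_le (fun μ hμ => continuous_finsetSum _ fun ν hν =>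
      hXi hκ hl hμ hν) fun μ hμ => ?_
    refine norm_intervalIntegral_sum_Icc_le (fun ν hν => hXi hκ hl hμ hν) fun ν hν => ?_
    rw [intervalIntegral.integral_const_mul, norm_mul, norm_real, Real.norm_eq_abs, abs_mul]
    have hNN {n : ℕ} (hn : n ∈ Finset.Icc 1 N) : (n : ℝ) ≤ N := by
      exact_mod_cast (Finset.mem_Icc.1 hn).2
    refine mul_le_mul ?_ ((hXb (Finset.mem_Icc.1 hκ).1 (Finset.mem_Icc.1 hl).1
      (Finset.mem_Icc.1 hμ).1 (Finset.mem_Icc.1 hν).1).trans ?_) (norm_nonneg _) (by positivity)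
    · refine (mul_le_of_le_one_left (abs_nonneg _) (abs_moll_mul_le_one hN κ l μ ν)).trans ?_
      rw [abs_of_nonneg (by positivity), sq]
      exact mul_le_mul (hNN hκ) (hNN hμ) (by positivity) (by positivity)
    · gcongr
      calc ((l * ν : ℕ) : ℝ) ^ 4 ≤ ((N : ℝ) * N) ^ 4 := by
            push_cast
            gcongr
            exacts [(Finset.mem_Icc.1 hl).2, (Finset.mem_Icc.1 hν).2]
        _ = _ := by ring
  linarith

end Diagonal

end Selberg

namespace Selberg

open Complex Set MeasureTheory Filter Topology ComplexConjugate

section DiagonalIntegral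

theorem thetaReg_ofReal {a : ℝ} (ha : 0 < a) :
    thetaReg a = ((thetaR a - 1 / (2 * √a) : ℝ) : ℂ) := by
  have : (a : ℂ) ^ (1 / 2 : ℂ) = ((√a : ℝ) : ℂ) := by
    rw [Real.sqrt_eq_rpow, ofReal_cpow ha.le]
    push_cast
    rfl
  rw [thetaReg, theta_ofReal, this]
  push_cast
  rfl

theorem abs_thetaR_sub_le {a : ℝ} (ha : 0 < a) : |thetaR a - 1 / (2 * √a)| ≤ 1 := by
  have hs : 0 < √a := Real.sqrt_pos.2 ha
  rcases le_total 1 a with h | h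
  · have h1 : thetaR a ≤ 1 := (thetaR_le ha).trans (by rw [div_le_one ha]; exact h)
    have h2 : 1 ≤ √a := Real.one_le_sqrt.2 h
    have h3 : 1 / (2 * √a) ≤ 1 := by rw [div_le_one (by positivity)]; linarith
    have h4 : 0 ≤ 1 / (2 * √a) := by positivity
    exact abs_le.2 ⟨by linarith [thetaR_nonneg a], by linarith⟩
  · have hinv := thetaReg_inv (w := (a : ℂ)) (by simpa using ha)
    rw [show (1 : ℂ) / a = ((1 / a : ℝ) : ℂ) by push_cast; rfl, thetaReg_ofReal ha,
      thetaReg_ofReal (by positivity)] at hinv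
    have hc : (a : ℂ) ^ (1 / 2 : ℂ) = ((√a : ℝ) : ℂ) := by
      rw [Real.sqrt_eq_rpow, ofReal_cpow ha.le]
      push_cast
      rfl
    rw [hc, ← ofReal_one, ← ofReal_div, ← ofReal_mul, ofReal_inj] at hinv
    have h1 : 1 / √a * (1 / (2 * √(1 / a))) = 1 / 2 := by
      rw [Real.sqrt_div zero_le_one, Real.sqrt_one]
      field_simp
    rw [hinv, mul_sub, h1]
    have h2 : 1 / √a * thetaR (1 / a) ≤ 1 := by
      have h3 : thetaR (1 / a) ≤ a := (thetaR_le (by positivity)).trans (by rw [one_div_one_div])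
      have h4 : a ≤ √a := by
        nth_rw 1 [← Real.mul_self_sqrt ha.le]
        exact mul_le_of_le_one_left hs.le (Real.sqrt_le_one.2 h)
      rw [one_div_mul_eq_div, div_le_one hs]
      linarith
    have h3 : 0 ≤ 1 / √a * thetaR (1 / a) := by
      have := thetaR_nonneg (1 / a)
      positivity
    exact abs_le.2 ⟨by linarith, by linarith⟩

theorem abs_diagTerm_sub_le {σ : ℝ} (hσ : 0 < σ) (ε v : ℝ) {κ l μ ν : ℕ} (hκ : 0 < κ) (hμ : 0 < μ)
    (hν : 0 < ν) :
    |diagTerm ε σ v κ l μ ν - Real.exp (ε * v) / (2 * √(2 * σ)) * Nat.gcd (κ * ν) (μ * l)| ≤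
      κ * μ * Real.exp ((1 + ε) * v) := by
  have hq : 0 < Nat.gcd (κ * ν) (μ * l) := Nat.gcd_pos_of_pos_left _ (Nat.mul_pos hκ hν)
  set q := Nat.gcd (κ * ν) (μ * l) with hqdef
  set a := 2 * σ * Real.exp (2 * v) * ((κ * μ : ℝ) / q) ^ 2 with ha
  have ha0 : 0 < a := by positivity
  have hsa : √a = √(2 * σ) * (Real.exp v * ((κ * μ : ℝ) / q)) := by
    rw [ha, mul_assoc, show Real.exp (2 * v) * ((κ * μ : ℝ) / q) ^ 2 =
      (Real.exp v * ((κ * μ : ℝ) / q)) ^ 2 by rw [mul_pow, ← Real.exp_nat_mul]; norm_cast,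
      Real.sqrt_mul (by positivity), Real.sqrt_sq (by positivity)]
  have hs : 0 < √(2 * σ) := Real.sqrt_pos.2 (by positivity)
  have e : diagTerm ε σ v κ l μ ν - Real.exp (ε * v) / (2 * √(2 * σ)) * q =
      κ * μ * Real.exp ((1 + ε) * v) * (thetaR a - 1 / (2 * √a)) := by
    rw [diagTerm, ← hqdef, ← ha, hsa, mul_sub, show (1 + ε) * v = ε * v + v by ring, Real.exp_add]
    field_simp
  rw [e, abs_mul, abs_of_nonneg (by positivity)]
  exact mul_le_of_le_one_right (by positivity) (abs_thetaR_sub_le ha0)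

theorem quadForm_zero (N : ℕ) :
    quadForm N 0 = quadSum N fun κ l μ ν => (Nat.gcd (κ * ν) (μ * l) : ℝ) := by
  rw [quadForm_eq_quadSum]
  congr 1
  funext κ l μ ν
  simp

theorem abs_quadSum_diagTerm_sub_le {N : ℕ} (hN : 1 ≤ N) {σ : ℝ} (hσ : 0 < σ) (ε v : ℝ) :
    |quadSum N (diagTerm ε σ v) - Real.exp (ε * v) / (2 * √(2 * σ)) * quadForm N 0| ≤
      (N : ℝ) ^ 6 * Real.exp ((1 + ε) * v) := by
  set c := Real.exp (ε * v) / (2 * √(2 * σ)) with hc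
  have h := quadSum_add N (fun κ l μ ν => c * (Nat.gcd (κ * ν) (μ * l) : ℝ))
    (fun κ l μ ν => diagTerm ε σ v κ l μ ν - c * (Nat.gcd (κ * ν) (μ * l) : ℝ))
  rw [quadSum_const_mul, ← quadForm_zero] at h
  simp only [add_sub_cancel] at h
  rw [show quadSum N (diagTerm ε σ v) = _ from h, add_sub_cancel_left]
  refine (abs_quadSum_le hN (M := (N : ℝ) ^ 2 * Real.exp ((1 + ε) * v))
    fun κ l μ ν hκ hl hμ hν => ?_).trans (le_of_eq (by ring))
  refine (abs_diagTerm_sub_le hσ ε v (Finset.mem_Icc.1 hκ).1 (Finset.mem_Icc.1 hμ).1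
    (Finset.mem_Icc.1 hν).1).trans ?_
  rw [sq]
  gcongr
  exacts [(Finset.mem_Icc.1 hκ).2, (Finset.mem_Icc.1 hμ).2]

/-- The weight `exp ((1 + ε) u)` times a theta function. -/
noncomputable def thetaWeight (ε u : ℝ) : ℝ := Real.exp ((1 + ε) * u) * thetaR (2 * Real.exp (2 * u))

theorem thetaWeight_nonneg (ε u : ℝ) : 0 ≤ thetaWeight ε u :=
  mul_nonneg (Real.exp_pos _).le (thetaR_nonneg _)

theorem thetaWeight_le {ε : ℝ} (hε : ε ≤ 1 / 2) (u : ℝ) :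
    thetaWeight ε u ≤ 2 * Real.exp (-ε * |u|) := by
  rw [thetaWeight]
  have hp : 0 < 2 * Real.exp (2 * u) := by positivity
  rcases le_total 0 u with hu | hu
  · rw [abs_of_nonneg hu]
    calc _ ≤ Real.exp ((1 + ε) * u) * (1 / (2 * Real.exp (2 * u))) := by
          gcongr; exact thetaR_le hp
      _ = Real.exp ((1 + ε) * u + -(2 * u)) / 2 := by
          rw [Real.exp_add, Real.exp_neg]; field_simp
      _ ≤ Real.exp (-ε * u) / 2 := by
          gcongr
          nlinarith
      _ ≤ _ := by linarith [Real.exp_pos (-ε * u)]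
  · rw [abs_of_nonpos hu]
    have hs : √(2 * Real.exp (2 * u)) = √2 * Real.exp u := by
      rw [show Real.exp (2 * u) = Real.exp u ^ 2 by rw [← Real.exp_nat_mul]; norm_cast,
        Real.sqrt_mul zero_le_two, Real.sqrt_sq (Real.exp_pos _).le]
    have h1 : thetaR (2 * Real.exp (2 * u)) ≤ 2 * Real.exp (-u) := by
      have h2 := (abs_le.1 (abs_thetaR_sub_le hp)).2
      rw [hs] at h2
      have h3 : 1 / (2 * (√2 * Real.exp u)) ≤ Real.exp (-u) := by
        rw [Real.exp_neg, ← one_div]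
        refine one_div_le_one_div_of_le (Real.exp_pos _) ?_
        have := Real.one_le_sqrt.2 (one_le_two (α := ℝ))
        nlinarith [Real.exp_pos u]
      have h4 : 1 ≤ Real.exp (-u) := Real.one_le_exp (by linarith)
      linarith
    calc _ ≤ Real.exp ((1 + ε) * u) * (2 * Real.exp (-u)) := by gcongr
      _ = 2 * Real.exp (-ε * -u) := by
          rw [mul_left_comm, ← Real.exp_add]
          congr 2
          ring

theorem continuous_thetaWeight (ε : ℝ) : Continuous (thetaWeight ε) := by
  refine Continuous.mul (by fun_prop) ((continuous_thetaR_exp one_pos one_pos).congr fun v => ?_)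
  simp

theorem integrable_thetaWeight {ε : ℝ} (hε0 : 0 < ε) (hε : ε ≤ 1 / 2) :
    Integrable (thetaWeight ε) :=
  ((integrable_exp_neg_abs hε0).const_mul 2).mono' (continuous_thetaWeight ε).aestronglyMeasurable
    (ae_of_all _ fun u => by
      rw [Real.norm_of_nonneg (thetaWeight_nonneg _ _)]
      exact thetaWeight_le hε u)

theorem integral_exp_neg_abs {c : ℝ} (hc : 0 < c) : ∫ v : ℝ, Real.exp (-c * |v|) = 2 / c := by
  rw [integral_comp_abs (f := fun v => Real.exp (-c * v)), integral_exp_mul_Ioi (by linarith)]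
  rw [mul_zero, Real.exp_zero]
  field_simp

theorem integral_thetaWeight_le {ε : ℝ} (hε0 : 0 < ε) (hε : ε ≤ 1 / 2) :
    ∫ u, thetaWeight ε u ≤ 4 / ε := by
  refine (integral_mono (integrable_thetaWeight hε0 hε)
    ((integrable_exp_neg_abs hε0).const_mul 2) (thetaWeight_le hε)).trans (le_of_eq ?_)
  rw [integral_const_mul, integral_exp_neg_abs hε0]
  ring

theorem diagTerm_eq_thetaWeight {σ : ℝ} (hσ : 0 < σ) (ε v : ℝ) {κ l μ ν : ℕ} (hκ : 0 < κ)
    (hμ : 0 < μ) (hν : 0 < ν) :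
    diagTerm ε σ v κ l μ ν = σ ^ (-(1 + ε) / 2) *
      ((Nat.gcd (κ * ν) (μ * l) : ℝ) ^ (1 + ε) * ((κ : ℝ) ^ (-ε) * (μ : ℝ) ^ (-ε))) *
      thetaWeight ε (v + Real.log (√σ * ((κ * μ : ℝ) / Nat.gcd (κ * ν) (μ * l)))) := by
  have hq : 0 < Nat.gcd (κ * ν) (μ * l) := Nat.gcd_pos_of_pos_left _ (Nat.mul_pos hκ hν)
  set q := Nat.gcd (κ * ν) (μ * l) with hqdef
  have hs : 0 < √σ := Real.sqrt_pos.2 hσ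
  set r := √σ * ((κ * μ : ℝ) / q) with hr
  have hr0 : 0 < r := by positivity
  have e1 : Real.exp ((1 + ε) * (v + Real.log r)) = Real.exp ((1 + ε) * v) * r ^ (1 + ε) := by
    rw [mul_add, Real.exp_add, Real.rpow_def_of_pos hr0, mul_comm (Real.log r)]
  have e2 : 2 * Real.exp (2 * (v + Real.log r)) =
      2 * σ * Real.exp (2 * v) * ((κ * μ : ℝ) / q) ^ 2 := by
    rw [mul_add, Real.exp_add, two_mul (Real.log r), Real.exp_add, Real.exp_log hr0, hr]
    have := Real.mul_self_sqrt hσ.le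
    linear_combination (2 * Real.exp (2 * v) * ((κ * μ : ℝ) / q) ^ 2) * this
  have e3 : r ^ (1 + ε) = σ ^ ((1 + ε) / 2) * ((κ : ℝ) * κ ^ ε * (μ * μ ^ ε) / (q : ℝ) ^ (1 + ε)) := by
    have hκ' : (0 : ℝ) < κ := by exact_mod_cast hκ
    have hμ' : (0 : ℝ) < μ := by exact_mod_cast hμ
    rw [hr, Real.mul_rpow hs.le (by positivity), Real.div_rpow (by positivity) (by positivity),
      Real.mul_rpow hκ'.le hμ'.le, Real.rpow_add hκ', Real.rpow_add hμ', Real.rpow_one, Real.rpow_one,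
      Real.sqrt_eq_rpow, ← Real.rpow_mul hσ.le]
    congr 2
    ring
  rw [diagTerm, ← hqdef, thetaWeight, e1, e2, e3, neg_div, Real.rpow_neg hσ.le, Real.rpow_neg (by positivity),
    Real.rpow_neg (by positivity)]
  have : (0 : ℝ) < (κ : ℝ) ^ ε := by positivity
  have : (0 : ℝ) < (μ : ℝ) ^ ε := by positivity
  have : (0 : ℝ) < (q : ℝ) ^ (1 + ε) := by positivity
  have : (0 : ℝ) < σ ^ ((1 + ε) / 2) := by positivity
  field_simp

end DiagonalIntegral

end Selberg

namespace Selberg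

open Complex Set MeasureTheory Filter Topology ComplexConjugate

section MeanSquare

theorem integrable_diagTerm {σ ε : ℝ} (hσ : 0 < σ) (hε0 : 0 < ε) (hε : ε ≤ 1 / 2) {κ l μ ν : ℕ}
    (hκ : 0 < κ) (hμ : 0 < μ) (hν : 0 < ν) : Integrable fun v => diagTerm ε σ v κ l μ ν := by
  simp only [diagTerm_eq_thetaWeight hσ ε _ hκ hμ hν]
  exact ((integrable_thetaWeight hε0 hε).comp_add_right _).const_mul _

theorem integral_diagTerm {σ : ℝ} (hσ : 0 < σ) (ε : ℝ) {κ l μ ν : ℕ}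
    (hκ : 0 < κ) (hμ : 0 < μ) (hν : 0 < ν) : ∫ v, diagTerm ε σ v κ l μ ν =
      (σ ^ (-(1 + ε) / 2) * ∫ u, thetaWeight ε u) *
      ((Nat.gcd (κ * ν) (μ * l) : ℝ) ^ (1 + ε) * ((κ : ℝ) ^ (-ε) * (μ : ℝ) ^ (-ε))) := by
  simp only [diagTerm_eq_thetaWeight hσ ε _ hκ hμ hν]
  rw [integral_const_mul, integral_add_right_eq_self (thetaWeight ε)]
  ring

theorem integrable_quadSum_diagTerm (N : ℕ) {σ ε : ℝ} (hσ : 0 < σ) (hε0 : 0 < ε) (hε : ε ≤ 1 / 2) :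
    Integrable fun v => quadSum N (diagTerm ε σ v) :=
  integrable_quadSum N fun _ _ _ _ hκ _ hμ hν => integrable_diagTerm hσ hε0 hε hκ hμ hν

theorem integral_quadSum_diagTerm (N : ℕ) {σ ε : ℝ} (hσ : 0 < σ) (hε0 : 0 < ε) (hε : ε ≤ 1 / 2) :
    ∫ v, quadSum N (diagTerm ε σ v) =
      σ ^ (-(1 + ε) / 2) * (∫ u, thetaWeight ε u) * quadForm N ε := by
  rw [integral_quadSum N fun _ _ _ _ hκ _ hμ hν => integrable_diagTerm hσ hε0 hε hκ hμ hν,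
    quadForm_eq_quadSum, ← quadSum_const_mul]
  exact quadSum_congr N fun _ _ _ _ hκ _ hμ hν => integral_diagTerm hσ ε hκ hμ hν

theorem setIntegral_quadSum_diagTerm_le {N : ℕ} (hN : 1 ≤ N) {σ ε : ℝ} (hσ : 0 < σ) (hε0 : 0 < ε)
    (hε : ε ≤ 1 / 2) : ∫ v in Ioi 0, quadSum N (diagTerm ε σ v) ≤
      σ ^ (-(1 + ε) / 2) * (4 / ε) * quadForm N ε + (N : ℝ) ^ 6 := by
  have hi := integrable_quadSum_diagTerm N hσ hε0 hε
  have h1 := intervalIntegral.integral_Iic_add_Ioi (b := (0 : ℝ)) hi.integrableOn hi.integrableOn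
  rw [integral_quadSum_diagTerm N hσ hε0 hε] at h1
  have h2 : σ ^ (-(1 + ε) / 2) * (∫ u, thetaWeight ε u) * quadForm N ε ≤
      σ ^ (-(1 + ε) / 2) * (4 / ε) * quadForm N ε := by
    gcongr
    · exact quadForm_nonneg N hε0.le
    · exact integral_thetaWeight_le hε0 hε
  have h3 : -(N : ℝ) ^ 6 ≤ ∫ v in Iic 0, quadSum N (diagTerm ε σ v) := by
    have h4 : ∫ v in Iic (0 : ℝ), -((N : ℝ) ^ 6 * Real.exp v) = -(N : ℝ) ^ 6 := by
      rw [integral_neg, integral_const_mul, integral_exp_Iic_zero, mul_one]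
    rw [← h4]
    refine setIntegral_mono_on ((integrableOn_exp_Iic 0).const_mul _).neg hi.integrableOn
      measurableSet_Iic fun v hv => ?_
    have h5 := (abs_le.1 (abs_quadSum_diagTerm_sub_le hN hσ ε v)).1
    have h6 : 0 ≤ Real.exp (ε * v) / (2 * √(2 * σ)) * quadForm N 0 :=
      mul_nonneg (by positivity) (quadForm_nonneg N le_rfl)
    have h7 : (N : ℝ) ^ 6 * Real.exp ((1 + ε) * v) ≤ (N : ℝ) ^ 6 * Real.exp v := by
      have hv0 : v ≤ 0 := hv
      gcongr
      nlinarith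
    linarith
  linarith

theorem integral_mollTheta_sq_le {N : ℕ} (hN : 1 ≤ N) {z : ℂ} (hz : 0 < z.re) (h1 : ‖z‖ = 1)
    {V : ℝ} (hV : 0 ≤ V) : ∫ v in (0 : ℝ)..V, ‖mollTheta N z v‖ ^ 2 ≤
      2 * (∫ v in (0 : ℝ)..V, ‖mollMain N z v‖ ^ 2) + 2 * (N : ℝ) ^ 6 := by
  have hc1 := continuous_mollMain N hz
  have hc2 := continuous_mollTheta N hz
  have h2 : ∫ v in (0 : ℝ)..V, ‖mollTheta N z v‖ ^ 2 ≤
      ∫ v in (0 : ℝ)..V, (2 * ‖mollMain N z v‖ ^ 2 + 2 * (N : ℝ) ^ 6 * Real.exp (-v)) := by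
    refine intervalIntegral.integral_mono_on hV (Continuous.intervalIntegrable (by fun_prop) _ _)
      (Continuous.intervalIntegrable (by fun_prop) _ _) fun v _ => ?_
    have h3 := norm_mollTheta_sub_le hN h1 v
    have h4 : ‖mollTheta N z v‖ ≤ ‖mollMain N z v‖ + Real.exp (-v / 2) * (N : ℝ) ^ 3 := by
      have := norm_le_norm_add_norm_sub' (mollTheta N z v) (mollMain N z v)
      linarith
    have h5 : Real.exp (-v) = Real.exp (-v / 2) * Real.exp (-v / 2) := by
      rw [← Real.exp_add, add_halves]
    calc _ ≤ (‖mollMain N z v‖ + Real.exp (-v / 2) * (N : ℝ) ^ 3) ^ 2 :=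
          pow_le_pow_left₀ (norm_nonneg _) h4 2
      _ ≤ _ := by
          rw [h5]
          nlinarith [sq_nonneg (‖mollMain N z v‖ - Real.exp (-v / 2) * (N : ℝ) ^ 3)]
  refine h2.trans ?_
  rw [intervalIntegral.integral_add (Continuous.intervalIntegrable (by fun_prop) _ _)
    (Continuous.intervalIntegrable (by fun_prop) _ _), intervalIntegral.integral_const_mul,
    intervalIntegral.integral_const_mul, intervalIntegral.integral_comp_neg (fun v => Real.exp v),
    integral_exp, neg_zero, Real.exp_zero]
  have : (0 : ℝ) ≤ (N : ℝ) ^ 6 := by positivity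
  nlinarith [Real.exp_pos (-V)]

theorem setIntegral_mollTheta_sq_le {N : ℕ} (hN : 1 ≤ N) {z : ℂ} (hz : 0 < z.re)
    (hz' : 1 / 2 ≤ z.im) (h1 : ‖z‖ = 1) {ε : ℝ} (hε0 : 0 < ε) (hε : ε ≤ 1 / 2) :
    ∫ v in Ioi 0, ‖mollTheta N z v‖ ^ 2 ≤
      32 * (z.re ^ (-(1 + ε) / 2) * quadForm N ε / ε) +
        8 * (∑' x, offKernel x) * ((N : ℝ) ^ 14 * z.re ^ (-(3 / 8) : ℝ)) + 10 * (N : ℝ) ^ 6 := by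
  have hl := intervalIntegral_tendsto_integral_Ioi (0 : ℝ)
    (integrable_mollTheta_sq N hz).integrableOn tendsto_id
  have hr := intervalIntegral_tendsto_integral_Ioi (0 : ℝ)
    (integrable_quadSum_diagTerm N hz hε0 hε).integrableOn tendsto_id
  have hb := le_of_tendsto_of_tendsto hl ((((hr.const_mul 4).add_const
    (4 * (∑' x, offKernel x) * ((N : ℝ) ^ 14 * z.re ^ (-(3 / 8) : ℝ)))).const_mul 2).add_const
    (2 * (N : ℝ) ^ 6)) (by
      filter_upwards [eventually_ge_atTop 0] with V hV
      have := integral_mollMain_sq_le hN hz hz' hε0.le (by linarith) hV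
      have := integral_mollTheta_sq_le hN hz h1 hV
      simp only [id]
      linarith)
  have hd := setIntegral_quadSum_diagTerm_le hN hz hε0 hε
  refine hb.trans ?_
  have e : z.re ^ (-(1 + ε) / 2) * (4 / ε) * quadForm N ε =
    4 * (z.re ^ (-(1 + ε) / 2) * quadForm N ε / ε) := by ring
  rw [e] at hd
  linarith

theorem intervalIntegral_mollTheta_sq_le {N : ℕ} (hN : 1 ≤ N) {z : ℂ} (hz : 0 < z.re)
    (hz' : 1 / 2 ≤ z.im) (h1 : ‖z‖ = 1) {V : ℝ} (hV : 0 ≤ V) :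
    ∫ v in (0 : ℝ)..V, ‖mollTheta N z v‖ ^ 2 ≤
      8 * (V * (z.re ^ (-(1 / 2) : ℝ) * quadForm N 0 + (N : ℝ) ^ 6 * Real.exp V)) +
        8 * (∑' x, offKernel x) * ((N : ℝ) ^ 14 * z.re ^ (-(3 / 8) : ℝ)) + 2 * (N : ℝ) ^ 6 := by
  have hm := integral_mollMain_sq_le hN hz hz' le_rfl zero_le_one hV
  have ht := integral_mollTheta_sq_le hN hz h1 hV
  have hd : ∫ v in (0 : ℝ)..V, quadSum N (diagTerm 0 z.re v) ≤
      V * (z.re ^ (-(1 / 2) : ℝ) * quadForm N 0 + (N : ℝ) ^ 6 * Real.exp V) := by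
    have hc := continuous_quadSum_diagTerm N hz 0
    refine (intervalIntegral.integral_mono_on hV (hc.intervalIntegrable _ _)
      (intervalIntegrable_const (c := z.re ^ (-(1 / 2) : ℝ) * quadForm N 0 +
        (N : ℝ) ^ 6 * Real.exp V)) fun v hv => ?_).trans (le_of_eq ?_)
    · have h5 := (abs_le.1 (abs_quadSum_diagTerm_sub_le hN hz 0 v)).2
      rw [zero_mul, Real.exp_zero, add_zero, one_mul] at h5
      have h6 : 1 / (2 * √(2 * z.re)) * quadForm N 0 ≤ z.re ^ (-(1 / 2) : ℝ) * quadForm N 0 := by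
        refine mul_le_mul_of_nonneg_right ?_ (quadForm_nonneg N le_rfl)
        rw [Real.rpow_neg hz.le, ← Real.sqrt_eq_rpow, one_div]
        refine inv_anti₀ (Real.sqrt_pos.2 hz) ?_
        have := Real.sqrt_le_sqrt (show z.re ≤ 2 * z.re by linarith)
        linarith [Real.sqrt_nonneg (2 * z.re)]
      have h7 : (N : ℝ) ^ 6 * Real.exp v ≤ (N : ℝ) ^ 6 * Real.exp V := by
        gcongr
        exact hv.2
      linarith
    · rw [intervalIntegral.integral_const, smul_eq_mul, sub_zero]
  linarith

end MeanSquare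

end Selberg

namespace Selberg

open Complex Set MeasureTheory Filter Topology ComplexConjugate

section Parameters

/-- The length of the mollifier at height `T`. -/
noncomputable def level (T : ℝ) : ℕ := ⌊T ^ (1 / 200 : ℝ)⌋₊

/-- The argument of the ray at height `T`. -/
noncomputable def angle (T : ℝ) : ℝ := Real.pi / 2 - 1 / T

theorem level_le {T : ℝ} (hT : 0 ≤ T) : (level T : ℝ) ≤ T ^ (1 / 200 : ℝ) :=
  Nat.floor_le (Real.rpow_nonneg hT _)

theorem level_pow_le {T : ℝ} (hT : 0 ≤ T) (k : ℕ) : (level T : ℝ) ^ k ≤ T ^ (k / 200 : ℝ) := by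
  refine (pow_le_pow_left₀ (Nat.cast_nonneg _) (level_le hT) k).trans_eq ?_
  rw [← Real.rpow_natCast, ← Real.rpow_mul hT]
  congr 1
  ring

theorem tendsto_level : Tendsto level atTop atTop :=
  tendsto_nat_floor_atTop.comp (tendsto_rpow_atTop (by norm_num))

theorem eventually_log_level :
    ∀ᶠ T : ℝ in atTop, 3 ≤ level T ∧ Real.log T / 400 ≤ Real.log (level T) := by
  have h1 := tendsto_level.eventually (eventually_ge_atTop 3)
  have h2 := Real.tendsto_log_atTop.eventually (eventually_ge_atTop (400 * Real.log 2))
  filter_upwards [h1, h2, eventually_gt_atTop (0 : ℝ)] with T h1 h2 hT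
  refine ⟨h1, ?_⟩
  have h3 : T ^ (1 / 200 : ℝ) ≤ 2 * level T := by
    have := (Nat.lt_floor_add_one (T ^ (1 / 200 : ℝ))).le
    have h1' : (3 : ℝ) ≤ level T := by exact_mod_cast h1
    change T ^ (1 / 200 : ℝ) ≤ (level T : ℝ) + 1 at this
    linarith
  have h4 := Real.log_le_log (Real.rpow_pos_of_pos hT _) h3
  rw [Real.log_rpow hT, Real.log_mul two_ne_zero
    (by have : 0 < level T := by omega
        positivity)] at h4
  linarith

theorem angle_pos {T : ℝ} (hT : 1 ≤ T) : 0 < angle T := by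
  have : 1 / T ≤ 1 := by rw [div_le_one (by linarith)]; exact hT
  have := Real.pi_gt_three
  unfold angle
  linarith

theorem angle_lt {T : ℝ} (hT : 0 < T) : angle T < Real.pi / 2 := by
  have : 0 < 1 / T := by positivity
  unfold angle
  linarith

theorem ray_angle_re {T : ℝ} : (ray (angle T)).re = Real.sin (1 / T) := by
  rw [ray_re, angle, Real.cos_pi_div_two_sub]

theorem ray_angle_im {T : ℝ} : (ray (angle T)).im = Real.cos (1 / T) := by
  rw [ray, exp_ofReal_mul_I_im, angle, Real.sin_pi_div_two_sub]

theorem le_sin_inv {T : ℝ} (hT : 1 ≤ T) : 1 / (2 * T) ≤ Real.sin (1 / T) := by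
  have h1 : 1 / T ≤ 1 := by rw [div_le_one (by linarith)]; exact hT
  have h0 : 0 < 1 / T := by positivity
  have h2 := Real.mul_le_sin h0.le (by linarith [Real.pi_gt_three])
  refine le_trans ?_ h2
  have : 1 / (2 * T) = 1 / 2 * (1 / T) := by field_simp
  rw [this]
  refine mul_le_mul_of_nonneg_right ?_ h0.le
  rw [div_le_div_iff₀ zero_lt_two Real.pi_pos]
  linarith [Real.pi_le_four]

theorem half_le_cos_inv {T : ℝ} (hT : 1 ≤ T) : 1 / 2 ≤ Real.cos (1 / T) := by
  have h1 : 1 / T ≤ 1 := by rw [div_le_one (by linarith)]; exact hT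
  have h0 : 0 < 1 / T := by positivity
  have := Real.one_sub_sq_div_two_le_cos (x := 1 / T)
  nlinarith

theorem sin_inv_rpow_le {T : ℝ} (hT : 1 ≤ T) {a : ℝ} (ha : 0 ≤ a) :
    Real.sin (1 / T) ^ (-a) ≤ (2 * T) ^ a := by
  have h := le_sin_inv hT
  have h0 : 0 < 1 / (2 * T) := by positivity
  refine (Real.rpow_le_rpow_of_nonpos h0 h (neg_nonpos.2 ha)).trans_eq ?_
  rw [one_div, Real.inv_rpow (by positivity), Real.rpow_neg (by positivity), inv_inv]

theorem two_mul_rpow_le {T : ℝ} (hT : 1 ≤ T) {a : ℝ} (ha1 : a ≤ 1) :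
    (2 * T) ^ a ≤ 2 * T ^ a := by
  rw [Real.mul_rpow zero_le_two (by linarith)]
  gcongr
  exact (Real.rpow_le_rpow_of_exponent_le one_le_two ha1).trans_eq (Real.rpow_one 2)

theorem level_pow_mul_sin_rpow_le {T : ℝ} (hT : 1 ≤ T) :
    (level T : ℝ) ^ 14 * Real.sin (1 / T) ^ (-(3 / 8) : ℝ) ≤ 2 * T ^ (9 / 20 : ℝ) := by
  have h0 : 0 ≤ T := by linarith
  calc _ ≤ T ^ ((14 : ℕ) / 200 : ℝ) * (2 * T ^ (3 / 8 : ℝ)) := by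
        gcongr
        · exact Real.rpow_nonneg ((by positivity : (0 : ℝ) ≤ 1 / (2 * T)).trans (le_sin_inv hT)) _
        · exact level_pow_le h0 14
        · exact (sin_inv_rpow_le hT (by norm_num)).trans (two_mul_rpow_le hT (by norm_num))
    _ = 2 * T ^ ((14 : ℕ) / 200 + 3 / 8 : ℝ) := by
        rw [Real.rpow_add (by linarith)]; ring
    _ ≤ _ := by
        gcongr 2 * ?_
        exact Real.rpow_le_rpow_of_exponent_le hT (by norm_num)

theorem exists_mollTheta_sq_le : ∃ C : ℝ, 0 < C ∧ ∀ᶠ T : ℝ in atTop,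
    ∫ v in Ioi (0 : ℝ), ‖mollTheta (level T) (ray (angle T)) v‖ ^ 2 ≤ C * T ^ (1 / 2 : ℝ) := by
  obtain ⟨C, hC, hQ⟩ := exists_quadForm_le
  set S := ∑' x, offKernel x with hS
  have hS0 : 0 ≤ S := tsum_nonneg offKernel_nonneg
  refine ⟨32 * (2 * Real.exp 200 * (2 * C)) + 8 * S * 2 + 10, by positivity, ?_⟩
  filter_upwards [eventually_log_level, eventually_ge_atTop (Real.exp 1)] with T hN hT
  obtain ⟨hN3, hlog⟩ := hN
  have hT1 : 1 ≤ T := (Real.one_le_exp zero_le_one).trans hT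
  have hT0 : 0 < T := by linarith
  have hL1 : 1 ≤ Real.log T := (Real.le_log_iff_exp_le hT0).2 hT
  set N := level T with hNdef
  have hlN1 : 1 ≤ Real.log N := by
    rw [Real.le_log_iff_exp_le (by positivity)]
    have : (3 : ℝ) ≤ N := by exact_mod_cast hN3
    linarith [Real.exp_one_lt_d9]
  set ε := 1 / (2 * Real.log N) with hε
  have hε0 : 0 < ε := by positivity
  have hε1 : ε ≤ 1 / 2 := by
    rw [hε]; gcongr; linarith
  have hεN : ε * Real.log N ≤ 1 := by
    rw [hε]; field_simp; norm_num
  have h := setIntegral_mollTheta_sq_le (N := N) (z := ray (angle T)) (by omega)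
    (by rw [ray_angle_re]; exact (by positivity : 0 < 1 / (2 * T)).trans_le (le_sin_inv hT1))
    (by rw [ray_angle_im]; exact half_le_cos_inv hT1) (norm_ray _) hε0 hε1
  rw [ray_angle_re, ← hS] at h
  refine h.trans ?_
  have hs0 : 0 ≤ Real.sin (1 / T) := (by positivity : (0 : ℝ) ≤ 1 / (2 * T)).trans (le_sin_inv hT1)
  have e1 : Real.sin (1 / T) ^ (-(1 + ε) / 2) ≤ 2 * Real.exp 200 * T ^ (1 / 2 : ℝ) := by
    have := sin_inv_rpow_le hT1 (a := (1 + ε) / 2) (by positivity)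
    rw [show -(1 + ε) / 2 = -((1 + ε) / 2) by ring]
    refine this.trans ?_
    rw [add_div, Real.rpow_add (by positivity)]
    have h2 := two_mul_rpow_le hT1 (a := 1 / 2) (by norm_num)
    have h3 : (2 * T) ^ (ε / 2) ≤ Real.exp 200 := by
      rw [Real.rpow_def_of_pos (by positivity)]
      apply Real.exp_le_exp.2
      have h5 : Real.log (2 * T) ≤ 2 * Real.log T := by
        rw [Real.log_mul two_ne_zero hT0.ne']
        linarith [Real.log_two_lt_d9]
      have h6 : ε ≤ 200 / Real.log T := by
        rw [hε, div_le_div_iff₀ (by positivity) (by positivity)]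
        linarith
      calc _ ≤ 2 * Real.log T * (200 / Real.log T / 2) := by gcongr
        _ = 200 := by field_simp
    calc _ ≤ (2 * T ^ (1 / 2 : ℝ)) * Real.exp 200 := by gcongr
      _ = _ := by ring
  have e2 : quadForm N ε / ε ≤ 2 * C := by
    rw [div_le_iff₀ hε0, hε]
    refine (hQ N ε (by omega) hε0.le hεN).trans_eq ?_
    field_simp
  have e3 := level_pow_mul_sin_rpow_le hT1
  have e4 : T ^ (9 / 20 : ℝ) ≤ T ^ (1 / 2 : ℝ) :=
    Real.rpow_le_rpow_of_exponent_le hT1 (by norm_num)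
  have e5 : (N : ℝ) ^ 6 ≤ T ^ (1 / 2 : ℝ) :=
    (level_pow_le hT0.le 6).trans (Real.rpow_le_rpow_of_exponent_le hT1 (by norm_num))
  calc _ ≤ 32 * ((2 * Real.exp 200 * T ^ (1 / 2 : ℝ)) * (2 * C)) + 8 * S * (2 * T ^ (1 / 2 : ℝ)) +
        10 * T ^ (1 / 2 : ℝ) := by
        rw [mul_div_assoc]
        have := div_nonneg (quadForm_nonneg N hε0.le) hε0.le
        gcongr ?_ + 8 * S * ?_ + 10 * ?_
        · gcongr
        · exact e3.trans (by linarith)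
    _ = _ := by ring

theorem exists_intervalIntegral_mollTheta_sq_le : ∃ C : ℝ, 0 < C ∧ ∀ η : ℝ, 0 < η → η ≤ 1 / 10 →
    ∀ᶠ T : ℝ in atTop, ∫ v in (0 : ℝ)..(η * Real.log T),
      ‖mollTheta (level T) (ray (angle T)) v‖ ^ 2 ≤ C * η * T ^ (1 / 2 : ℝ) := by
  obtain ⟨C, hC, hQ⟩ := exists_quadForm_le
  set S := ∑' x, offKernel x with hS
  have hS0 : 0 ≤ S := tsum_nonneg offKernel_nonneg
  refine ⟨8 * (800 * C + 1) + (16 * S + 2), by positivity, fun η hη hη1 => ?_⟩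
  have hlog' : ∀ᶠ T : ℝ in atTop, Real.log T ≤ T ^ (1 / 20 : ℝ) := by
    filter_upwards [(isLittleO_log_rpow_atTop (r := 1 / 20) (by norm_num)).bound zero_lt_one,
      eventually_ge_atTop 1] with T h hT
    rw [Real.norm_of_nonneg (Real.log_nonneg hT),
      Real.norm_of_nonneg (Real.rpow_nonneg (by linarith) _), one_mul] at h
    exact h
  have hη' : ∀ᶠ T : ℝ in atTop, 1 / η ≤ T ^ (1 / 20 : ℝ) :=
    (tendsto_rpow_atTop (by norm_num)).eventually (eventually_ge_atTop _)
  filter_upwards [eventually_log_level, eventually_ge_atTop (Real.exp 1), hlog', hη']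
    with T hN hT hlT hηT
  obtain ⟨hN3, hlog⟩ := hN
  have hT1 : 1 ≤ T := (Real.one_le_exp zero_le_one).trans hT
  have hT0 : 0 < T := by linarith
  have hL1 : 1 ≤ Real.log T := (Real.le_log_iff_exp_le hT0).2 hT
  set N := level T with hNdef
  have h := intervalIntegral_mollTheta_sq_le (N := N) (z := ray (angle T)) (by omega)
    (by rw [ray_angle_re]; exact (by positivity : 0 < 1 / (2 * T)).trans_le (le_sin_inv hT1))
    (by rw [ray_angle_im]; exact half_le_cos_inv hT1) (norm_ray _)
    (V := η * Real.log T) (by positivity)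
  rw [ray_angle_re, ← hS] at h
  refine h.trans ?_
  have hs0 : 0 ≤ Real.sin (1 / T) := (by positivity : (0 : ℝ) ≤ 1 / (2 * T)).trans (le_sin_inv hT1)
  have e1 : Real.sin (1 / T) ^ (-(1 / 2) : ℝ) ≤ 2 * T ^ (1 / 2 : ℝ) :=
    (sin_inv_rpow_le hT1 (by norm_num)).trans (two_mul_rpow_le hT1 (by norm_num))
  have e2 : quadForm N 0 ≤ 400 * C / Real.log T := by
    refine (hQ N 0 (by omega) le_rfl (by simp)).trans ?_
    rw [div_le_div_iff₀ (by linarith) (by linarith)]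
    nlinarith
  have e3 := level_pow_mul_sin_rpow_le hT1
  have e5 : (N : ℝ) ^ 6 ≤ T ^ (9 / 20 : ℝ) :=
    (level_pow_le hT0.le 6).trans (Real.rpow_le_rpow_of_exponent_le hT1 (by norm_num))
  have e6 : T ^ (9 / 20 : ℝ) ≤ η * T ^ (1 / 2 : ℝ) := by
    rw [show (1 / 2 : ℝ) = 9 / 20 + 1 / 20 by norm_num, Real.rpow_add hT0]
    have : 1 ≤ η * T ^ (1 / 20 : ℝ) := by
      rwa [div_le_iff₀' hη] at hηT
    have h9 : 0 ≤ T ^ (9 / 20 : ℝ) := by positivity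
    nlinarith
  have e7 : Real.log T * ((N : ℝ) ^ 6 * Real.exp (η * Real.log T)) ≤ T ^ (1 / 2 : ℝ) := by
    have : Real.exp (η * Real.log T) ≤ T ^ (1 / 10 : ℝ) := by
      rw [Real.rpow_def_of_pos hT0, mul_comm]
      apply Real.exp_le_exp.2
      gcongr
    calc _ ≤ T ^ (1 / 20 : ℝ) * (T ^ ((6 : ℕ) / 200 : ℝ) * T ^ (1 / 10 : ℝ)) := by
          gcongr
          exact level_pow_le hT0.le 6
      _ = T ^ (1 / 20 + ((6 : ℕ) / 200 + 1 / 10) : ℝ) := by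
          rw [Real.rpow_add hT0, Real.rpow_add hT0]
      _ ≤ _ := Real.rpow_le_rpow_of_exponent_le hT1 (by norm_num)
  calc _ ≤ 8 * (η * Real.log T * ((2 * T ^ (1 / 2 : ℝ)) * (400 * C / Real.log T) +
        (N : ℝ) ^ 6 * Real.exp (η * Real.log T))) + 8 * S * (2 * (η * T ^ (1 / 2 : ℝ))) +
        2 * (η * T ^ (1 / 2 : ℝ)) := by
        have := quadForm_nonneg N le_rfl
        gcongr ?_ + 8 * S * ?_ + 2 * ?_
        · gcongr
        · exact e3.trans (by linarith)
        · exact e5.trans e6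
    _ = 8 * (800 * C) * η * T ^ (1 / 2 : ℝ) +
        8 * η * (Real.log T * ((N : ℝ) ^ 6 * Real.exp (η * Real.log T))) +
        (16 * S + 2) * η * T ^ (1 / 2 : ℝ) := by
        field_simp
        ring
    _ ≤ 8 * (800 * C) * η * T ^ (1 / 2 : ℝ) + 8 * η * T ^ (1 / 2 : ℝ) +
        (16 * S + 2) * η * T ^ (1 / 2 : ℝ) := by gcongr
    _ = _ := by ring

theorem exists_integral_hardy_sq_le : ∃ C : ℝ, 0 < C ∧ ∀ᶠ T : ℝ in atTop,
    ∫ t, hardy (level T) (angle T) t ^ 2 ≤ C * T ^ (1 / 2 : ℝ) := by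
  obtain ⟨C, hC, h⟩ := exists_mollTheta_sq_le
  refine ⟨4 * Real.pi * C, by positivity, ?_⟩
  filter_upwards [h, eventually_ge_atTop 1] with T h hT
  rw [integral_hardy_sq _ (angle_pos hT) (angle_lt (by linarith)), mul_assoc _ C]
  gcongr

theorem exists_integral_intervalIntegral_hardy_sq_le : ∃ C : ℝ, 0 < C ∧
    ∀ η : ℝ, 0 < η → η ≤ 1 / 10 → ∀ A : ℝ, 0 < A → ∀ᶠ T : ℝ in atTop,
    ∫ t, (∫ x in t..(t + A / Real.log T), hardy (level T) (angle T) x) ^ 2 ≤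
      C * (η + 1 / (η ^ 2 * A ^ 2)) * ((A / Real.log T) ^ 2 * T ^ (1 / 2 : ℝ)) := by
  obtain ⟨C₁, hC₁, h₁⟩ := exists_mollTheta_sq_le
  obtain ⟨C₂, hC₂, h₂⟩ := exists_intervalIntegral_mollTheta_sq_le
  refine ⟨16 * Real.pi * (C₁ + C₂), by positivity, fun η hη hη1 A hA => ?_⟩
  filter_upwards [h₁, h₂ η hη hη1, eventually_ge_atTop (Real.exp 1)] with T h₁ h₂ hT
  have hT1 : 1 ≤ T := (Real.one_le_exp zero_le_one).trans hT
  have hT0 : 0 < T := by linarith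
  have hL1 : 1 ≤ Real.log T := (Real.le_log_iff_exp_le hT0).2 hT
  refine (integral_intervalIntegral_hardy_sq_le _ (angle_pos hT1) (angle_lt hT0)
    (H := A / Real.log T) (by positivity) (V := η * Real.log T) (by positivity)).trans ?_
  calc _ ≤ 4 * Real.pi * ((A / Real.log T) ^ 2 * (C₂ * η * T ^ (1 / 2 : ℝ)) +
        4 / (η * Real.log T) ^ 2 * (C₁ * T ^ (1 / 2 : ℝ))) := by gcongr
    _ = 4 * Real.pi * ((C₂ * η) * ((A / Real.log T) ^ 2 * T ^ (1 / 2 : ℝ)) +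
        4 * C₁ * (1 / (η ^ 2 * A ^ 2)) * ((A / Real.log T) ^ 2 * T ^ (1 / 2 : ℝ))) := by
        field_simp
    _ ≤ 4 * Real.pi * ((4 * (C₁ + C₂) * η) * ((A / Real.log T) ^ 2 * T ^ (1 / 2 : ℝ)) +
        4 * (C₁ + C₂) * (1 / (η ^ 2 * A ^ 2)) * ((A / Real.log T) ^ 2 * T ^ (1 / 2 : ℝ))) := by
        gcongr <;> linarith
    _ = _ := by ring

end Parameters

end Selberg

namespace Selberg

open Complex Set MeasureTheory Filter Topology ComplexConjugate

section GammaBound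

theorem norm_pow_four_le (j : ℕ) {u : ℝ} (hu : 1 ≤ u) :
    ‖(1 / 4 + u * I : ℂ) + j‖ ^ 4 ≤ (1 + 1 / ((j : ℝ) + 1 / 4) ^ 2) *
      (‖(-1 / 4 + u * I : ℂ) + j‖ ^ 2 * ‖(3 / 4 + u * I : ℂ) + j‖ ^ 2) := by
  have key (x : ℝ) : ‖(x + u * I : ℂ) + j‖ ^ 2 = (x + j) ^ 2 + u ^ 2 := by
    rw [Complex.sq_norm, Complex.normSq_apply]
    simp
    ring
  have h1 := key (1 / 4)
  have h2 := key (-1 / 4)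
  have h3 := key (3 / 4)
  push_cast at h1 h2 h3
  rw [show 4 = 2 * 2 from rfl, pow_mul, h1, h2, h3]
  set a : ℝ := j + 1 / 4 with ha
  have ha0 : 0 < a := by positivity
  have hX : ((-1 / 4 + j) ^ 2 + u ^ 2) * ((3 / 4 + (j : ℝ)) ^ 2 + u ^ 2) =
      (a ^ 2 + u ^ 2) ^ 2 + (u ^ 2 / 2 + 1 / 16 - a ^ 2 / 2) := by
    rw [ha]; ring
  rw [hX, show 1 / 4 + (j : ℝ) = a by rw [ha]; ring]
  have : 1 + 1 / a ^ 2 = (a ^ 2 + 1) / a ^ 2 := by field_simp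
  rw [this, div_mul_eq_mul_div, le_div_iff₀ (by positivity)]
  have hu2 : 1 ≤ u ^ 2 := by nlinarith
  rcases Nat.eq_zero_or_pos j with rfl | hj
  · have : a = 1 / 4 := by simp [ha]
    rw [this]
    nlinarith [sq_nonneg (u ^ 2)]
  · have : 1 ≤ a := by
      have : (1 : ℝ) ≤ j := by exact_mod_cast hj
      linarith
    have ha2 : 1 ≤ a ^ 2 := by nlinarith
    nlinarith [mul_nonneg (sq_nonneg a) (sq_nonneg u), sq_nonneg (a ^ 2), sq_nonneg (u ^ 2)]

theorem exists_prod_le : ∃ K : ℝ, 0 < K ∧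
    ∀ n : ℕ, ∏ j ∈ Finset.range n, (1 + 1 / ((j : ℝ) + 1 / 4) ^ 2) ≤ K := by
  have hs : Summable fun j : ℕ => 1 / ((j : ℝ) + 1 / 4) ^ 2 := by
    have := (Real.summable_one_div_nat_add_rpow (1 / 4) 2).2 (by norm_num)
    refine this.congr fun j => ?_
    rw [abs_of_nonneg (by positivity)]
    norm_num
  refine ⟨Real.exp (∑' j : ℕ, 1 / ((j : ℝ) + 1 / 4) ^ 2), Real.exp_pos _, fun n => ?_⟩
  calc _ ≤ ∏ j ∈ Finset.range n, Real.exp (1 / ((j : ℝ) + 1 / 4) ^ 2) := by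
        refine Finset.prod_le_prod (fun j _ => by positivity) fun j _ => ?_
        rw [add_comm]
        exact Real.add_one_le_exp _
    _ = Real.exp (∑ j ∈ Finset.range n, 1 / ((j : ℝ) + 1 / 4) ^ 2) := (Real.exp_sum _ _).symm
    _ ≤ _ := Real.exp_le_exp.2 (hs.sum_le_tsum _ fun j _ => by positivity)

theorem norm_GammaSeq (x u : ℝ) (n : ℕ) (hn : 0 < n) : ‖GammaSeq (x + u * I) n‖ =
    (n : ℝ) ^ x * (n.factorial : ℝ) / ∏ j ∈ Finset.range (n + 1), ‖(x + u * I : ℂ) + j‖ := by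
  rw [GammaSeq, norm_div, norm_mul, norm_prod, Complex.norm_natCast,
    norm_natCast_cpow_of_pos hn]
  simp

theorem exists_Gamma_quarter_ge : ∃ K : ℝ, 0 < K ∧ ∀ u : ℝ, 1 ≤ u →
    ‖Complex.Gamma (-1 / 4 + u * I)‖ ^ 2 * ‖Complex.Gamma (3 / 4 + u * I)‖ ^ 2 ≤
      K * ‖Complex.Gamma (1 / 4 + u * I)‖ ^ 4 := by
  obtain ⟨K, hK, hprod⟩ := exists_prod_le
  refine ⟨K, hK, fun u hu => ?_⟩
  have h1 := ((GammaSeq_tendsto_Gamma (-1 / 4 + u * I)).norm.pow 2).mul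
    ((GammaSeq_tendsto_Gamma (3 / 4 + u * I)).norm.pow 2)
  have h2 := ((GammaSeq_tendsto_Gamma (1 / 4 + u * I)).norm.pow 4).const_mul K
  refine le_of_tendsto_of_tendsto h1 h2 ?_
  filter_upwards [eventually_gt_atTop 0] with n hn
  have e1 := norm_GammaSeq (-1 / 4) u n hn
  have e2 := norm_GammaSeq (3 / 4) u n hn
  have e3 := norm_GammaSeq (1 / 4) u n hn
  push_cast at e1 e2 e3
  rw [e1, e2, e3]
  have hp (x : ℝ) : 0 < ∏ j ∈ Finset.range (n + 1), ‖(x + u * I : ℂ) + j‖ := by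
    refine Finset.prod_pos fun j _ => norm_pos_iff.2 fun h => ?_
    have := congrArg Complex.im h
    simp at this
    linarith
  have p1 := hp (-1 / 4)
  have p2 := hp (3 / 4)
  have p3 := hp (1 / 4)
  push_cast at p1 p2 p3
  have hP : (∏ j ∈ Finset.range (n + 1), ‖(1 / 4 + u * I : ℂ) + j‖) ^ 4 ≤
      K * ((∏ j ∈ Finset.range (n + 1), ‖(-1 / 4 + u * I : ℂ) + j‖) ^ 2 *
      (∏ j ∈ Finset.range (n + 1), ‖(3 / 4 + u * I : ℂ) + j‖) ^ 2) := by
    rw [← Finset.prod_pow, ← Finset.prod_pow, ← Finset.prod_pow, ← Finset.prod_mul_distrib]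
    refine (Finset.prod_le_prod (fun j _ => by positivity)
      fun j _ => norm_pow_four_le j hu).trans ?_
    rw [Finset.prod_mul_distrib]
    exact mul_le_mul_of_nonneg_right (hprod _) (Finset.prod_nonneg fun j _ => by positivity)
  set P1 := ∏ j ∈ Finset.range (n + 1), ‖(-1 / 4 + u * I : ℂ) + j‖
  set P2 := ∏ j ∈ Finset.range (n + 1), ‖(3 / 4 + u * I : ℂ) + j‖
  set P3 := ∏ j ∈ Finset.range (n + 1), ‖(1 / 4 + u * I : ℂ) + j‖
  have hn' : (0 : ℝ) < n := by exact_mod_cast hn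
  have hpow : ((n : ℝ) ^ (-1 / 4 : ℝ)) ^ 2 * ((n : ℝ) ^ (3 / 4 : ℝ)) ^ 2 =
      ((n : ℝ) ^ (1 / 4 : ℝ)) ^ 4 := by
    rw [← Real.rpow_natCast, ← Real.rpow_natCast, ← Real.rpow_natCast, ← Real.rpow_mul hn'.le,
      ← Real.rpow_mul hn'.le, ← Real.rpow_mul hn'.le, ← Real.rpow_add hn']
    norm_num
  calc _ = ((n : ℝ) ^ (-1 / 4 : ℝ)) ^ 2 * ((n : ℝ) ^ (3 / 4 : ℝ)) ^ 2 *
        (n.factorial : ℝ) ^ 4 / (P1 ^ 2 * P2 ^ 2) := by field_simp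
    _ = ((n : ℝ) ^ (1 / 4 : ℝ)) ^ 4 * (n.factorial : ℝ) ^ 4 / (P1 ^ 2 * P2 ^ 2) := by rw [hpow]
    _ ≤ ((n : ℝ) ^ (1 / 4 : ℝ)) ^ 4 * (n.factorial : ℝ) ^ 4 * (K / P3 ^ 4) := by
        rw [div_eq_mul_one_div]
        gcongr ?_ * ?_
        rw [div_le_div_iff₀ (by positivity) (by positivity)]
        linarith
    _ = _ := by ring

theorem norm_sin_le (z : ℂ) : ‖Complex.sin z‖ ≤ Real.exp |z.im| := by
  rw [Complex.sin]
  have h1 : ‖cexp (-z * I)‖ ≤ Real.exp |z.im| := by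
    rw [Complex.norm_exp]
    simp [le_abs_self]
  have h2 : ‖cexp (z * I)‖ ≤ Real.exp |z.im| := by
    rw [Complex.norm_exp]
    simp [neg_le_abs]
  rw [norm_div, norm_mul, norm_I, mul_one, RCLike.norm_ofNat, div_le_iff₀ two_pos]
  linarith [norm_sub_le (cexp (-z * I)) (cexp (z * I))]

theorem exists_le_norm_Gammaℝ : ∃ c : ℝ, 0 < c ∧ ∀ t : ℝ, 2 ≤ t →
    c * (t ^ (-(1 / 4) : ℝ) * Real.exp (-(Real.pi * t / 4))) ≤ ‖Gammaℝ (1 / 2 + I * t)‖ := by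
  obtain ⟨K, hK, h⟩ := exists_Gamma_quarter_ge
  refine ⟨Real.pi ^ (-(1 / 4) : ℝ) * (Real.pi ^ 4 / K) ^ (1 / 8 : ℝ), by positivity,
    fun t ht => ?_⟩
  set u := t / 2 with hu
  have hu1 : 1 ≤ u := by rw [hu]; linarith
  have hG : ‖Gammaℝ (1 / 2 + I * t)‖ =
      Real.pi ^ (-(1 / 4) : ℝ) * ‖Complex.Gamma (1 / 4 + u * I)‖ := by
    rw [Gammaℝ_def, norm_mul, Complex.norm_cpow_eq_rpow_re_of_pos Real.pi_pos]
    congr 2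
    · simp; norm_num
    · congr 1; rw [hu]; push_cast; ring
  rw [hG, mul_assoc]
  refine mul_le_mul_of_nonneg_left ?_ (by positivity)
  set g := ‖Complex.Gamma (1 / 4 + u * I)‖ with hg
  set g' := ‖Complex.Gamma (3 / 4 + u * I)‖ with hg'
  have hrec : g' = ‖(-1 / 4 + u * I : ℂ)‖ * ‖Complex.Gamma (-1 / 4 + u * I)‖ := by
    rw [hg', ← norm_mul, ← Complex.Gamma_add_one]
    · congr 2; ring
    · intro h0
      have := congrArg Complex.im h0
      simp at this
      linarith
  have hnorm : ‖(-1 / 4 + u * I : ℂ)‖ ^ 2 ≤ t ^ 2 := by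
    rw [Complex.sq_norm, Complex.normSq_apply]
    simp
    nlinarith
  have hrefl : g * g' * Real.exp (Real.pi * u) ≥ Real.pi := by
    have h1 := Complex.Gamma_mul_Gamma_one_sub (1 / 4 + u * I)
    have h2 : Complex.Gamma (1 - (1 / 4 + u * I)) = conj (Complex.Gamma (3 / 4 + u * I)) := by
      rw [← Complex.Gamma_conj]
      congr 1
      rw [map_add, map_mul, conj_I, conj_ofReal, map_div₀, map_ofNat, map_ofNat]
      ring
    have h3 : g * g' = Real.pi / ‖Complex.sin (Real.pi * (1 / 4 + u * I))‖ := by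
      have := congrArg norm h1
      rw [h2, norm_mul, norm_div, RCLike.norm_conj, Complex.norm_of_nonneg Real.pi_pos.le] at this
      exact this
    have h4 : ‖Complex.sin (Real.pi * (1 / 4 + u * I))‖ ≤ Real.exp (Real.pi * u) := by
      refine (norm_sin_le _).trans_eq ?_
      congr 1
      have : (Real.pi * (1 / 4 + u * I) : ℂ).im = Real.pi * u := by simp
      rw [this, abs_of_nonneg (mul_nonneg Real.pi_pos.le (by linarith))]
    have hs0 : 0 < ‖Complex.sin (Real.pi * (1 / 4 + u * I))‖ := by
      refine (norm_nonneg _).lt_of_ne fun h0 => ?_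
      rw [← h0, div_zero, mul_eq_zero] at h3
      rcases h3 with h3 | h3
      · refine Complex.Gamma_ne_zero_of_re_pos ?_ (norm_eq_zero.1 h3); simp
      · refine Complex.Gamma_ne_zero_of_re_pos ?_ (norm_eq_zero.1 h3); simp
    rw [h3, ge_iff_le, div_mul_eq_mul_div, le_div_iff₀ hs0]
    gcongr
  have hmain : g' ^ 4 ≤ K * t ^ 2 * g ^ 4 := by
    have := h u hu1
    calc g' ^ 4 = ‖(-1 / 4 + u * I : ℂ)‖ ^ 2 *
          (‖Complex.Gamma (-1 / 4 + u * I)‖ ^ 2 * g' ^ 2) := by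
          rw [show g' ^ 4 = g' ^ 2 * g' ^ 2 by ring]
          nth_rewrite 1 [hrec]
          ring
      _ ≤ t ^ 2 * (K * g ^ 4) := by gcongr
      _ = _ := by ring
  have h8 : Real.pi ^ 4 / K * (t ^ (-2 : ℝ) * Real.exp (-(2 * Real.pi * t))) ≤ g ^ 8 := by
    have : Real.pi ^ 4 ≤ g ^ 8 * K * t ^ 2 * Real.exp (2 * Real.pi * t) := by
      calc Real.pi ^ 4 ≤ (g * g' * Real.exp (Real.pi * u)) ^ 4 := by gcongr
        _ = g ^ 4 * g' ^ 4 * Real.exp (2 * Real.pi * t) := by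
            rw [mul_pow, mul_pow, ← Real.exp_nat_mul, hu]
            congr 2
            push_cast; ring
        _ ≤ g ^ 4 * (K * t ^ 2 * g ^ 4) * Real.exp (2 * Real.pi * t) := by gcongr
        _ = _ := by ring
    have ht0 : 0 < t := by linarith
    rw [Real.exp_neg, Real.rpow_neg ht0.le, ← mul_inv, div_mul_eq_mul_div, div_le_iff₀ hK,
      ← div_eq_mul_inv, div_le_iff₀ (by positivity)]
    norm_num
    linarith
  have h9 := Real.rpow_le_rpow (by positivity) h8 (by norm_num : (0 : ℝ) ≤ 1 / 8)
  have ht0 : 0 < t := by linarith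
  rw [← Real.rpow_natCast g,
    ← Real.rpow_mul (norm_nonneg _), Real.mul_rpow (by positivity) (by positivity), Real.mul_rpow (by positivity) (by positivity),
    ← Real.rpow_mul ht0.le, ← Real.exp_mul] at h9
  norm_num at h9
  rwa [show -(2 * Real.pi * t * (1 / 8)) = -(Real.pi * t / 4) by ring] at h9

end GammaBound

end Selberg

namespace Selberg

open Complex Set MeasureTheory Filter Topology ComplexConjugate

section ZetaGrowth

/-- The terms of the Euler-Maclaurin series for `ζ`. -/
noncomputable def eulerTerm (n : ℕ) (s : ℂ) : ℂ :=
  ((n + 2 : ℕ) : ℂ) ^ (-s) - (((n + 2 : ℕ) : ℂ) ^ (1 - s) - ((n + 1 : ℕ) : ℂ) ^ (1 - s)) / (1 - s)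

theorem eulerTerm_eq_integral (n : ℕ) {s : ℂ} (hs : s ≠ 1) : eulerTerm n s =
    ∫ x in ((n + 1 : ℕ) : ℝ)..((n + 2 : ℕ) : ℝ), (((n + 2 : ℕ) : ℂ) ^ (-s) - (x : ℂ) ^ (-s)) := by
  have hle : ((n + 1 : ℕ) : ℝ) ≤ ((n + 2 : ℕ) : ℝ) := by push_cast; linarith
  have h0 : (0 : ℝ) ∉ uIcc ((n + 1 : ℕ) : ℝ) ((n + 2 : ℕ) : ℝ) := by
    rw [uIcc_of_le hle]
    intro h
    have : (0 : ℝ) < (n + 1 : ℕ) := by positivity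
    linarith [h.1]
  have h1 : -s ≠ -1 := fun h => hs (neg_injective h)
  rw [intervalIntegral.integral_sub intervalIntegrable_const
    (intervalIntegral.intervalIntegrable_cpow (Or.inr h0)), integral_cpow (Or.inr ⟨h1, h0⟩),
    intervalIntegral.integral_const, eulerTerm]
  push_cast
  rw [show ((n : ℝ) + 2 - (n + 1)) = 1 by ring, one_smul, show -s + 1 = 1 - s by ring]

theorem norm_cpow_sub_le (n : ℕ) {s : ℂ} (hs : 0 ≤ s.re) {x : ℝ}
    (hx : x ∈ Icc ((n + 1 : ℕ) : ℝ) ((n + 2 : ℕ) : ℝ)) :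
    ‖((n + 2 : ℕ) : ℂ) ^ (-s) - (x : ℂ) ^ (-s)‖ ≤ ‖s‖ * ((n + 1 : ℕ) : ℝ) ^ (-s.re - 1) := by
  have hn : (0 : ℝ) < (n + 1 : ℕ) := by positivity
  have hle : ((n + 1 : ℕ) : ℝ) ≤ ((n + 2 : ℕ) : ℝ) := by push_cast; linarith
  have h := Convex.norm_image_sub_le_of_norm_hasDerivWithin_le (𝕜 := ℝ)
    (f := fun y : ℝ => (y : ℂ) ^ (-s)) (f' := fun y : ℝ => -s * (y : ℂ) ^ (-s - 1))
    (C := ‖s‖ * ((n + 1 : ℕ) : ℝ) ^ (-s.re - 1)) (s := Icc ((n + 1 : ℕ) : ℝ) ((n + 2 : ℕ) : ℝ))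
    (fun y hy => by
      have hy0 : 0 < y := hn.trans_le hy.1
      refine HasDerivAt.hasDerivWithinAt ?_
      by_cases h0 : s = 0
      · simpa [h0] using hasDerivAt_const y (1 : ℂ)
      · exact hasDerivAt_ofReal_cpow_const hy0.ne' (neg_ne_zero.2 h0))
    (fun y hy => by
      have hy0 : 0 < y := hn.trans_le hy.1
      rw [norm_mul, norm_neg, norm_cpow_eq_rpow_re_of_pos hy0]
      refine mul_le_mul_of_nonneg_left ?_ (norm_nonneg _)
      exact Real.rpow_le_rpow_of_nonpos hn hy.1 (by simp; linarith))
    (convex_Icc _ _) hx (right_mem_Icc.2 hle)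
  have h2 : ‖((n + 2 : ℕ) : ℝ) - x‖ ≤ 1 := by
    rw [Real.norm_eq_abs, abs_le]
    have := hx.1
    have := hx.2
    push_cast at *
    constructor <;> linarith
  rw [ofReal_natCast] at h
  exact h.trans (mul_le_of_le_one_right (by positivity) h2)

theorem norm_eulerTerm_le (n : ℕ) {s : ℂ} (h1 : s ≠ 1) (hs : 0 ≤ s.re) {θ : ℝ} (h0 : 0 ≤ θ)
    (hθ : θ ≤ 1) : ‖eulerTerm n s‖ ≤ 2 * ‖s‖ ^ θ * ((n + 1 : ℕ) : ℝ) ^ (-s.re - θ) := by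
  have hn : (0 : ℝ) < (n + 1 : ℕ) := by positivity
  have hle : ((n + 1 : ℕ) : ℝ) ≤ ((n + 2 : ℕ) : ℝ) := by push_cast; linarith
  have key : ∀ C : ℝ, (∀ x ∈ Icc ((n + 1 : ℕ) : ℝ) ((n + 2 : ℕ) : ℝ),
      ‖((n + 2 : ℕ) : ℂ) ^ (-s) - (x : ℂ) ^ (-s)‖ ≤ C) → ‖eulerTerm n s‖ ≤ C := fun C hC => by
    rw [eulerTerm_eq_integral n h1]
    refine (intervalIntegral.norm_integral_le_of_norm_le_const (C := C) fun x hx => ?_).trans ?_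
    · rw [uIoc_of_le hle] at hx
      exact hC x ⟨hx.1.le, hx.2⟩
    · push_cast
      rw [show ((n : ℝ) + 2 - (n + 1)) = 1 by ring, abs_one, mul_one]
  have hA := key _ fun x hx => norm_cpow_sub_le n hs hx
  have hB := key (2 * ((n + 1 : ℕ) : ℝ) ^ (-s.re)) fun x hx => by
    refine (norm_sub_le _ _).trans ?_
    have e1 : ‖((n + 2 : ℕ) : ℂ) ^ (-s)‖ ≤ ((n + 1 : ℕ) : ℝ) ^ (-s.re) := by
      rw [norm_natCast_cpow_of_pos (by omega), neg_re]
      exact Real.rpow_le_rpow_of_nonpos hn hle (by linarith)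
    have e2 : ‖(x : ℂ) ^ (-s)‖ ≤ ((n + 1 : ℕ) : ℝ) ^ (-s.re) := by
      rw [norm_cpow_eq_rpow_re_of_pos (hn.trans_le hx.1), neg_re]
      exact Real.rpow_le_rpow_of_nonpos hn hx.1 (by linarith)
    linarith
  calc ‖eulerTerm n s‖ = ‖eulerTerm n s‖ ^ θ * ‖eulerTerm n s‖ ^ (1 - θ) := by
        rw [← Real.rpow_add_of_nonneg (norm_nonneg _) h0 (by linarith)]
        simp
    _ ≤ (‖s‖ * ((n + 1 : ℕ) : ℝ) ^ (-s.re - 1)) ^ θ *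
        (2 * ((n + 1 : ℕ) : ℝ) ^ (-s.re)) ^ (1 - θ) := by
        gcongr
    _ = 2 ^ (1 - θ) * ‖s‖ ^ θ * ((n + 1 : ℕ) : ℝ) ^ (-s.re - θ) := by
        rw [Real.mul_rpow (norm_nonneg _) (by positivity), Real.mul_rpow (by norm_num)
          (by positivity), ← Real.rpow_mul hn.le, ← Real.rpow_mul hn.le,
          show -s.re - θ = (-s.re - 1) * θ + -s.re * (1 - θ) by ring, Real.rpow_add hn]
        ring
    _ ≤ _ := by
        gcongr
        exact (Real.rpow_le_rpow_of_exponent_le one_le_two (by linarith)).trans_eq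
          (Real.rpow_one 2)

theorem summable_succ_rpow {a : ℝ} (ha : a < -1) :
    Summable fun n : ℕ => ((n + 1 : ℕ) : ℝ) ^ a :=
  (summable_nat_add_iff 1).2 (Real.summable_nat_rpow.2 ha)

theorem sum_eulerTerm (M : ℕ) {s : ℂ} : ∑ n ∈ Finset.range M, eulerTerm n s =
    (∑ n ∈ Finset.range M, ((n + 2 : ℕ) : ℂ) ^ (-s)) -
      (((M + 1 : ℕ) : ℂ) ^ (1 - s) - 1) / (1 - s) := by
  induction M with
  | zero => simp
  | succ M ih =>
    rw [Finset.sum_range_succ, ih, Finset.sum_range_succ, eulerTerm]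
    ring

theorem riemannZeta_eq_tsum_eulerTerm_of_one_lt {s : ℂ} (hs : 1 < s.re) :
    riemannZeta s = 1 - 1 / (1 - s) + ∑' n, eulerTerm n s := by
  have h1 : s ≠ 1 := fun h => by rw [h] at hs; simp at hs
  have hsum : Summable fun n => eulerTerm n s := by
    refine Summable.of_norm_bounded
      ((summable_succ_rpow (a := -s.re - 1) (by linarith)).mul_left (2 * ‖s‖ ^ (1 : ℝ)))
      fun n => norm_eulerTerm_le n h1 (by linarith) zero_le_one le_rfl
  have hz : HasSum (fun n : ℕ => ((n + 2 : ℕ) : ℂ) ^ (-s)) (riemannZeta s - 1) := by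
    have hS := Complex.summable_one_div_nat_cpow.2 hs
    have h := hS.hasSum
    rw [← zeta_eq_tsum_one_div_nat_cpow hs, ← hasSum_nat_add_iff' 2] at h
    simp only [Finset.sum_range_succ, Finset.sum_range_zero, Nat.cast_zero, Nat.cast_one,
      one_cpow, zero_cpow (Complex.ne_zero_of_one_lt_re hs)] at h
    simpa [cpow_neg] using h
  have ht : Tendsto (fun M : ℕ => ((M + 1 : ℕ) : ℂ) ^ (1 - s)) atTop (𝓝 0) := by
    rw [tendsto_zero_iff_norm_tendsto_zero]
    have : Tendsto (fun M : ℕ => ((M + 1 : ℕ) : ℝ) ^ (-(s.re - 1))) atTop (𝓝 0) :=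
      (tendsto_rpow_neg_atTop (by linarith)).comp
        (tendsto_natCast_atTop_atTop.comp (tendsto_add_atTop_nat 1))
    refine this.congr fun M => ?_
    rw [norm_natCast_cpow_of_pos (by omega)]
    simp
  have hlim := (hz.tendsto_sum_nat.sub ((ht.sub_const 1).div_const (1 - s)))
  simp only [← sum_eulerTerm] at hlim
  rw [tendsto_nhds_unique hsum.hasSum.tendsto_sum_nat hlim]
  ring

theorem differentiable_eulerTerm (n : ℕ) {s : ℂ} (hs : s ≠ 1) :
    DifferentiableAt ℂ (eulerTerm n) s := by
  have h2 : ((n + 2 : ℕ) : ℂ) ≠ 0 := Nat.cast_ne_zero.2 (by omega)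
  have h1 : ((n + 1 : ℕ) : ℂ) ≠ 0 := Nat.cast_ne_zero.2 (by omega)
  unfold eulerTerm
  refine DifferentiableAt.sub ?_ (DifferentiableAt.div (DifferentiableAt.sub ?_ ?_) ?_ ?_)
  · exact differentiableAt_id.neg.const_cpow (Or.inl h2)
  · exact ((differentiableAt_const _).sub differentiableAt_id).const_cpow (Or.inl h2)
  · exact ((differentiableAt_const _).sub differentiableAt_id).const_cpow (Or.inl h1)
  · exact (differentiableAt_const _).sub differentiableAt_id
  · exact sub_ne_zero.2 hs.symm

theorem differentiableAt_tsum_eulerTerm {s : ℂ} (h1 : s ≠ 1) (hs : 0 < s.re) :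
    DifferentiableAt ℂ (fun w => ∑' n, eulerTerm n w) s := by
  set U : Set ℂ := {w | s.re / 2 < w.re} ∩ Metric.ball s 1 ∩ {1}ᶜ with hU
  have hopen : IsOpen U := ((isOpen_lt continuous_const continuous_re).inter
    Metric.isOpen_ball).inter isOpen_compl_singleton
  have hmem : s ∈ U := ⟨⟨by change s.re / 2 < s.re; linarith, Metric.mem_ball_self one_pos⟩, h1⟩
  refine (differentiableOn_tsum_of_summable_norm
    (u := fun n : ℕ => 2 * (‖s‖ + 1) * ((n + 1 : ℕ) : ℝ) ^ (-(s.re / 2) - 1))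
    ((summable_succ_rpow (by linarith)).mul_left _)
    (fun n w hw => (differentiable_eulerTerm n hw.2).differentiableWithinAt) hopen
    fun n w hw => ?_).differentiableAt (hopen.mem_nhds hmem)
  have hre : s.re / 2 < w.re := hw.1.1
  refine (norm_eulerTerm_le n hw.2 (by linarith) zero_le_one le_rfl).trans ?_
  rw [Real.rpow_one]
  have hn : ‖w‖ ≤ ‖s‖ + 1 := by
    have := norm_sub_norm_le w s
    have h2 : ‖w - s‖ < 1 := by simpa [dist_eq_norm] using hw.1.2
    linarith
  gcongr
  push_cast
  linarith [(Nat.cast_nonneg n : (0 : ℝ) ≤ n)]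

theorem riemannZeta_eq_tsum_eulerTerm {s : ℂ} (hs : 0 < s.re) (hi : 0 < s.im) :
    riemannZeta s = 1 - 1 / (1 - s) + ∑' n, eulerTerm n s := by
  set U : Set ℂ := {w | 0 < w.re ∧ 0 < w.im} with hU
  have hopen : IsOpen U := (isOpen_lt continuous_const continuous_re).inter
    (isOpen_lt continuous_const continuous_im)
  have hconv : Convex ℝ U := (convex_halfSpace_re_gt 0).inter (convex_halfSpace_im_gt 0)
  have hne : ∀ w ∈ U, w ≠ 1 := fun w hw h => by
    have := hw.2
    rw [h] at this
    simp at this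
  have hf : AnalyticOnNhd ℂ riemannZeta U := DifferentiableOn.analyticOnNhd
    (fun w hw => (differentiableAt_riemannZeta (hne w hw)).differentiableWithinAt) hopen
  have hg : AnalyticOnNhd ℂ (fun s => 1 - 1 / (1 - s) + ∑' n, eulerTerm n s) U :=
    DifferentiableOn.analyticOnNhd (fun w hw => by
      refine DifferentiableAt.differentiableWithinAt (DifferentiableAt.add ?_
        (differentiableAt_tsum_eulerTerm (hne w hw) hw.1))
      have : 1 - w ≠ 0 := sub_ne_zero.2 (hne w hw).symm
      fun_prop (disch := assumption)) hopen
  have h2 : (2 + I : ℂ) ∈ U := by simp [hU]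
  refine hf.eqOn_of_preconnected_of_eventuallyEq hg hconv.isPreconnected h2 ?_ ⟨hs, hi⟩
  have : {w : ℂ | 1 < w.re} ∈ 𝓝 (2 + I : ℂ) :=
    (isOpen_lt continuous_const continuous_re).mem_nhds (by simp)
  filter_upwards [this] with w hw
  exact riemannZeta_eq_tsum_eulerTerm_of_one_lt hw

theorem exists_norm_riemannZeta_le : ∃ C : ℝ, 1 ≤ C ∧ ∀ θ : ℝ, 0 ≤ θ → θ ≤ 1 → ∀ s : ℂ,
    0 < s.re → 5 / 4 ≤ s.re + θ → 1 ≤ s.im → ‖riemannZeta s‖ ≤ C * ‖s‖ ^ θ := by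
  set K : ℝ := ∑' n : ℕ, ((n + 1 : ℕ) : ℝ) ^ (-(5 / 4) : ℝ) with hK
  have hK0 : 0 ≤ K := tsum_nonneg fun n => by positivity
  refine ⟨2 + 2 * K, by linarith, fun θ h0 hθ s hs hsθ hi => ?_⟩
  have h1 : s ≠ 1 := fun h => by rw [h] at hi; simp at hi; linarith
  rw [riemannZeta_eq_tsum_eulerTerm hs (by linarith)]
  have hnorm : 1 ≤ ‖s‖ := hi.trans ((le_abs_self _).trans (abs_im_le_norm s))
  have hnorm' : 1 ≤ ‖1 - s‖ := by
    have := abs_im_le_norm (1 - s)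
    simp only [sub_im, one_im, zero_sub, abs_neg] at this
    exact hi.trans ((le_abs_self _).trans this)
  have hpow : 1 ≤ ‖s‖ ^ θ := Real.one_le_rpow hnorm h0
  have ht : ‖∑' n, eulerTerm n s‖ ≤ 2 * ‖s‖ ^ θ * K := by
    rw [hK, ← tsum_mul_left]
    refine tsum_of_norm_bounded (((summable_succ_rpow (by norm_num)).mul_left _).hasSum)
      fun n => (norm_eulerTerm_le n h1 hs.le h0 hθ).trans ?_
    gcongr
    · push_cast
      linarith [(Nat.cast_nonneg n : (0 : ℝ) ≤ n)]
    · linarith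
  have h2 : ‖(1 - 1 / (1 - s) : ℂ)‖ ≤ 2 := by
    refine (norm_sub_le _ _).trans ?_
    rw [norm_one, norm_div, norm_one]
    have : 1 / ‖1 - s‖ ≤ 1 := by rw [div_le_one (by linarith)]; exact hnorm'
    linarith
  refine (norm_add_le _ _).trans ?_
  nlinarith

end ZetaGrowth

end Selberg

namespace Selberg

open Complex Set MeasureTheory Filter Topology ComplexConjugate

section LowerBound

theorem differentiable_mollPoly (N : ℕ) : Differentiable ℂ (mollPoly N) := by
  unfold mollPoly
  refine Differentiable.fun_sum fun n hn => (Differentiable.const_cpow (by fun_prop) ?_).const_mul _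
  have := (Finset.mem_Icc.1 hn).1
  exact Or.inl (Nat.cast_ne_zero.2 (by omega))

theorem norm_mollPoly_le {N : ℕ} (hN : 1 ≤ N) {s : ℂ} (hs : 0 ≤ s.re) :
    ‖mollPoly N s‖ ≤ (N : ℝ) ^ 2 := by
  unfold mollPoly
  refine (norm_sum_le_of_le _ (f := _) (n := fun _ => (N : ℝ)) fun n hn => ?_).trans ?_
  · obtain ⟨h1, h2⟩ := Finset.mem_Icc.1 hn
    have h1' : (1 : ℝ) ≤ n := by exact_mod_cast h1
    have h2' : (n : ℝ) ≤ N := by exact_mod_cast h2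
    rw [norm_mul, norm_real, Real.norm_eq_abs, norm_natCast_cpow_of_pos (by omega)]
    calc _ ≤ 1 * (n : ℝ) ^ (1 : ℝ) := by
          gcongr
          · exact abs_moll_le_one hN n
          · simpa using hs
      _ ≤ N := by rwa [one_mul, Real.rpow_one]
  · simp [sq]

theorem tsum_one_div_add_two_sq_le : ∑' n : ℕ, 1 / ((n + 2 : ℕ) : ℝ) ^ 2 ≤ 1 := by
  have h := (hasSum_nat_add_iff' 2).2 hasSum_zeta_two
  rw [h.tsum_eq]
  simp [Finset.sum_range_succ]
  nlinarith [Real.pi_pos, Real.pi_lt_d2]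

theorem summable_one_div_add_two_sq : Summable fun n : ℕ => 1 / ((n + 2 : ℕ) : ℝ) ^ 2 :=
  ((hasSum_nat_add_iff' 2).2 hasSum_zeta_two).summable

theorem norm_riemannZeta_sub_one_le {s : ℂ} (hs : s.re = 6) :
    ‖riemannZeta s - 1‖ ≤ 1 / 16 := by
  have hS := Complex.summable_one_div_nat_cpow.2 (by rw [hs]; norm_num : 1 < s.re)
  have h := hS.hasSum
  rw [← zeta_eq_tsum_one_div_nat_cpow (by rw [hs]; norm_num), ← hasSum_nat_add_iff' 2] at h
  simp only [Finset.sum_range_succ, Finset.sum_range_zero, Nat.cast_zero, Nat.cast_one,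
    one_cpow, zero_cpow (Complex.ne_zero_of_one_lt_re (by rw [hs]; norm_num : 1 < s.re))] at h
  rw [show riemannZeta s - 1 = riemannZeta s - (0 + 1 / 0 + 1 / 1) by simp, ← h.tsum_eq]
  refine (tsum_of_norm_bounded ((summable_one_div_add_two_sq.mul_left (1 / 16)).hasSum)
    fun n => ?_).trans ?_
  · rw [norm_div, norm_one, norm_natCast_cpow_of_pos (by omega), hs]
    have h2 : (2 : ℝ) ≤ (n + 2 : ℕ) := by push_cast; linarith [(Nat.cast_nonneg n : (0 : ℝ) ≤ n)]
    rw [show (6 : ℝ) = ((6 : ℕ) : ℝ) by norm_num, Real.rpow_natCast, div_mul_div_comm, one_mul]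
    gcongr
    calc (16 : ℝ) * ((n + 2 : ℕ) : ℝ) ^ 2 = 2 ^ 4 * ((n + 2 : ℕ) : ℝ) ^ 2 := by norm_num
      _ ≤ ((n + 2 : ℕ) : ℝ) ^ 4 * ((n + 2 : ℕ) : ℝ) ^ 2 := by gcongr
      _ = _ := by ring
  · rw [tsum_mul_left]
    linarith [tsum_one_div_add_two_sq_le]

theorem norm_mollPoly_sub_one_le {N : ℕ} (hN : 1 ≤ N) {s : ℂ} (hs : s.re = 6) :
    ‖mollPoly N s - 1‖ ≤ 1 / 8 := by
  obtain ⟨M, rfl⟩ := Nat.exists_eq_add_of_le' hN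
  have : mollPoly (M + 1) s - 1 =
      ∑ k ∈ Finset.range M, (moll (M + 1) (k + 2) : ℂ) * ((k + 2 : ℕ) : ℂ) ^ (1 - s) := by
    rw [mollPoly, ← Finset.Ico_add_one_right_eq_Icc, Finset.sum_Ico_eq_sum_range,
      Nat.add_sub_cancel, Finset.sum_range_succ']
    rw [Nat.add_zero, moll_one hN, Nat.cast_one, one_cpow, ofReal_one, mul_one, add_sub_cancel_right]
    exact Finset.sum_congr rfl fun k _ => by rw [show 1 + (k + 1) = k + 2 by ring]
  rw [this]
  refine (norm_sum_le_of_le _ (n := fun k : ℕ => 1 / 8 * (1 / ((k + 2 : ℕ) : ℝ) ^ 2))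
    fun k _ => ?_).trans ?_
  · rw [norm_mul, norm_real, Real.norm_eq_abs, norm_natCast_cpow_of_pos (by omega), sub_re, hs,
      one_re, show (1 - 6 : ℝ) = -((5 : ℕ) : ℝ) by norm_num, Real.rpow_neg (by positivity),
      Real.rpow_natCast, ← one_div]
    have h2 : (2 : ℝ) ≤ (k + 2 : ℕ) := by push_cast; linarith [(Nat.cast_nonneg k : (0 : ℝ) ≤ k)]
    calc _ ≤ 1 * (1 / ((k + 2 : ℕ) : ℝ) ^ 5) := by
          gcongr
          exact abs_moll_le_one hN _
      _ ≤ 1 / (8 * ((k + 2 : ℕ) : ℝ) ^ 2) := by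
          rw [one_mul]
          gcongr
          calc (8 : ℝ) * ((k + 2 : ℕ) : ℝ) ^ 2 = 2 ^ 3 * ((k + 2 : ℕ) : ℝ) ^ 2 := by norm_num
            _ ≤ ((k + 2 : ℕ) : ℝ) ^ 3 * ((k + 2 : ℕ) : ℝ) ^ 2 := by gcongr
            _ = _ := by ring
      _ = _ := by rw [div_mul_div_comm, one_mul]
  · rw [← Finset.mul_sum]
    have := summable_one_div_add_two_sq.sum_le_tsum (Finset.range M) fun k _ => by positivity
    linarith [tsum_one_div_add_two_sq_le]

/-- The mollified zeta function. -/
noncomputable def mollZeta (N : ℕ) (s : ℂ) : ℂ := riemannZeta s * mollPoly N s ^ 2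

theorem norm_mollZeta_sub_one_le {N : ℕ} (hN : 1 ≤ N) {s : ℂ} (hs : s.re = 6) :
    ‖mollZeta N s - 1‖ ≤ 1 / 2 := by
  set a := riemannZeta s - 1 with ha
  set b := mollPoly N s - 1 with hb
  have h1 : ‖a‖ ≤ 1 / 16 := norm_riemannZeta_sub_one_le hs
  have h2 : ‖b‖ ≤ 1 / 8 := norm_mollPoly_sub_one_le hN hs
  have : mollZeta N s - 1 = a + 2 * b + 2 * a * b + b ^ 2 + a * b ^ 2 := by
    rw [mollZeta, ha, hb]; ring
  rw [this]
  refine (norm_add_le_of_le (norm_add_le_of_le (norm_add_le_of_le (norm_add_le_of_le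
    h1 (r₂ := 1 / 4) ?_) (r₂ := 1 / 64) ?_) (r₂ := 1 / 64) ?_) (r₂ := 1 / 64) ?_).trans
    (by norm_num)
  · rw [norm_mul, RCLike.norm_ofNat]; linarith
  · rw [norm_mul, norm_mul, RCLike.norm_ofNat]
    calc _ ≤ 2 * (1 / 16) * (1 / 8 : ℝ) := by gcongr
      _ = _ := by norm_num
  · rw [norm_pow]
    calc _ ≤ (1 / 8 : ℝ) ^ 2 := by gcongr
      _ = _ := by norm_num
  · rw [norm_mul, norm_pow]
    calc _ ≤ (1 / 16) * (1 / 8 : ℝ) ^ 2 := by gcongr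
      _ ≤ _ := by norm_num

theorem differentiableAt_mollZeta (N : ℕ) {s : ℂ} (hs : s ≠ 1) :
    DifferentiableAt ℂ (mollZeta N) s :=
  (differentiableAt_riemannZeta hs).mul ((differentiable_mollPoly N s).pow 2)

theorem continuousOn_mollZeta_vertical (N : ℕ) (σ : ℝ) :
    ContinuousOn (fun y : ℝ => mollZeta N (σ + y * I)) (Ioi 0) := by
  intro y hy
  refine ContinuousAt.continuousWithinAt (ContinuousAt.comp (g := mollZeta N)
    (differentiableAt_mollZeta N ?_).continuousAt (by fun_prop))
  intro h
  have := congrArg im h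
  simp at this
  exact hy.ne' this

theorem exists_norm_horizontal_le : ∃ C : ℝ, 0 < C ∧ ∀ N : ℕ, 1 ≤ N → ∀ y : ℝ, 1 ≤ y →
    ‖∫ x : ℝ in (1 / 2 : ℝ)..6, mollZeta N (x + y * I)‖ ≤ C * (y ^ (3 / 4 : ℝ) * (N : ℝ) ^ 4) := by
  obtain ⟨C, hC, h⟩ := exists_norm_riemannZeta_le
  refine ⟨C * 7 * 6, by positivity, fun N hN y hy => ?_⟩
  refine (intervalIntegral.norm_integral_le_of_norm_le_const
    (C := C * 7 * (y ^ (3 / 4 : ℝ) * (N : ℝ) ^ 4)) fun x hx => ?_).trans ?_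
  · rw [uIoc_of_le (by norm_num)] at hx
    have hz := h (3 / 4) (by norm_num) (by norm_num) (x + y * I)
      (by simp; linarith [hx.1]) (by simp; linarith [hx.1]) (by simpa using hy)
    have hp := norm_mollPoly_le hN (s := x + y * I) (by simp; linarith [hx.1])
    have hn : ‖(x + y * I : ℂ)‖ ≤ 7 * y := by
      refine (norm_add_le _ _).trans ?_
      rw [norm_mul, norm_I, Complex.norm_of_nonneg (by linarith [hx.1]),
        Complex.norm_of_nonneg (by linarith)]
      linarith [hx.2]
    rw [mollZeta, norm_mul, norm_pow]
    calc _ ≤ C * (7 * y) ^ (3 / 4 : ℝ) * ((N : ℝ) ^ 2) ^ 2 := by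
          gcongr
          refine hz.trans ?_
          gcongr
      _ ≤ C * (7 * y ^ (3 / 4 : ℝ)) * ((N : ℝ) ^ 2) ^ 2 := by
          rw [Real.mul_rpow (by norm_num) (by linarith)]
          gcongr
          exact (Real.rpow_le_rpow_of_exponent_le (by norm_num) (by norm_num)).trans_eq
            (Real.rpow_one 7)
      _ = _ := by ring
  · rw [abs_of_nonneg (by norm_num)]
    have : 0 ≤ C * 7 * (y ^ (3 / 4 : ℝ) * (N : ℝ) ^ 4) := by positivity
    linarith

theorem norm_vertical_ge {N : ℕ} (hN : 1 ≤ N) {a b : ℝ} (ha : 0 < a) (hab : a ≤ b) :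
    (b - a) / 2 ≤ ‖∫ y : ℝ in a..b, mollZeta N ((6 : ℝ) + y * I)‖ := by
  have hintv : IntervalIntegrable (fun y : ℝ => mollZeta N ((6 : ℝ) + y * I)) volume a b :=
    ((continuousOn_mollZeta_vertical N 6).mono fun y hy => by
      rw [uIcc_of_le hab] at hy
      exact ha.trans_le hy.1).intervalIntegrable
  have h1 : ‖∫ y : ℝ in a..b, (mollZeta N ((6 : ℝ) + y * I) - 1)‖ ≤ 1 / 2 * (b - a) := by
    refine (intervalIntegral.norm_integral_le_of_norm_le_const (C := 1 / 2) fun y _ =>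
      norm_mollZeta_sub_one_le hN (by simp)).trans_eq ?_
    rw [abs_of_nonneg (by linarith)]
  rw [intervalIntegral.integral_sub hintv intervalIntegrable_const,
    intervalIntegral.integral_const] at h1
  have h2 : ‖((b - a) • (1 : ℂ))‖ = b - a := by
    rw [norm_smul, norm_one, mul_one, Real.norm_of_nonneg (by linarith)]
  have h3 := norm_sub_norm_le ((b - a) • (1 : ℂ)) (∫ y : ℝ in a..b, mollZeta N ((6 : ℝ) + y * I))
  rw [norm_sub_rev] at h3
  linarith

theorem exists_integral_mollZeta_ge : ∀ᶠ T : ℝ in atTop,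
    T / 4 ≤ ∫ y in (T + 1)..(2 * T - 1), ‖mollZeta (level T) (1 / 2 + I * y)‖ := by
  obtain ⟨C, hC, h⟩ := exists_norm_horizontal_le
  have hbig : ∀ᶠ T : ℝ in atTop, 32 * C ≤ T ^ (1 / 10 : ℝ) :=
    (tendsto_rpow_atTop (by norm_num)).eventually (eventually_ge_atTop _)
  filter_upwards [eventually_log_level, eventually_ge_atTop 16, hbig] with T hN hT hbig
  set N := level T with hNdef
  have hN1 : 1 ≤ N := by omega
  have hrect := integral_boundary_rect_eq_zero_of_differentiableOn (mollZeta N)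
    ((1 / 2 : ℝ) + ((T + 1 : ℝ) : ℂ) * I) ((6 : ℝ) + ((2 * T - 1 : ℝ) : ℂ) * I) (fun s hs => by
      refine (differentiableAt_mollZeta N fun h1 => ?_).differentiableWithinAt
      have := hs.2
      simp only [mem_preimage, add_im, ofReal_im, mul_im, ofReal_re, I_re, I_im, mul_zero, mul_one,
        zero_add, add_zero] at this
      rw [uIcc_of_le (by linarith), h1] at this
      have := this.1
      simp at this
      linarith)
  simp only [add_re, ofReal_re, mul_re, I_re, mul_zero, ofReal_im, I_im, mul_one, sub_self,
    add_zero, add_im, mul_im, zero_add] at hrect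
  have hside (y : ℝ) (h1 : 1 ≤ y) (h2 : y ≤ 2 * T) :
      ‖∫ x : ℝ in (1 / 2 : ℝ)..6, mollZeta N (x + y * I)‖ ≤ T / 16 := by
    refine (h N hN1 y h1).trans ?_
    calc C * (y ^ (3 / 4 : ℝ) * (N : ℝ) ^ 4)
        ≤ C * ((2 * T ^ (3 / 4 : ℝ)) * T ^ ((4 : ℕ) / 200 : ℝ)) := by
          gcongr
          · exact (Real.rpow_le_rpow (by linarith) h2 (by norm_num)).trans
              (two_mul_rpow_le (by linarith) (by norm_num))
          · exact level_pow_le (by linarith) 4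
      _ = 32 * C * T ^ (3 / 4 + (4 : ℕ) / 200 : ℝ) / 16 := by
          rw [Real.rpow_add (by linarith)]; ring
      _ ≤ T ^ (1 / 10 : ℝ) * T ^ (9 / 10 : ℝ) / 16 := by
          gcongr
          · linarith
          · norm_num
      _ = T / 16 := by
          rw [← Real.rpow_add (by linarith)]
          norm_num
  have hv := norm_vertical_ge hN1 (a := T + 1) (b := 2 * T - 1) (by linarith) (by linarith)
  have h1 := hside (T + 1) (by linarith) (by linarith)
  have h2 := hside (2 * T - 1) (by linarith) (by linarith)
  have h3 : ‖∫ y : ℝ in (T + 1)..(2 * T - 1), mollZeta N ((1 / 2 : ℝ) + y * I)‖ ≤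
      ∫ y in (T + 1)..(2 * T - 1), ‖mollZeta N (1 / 2 + I * y)‖ := by
    refine (intervalIntegral.norm_integral_le_integral_norm (by linarith)).trans_eq ?_
    refine intervalIntegral.integral_congr fun y _ => ?_
    change ‖mollZeta N ((1 / 2 : ℝ) + y * I)‖ = ‖mollZeta N (1 / 2 + I * y)‖
    congr 2
    push_cast
    ring
  set A := ∫ x : ℝ in (1 / 2 : ℝ)..6, mollZeta N (x + ((T + 1 : ℝ) : ℂ) * I)
  set B := ∫ x : ℝ in (1 / 2 : ℝ)..6, mollZeta N (x + ((2 * T - 1 : ℝ) : ℂ) * I)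
  set V := ∫ y : ℝ in (T + 1)..(2 * T - 1), mollZeta N ((6 : ℝ) + y * I)
  set W := ∫ y : ℝ in (T + 1)..(2 * T - 1), mollZeta N ((1 / 2 : ℝ) + y * I)
  have h4 : I • V = B - A + I • W := by linear_combination hrect
  have h5 : ‖V‖ ≤ ‖B‖ + ‖A‖ + ‖W‖ := by
    have := congrArg norm h4
    rw [norm_smul, norm_I, one_mul] at this
    rw [this]
    refine (norm_add_le _ _).trans ?_
    rw [norm_smul, norm_I, one_mul]
    gcongr
    exact norm_sub_le _ _
  linarith

end LowerBound

end Selberg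

namespace Selberg

open Complex Set MeasureTheory Filter Topology ComplexConjugate

section HardyLowerBound

theorem abs_hardy (N : ℕ) (α t : ℝ) : |hardy N α t| =
    ‖mollZeta N (1 / 2 + I * t)‖ * (‖Gammaℝ (1 / 2 + I * t)‖ * Real.exp (α * t / 2)) := by
  have hxi : |xi t| = ‖riemannZeta (1 / 2 + I * t)‖ * ‖Gammaℝ (1 / 2 + I * t)‖ := by
    rw [← norm_mul, ← completedRiemannZeta_eq_mul (by simp), ← ofReal_xi, norm_real,
      Real.norm_eq_abs]
  rw [hardy, abs_mul, abs_mul, hxi, Real.abs_exp, abs_of_nonneg (sq_nonneg _), mollZeta, norm_mul,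
    norm_pow]
  ring

theorem exists_abs_hardy_ge : ∃ c : ℝ, 0 < c ∧ ∀ T : ℝ, 2 ≤ T → ∀ t ∈ Icc T (2 * T), ∀ N : ℕ,
    c * T ^ (-(1 / 4) : ℝ) * ‖mollZeta N (1 / 2 + I * t)‖ ≤ |hardy N (angle T) t| := by
  obtain ⟨c, hc, h⟩ := exists_le_norm_Gammaℝ
  refine ⟨c / 2 * Real.exp (-1), by positivity, fun T hT t ht N => ?_⟩
  rw [abs_hardy, mul_comm]
  refine mul_le_mul_of_nonneg_left ?_ (norm_nonneg _)
  have hT0 : 0 < T := by linarith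
  have ht0 : 0 < t := hT0.trans_le ht.1
  have h1 := h t (hT.trans ht.1)
  have h2 : T ^ (-(1 / 4) : ℝ) / 2 ≤ t ^ (-(1 / 4) : ℝ) := by
    have e1 : (2 * T) ^ (-(1 / 4) : ℝ) ≤ t ^ (-(1 / 4) : ℝ) :=
      Real.rpow_le_rpow_of_nonpos ht0 ht.2 (by norm_num)
    refine le_trans ?_ e1
    rw [Real.mul_rpow zero_le_two hT0.le, div_eq_inv_mul]
    gcongr
    rw [← Real.rpow_neg_one]
    exact Real.rpow_le_rpow_of_exponent_le one_le_two (by norm_num)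
  have h3 : Real.exp (-1) ≤ Real.exp (-(Real.pi * t / 4)) * Real.exp (angle T * t / 2) := by
    rw [← Real.exp_add]
    apply Real.exp_le_exp.2
    have : -(Real.pi * t / 4) + angle T * t / 2 = -(t / (2 * T)) := by
      rw [angle]; field_simp; ring
    rw [this, neg_le_neg_iff, div_le_one (by positivity)]
    exact ht.2
  calc c / 2 * Real.exp (-1) * T ^ (-(1 / 4) : ℝ)
      = c * (T ^ (-(1 / 4) : ℝ) / 2) * Real.exp (-1) := by ring
    _ ≤ c * t ^ (-(1 / 4) : ℝ) *
        (Real.exp (-(Real.pi * t / 4)) * Real.exp (angle T * t / 2)) := by gcongr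
    _ = c * (t ^ (-(1 / 4) : ℝ) * Real.exp (-(Real.pi * t / 4))) *
        Real.exp (angle T * t / 2) := by ring
    _ ≤ _ := by gcongr

theorem exists_integral_abs_hardy_ge : ∃ c : ℝ, 0 < c ∧ ∀ᶠ T : ℝ in atTop,
    c * T ^ (3 / 4 : ℝ) ≤
      ∫ t in (T + 1)..(2 * T - 1), |hardy (level T) (angle T) t| := by
  obtain ⟨c, hc, h⟩ := exists_abs_hardy_ge
  refine ⟨c / 4, by positivity, ?_⟩
  filter_upwards [exists_integral_mollZeta_ge, eventually_ge_atTop 2] with T h1 hT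
  have hT0 : 0 < T := by linarith
  have hle : T + 1 ≤ 2 * T - 1 := by linarith
  calc c / 4 * T ^ (3 / 4 : ℝ) = c * T ^ (-(1 / 4) : ℝ) * (T / 4) := by
        rw [show (3 / 4 : ℝ) = -(1 / 4) + 1 by norm_num, Real.rpow_add hT0, Real.rpow_one]
        ring
    _ ≤ c * T ^ (-(1 / 4) : ℝ) *
        ∫ y in (T + 1)..(2 * T - 1), ‖mollZeta (level T) (1 / 2 + I * y)‖ := by gcongr
    _ = ∫ y in (T + 1)..(2 * T - 1),
        c * T ^ (-(1 / 4) : ℝ) * ‖mollZeta (level T) (1 / 2 + I * y)‖ :=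
        (intervalIntegral.integral_const_mul _ _).symm
    _ ≤ _ := by
        refine intervalIntegral.integral_mono_on hle ?_
          (continuous_hardy _ _).abs.continuousOn.intervalIntegrable
          fun t ht => h T hT t ⟨by linarith [ht.1], by linarith [ht.2]⟩ _
        refine ContinuousOn.intervalIntegrable (ContinuousOn.mul continuousOn_const
          (ContinuousOn.norm ?_))
        refine ((continuousOn_mollZeta_vertical (level T) (1 / 2)).mono fun y hy => ?_).congr
          fun y _ => ?_
        · rw [uIcc_of_le hle] at hy
          exact hT0.trans_le (by linarith [hy.1])
        · congr 1
          push_cast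
          ring

end HardyLowerBound

end Selberg

namespace Selberg

open Complex Set MeasureTheory Filter Topology ComplexConjugate

section SignChanges

theorem sq_setIntegral_le {s : Set ℝ} {f : ℝ → ℝ} (hs : volume s ≠ ⊤)
    (hf : IntegrableOn f s) (hf2 : IntegrableOn (fun x => f x ^ 2) s) :
    (∫ x in s, f x) ^ 2 ≤ volume.real s * ∫ x in s, f x ^ 2 := by
  set m := volume.real s with hm
  set A := ∫ x in s, f x with hA
  have hm0 : 0 ≤ m := measureReal_nonneg
  rcases hm0.eq_or_lt with h0 | h0
  · have : volume s = 0 := by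
      rcases (ENNReal.toReal_eq_zero_iff _).1 h0.symm with h | h
      · exact h
      · exact absurd h hs
    rw [← h0, hA, Measure.restrict_eq_zero.2 this]
    simp
  · have hconst : IntegrableOn (fun _ : ℝ => (A / m) ^ 2) s := integrableOn_const hs
    have h1 : 0 ≤ ∫ x in s, (f x - A / m) ^ 2 := integral_nonneg fun x => sq_nonneg _
    have h2 : ∫ x in s, (f x - A / m) ^ 2 = (∫ x in s, f x ^ 2) - 2 * (A / m) * A + m * (A / m) ^ 2 := by
      calc _ = ∫ x in s, (f x ^ 2 - 2 * (A / m) * f x + (A / m) ^ 2) :=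
            integral_congr_ae (ae_of_all _ fun x => by ring)
        _ = _ := by
            have hsub : IntegrableOn (fun x => f x ^ 2 - 2 * (A / m) * f x) s :=
              hf2.sub (hf.const_mul _)
            rw [integral_add hsub hconst,
              integral_sub hf2 (hf.const_mul _), integral_const_mul, setIntegral_const, smul_eq_mul]
    have h3 : 2 * (A / m) * A = 2 * A ^ 2 / m := by ring
    have h4 : m * (A / m) ^ 2 = A ^ 2 / m := by field_simp
    rw [h2, h3, h4] at h1
    have h5 : A ^ 2 / m ≤ ∫ x in s, f x ^ 2 := by
      have : 2 * A ^ 2 / m = A ^ 2 / m + A ^ 2 / m := by ring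
      linarith
    rwa [div_le_iff₀' h0] at h5

theorem intervalIntegral_shift_swap {f : ℝ → ℝ} (hf : Continuous f) {a b H : ℝ} (hH : 0 ≤ H) :
    ∫ t in a..b, ∫ x in t..(t + H), f x = ∫ x in (0 : ℝ)..H, ∫ t in (a + x)..(b + x), f t := by
  have h1 (t : ℝ) : ∫ x in t..(t + H), f x = ∫ x in (0 : ℝ)..H, f (t + x) := by
    rw [intervalIntegral.integral_comp_add_left (fun x => f x) t, add_zero]
  have h2 (x : ℝ) : ∫ t in (a + x)..(b + x), f t = ∫ t in a..b, f (t + x) := by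
    rw [intervalIntegral.integral_comp_add_right (fun t => f t) x]
  simp only [h1, h2, intervalIntegral.integral_of_le hH]
  refine intervalIntegral_integral_swap (μ := volume.restrict (Ioc 0 H)) ?_
  rw [Measure.prod_restrict]
  have hc : Continuous (Function.uncurry fun t x => f (t + x)) := by
    simp only [Function.uncurry_def]; fun_prop
  exact (hc.continuousOn.integrableOn_compact (isCompact_uIcc.prod isCompact_Icc)).mono_set
    (prod_mono uIoc_subset_uIcc Ioc_subset_Icc_self)

theorem abs_intervalIntegral_eq_of_ne_zero {X W : ℝ → ℝ} (hX : Continuous X) (hW : ∀ x, 0 ≤ W x)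
    {t H : ℝ} (hH : 0 ≤ H) (h : ∀ x ∈ Icc t (t + H), X x ≠ 0) :
    |∫ x in t..(t + H), X x * W x| = ∫ x in t..(t + H), |X x * W x| := by
  set F : ℝ → ℝ := fun x => X x * W x with hF
  change |∫ x in t..(t + H), F x| = ∫ x in t..(t + H), |F x|
  have hsign : (∀ x ∈ Icc t (t + H), 0 ≤ F x) ∨ ∀ x ∈ Icc t (t + H), F x ≤ 0 := by
    by_contra! hcon
    obtain ⟨⟨x, hx, hx0⟩, y, hy, hy0⟩ := hcon
    obtain ⟨z, hz, hz0⟩ := isPreconnected_Icc.intermediate_value hx hy hX.continuousOn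
      ⟨(neg_of_mul_neg_left hx0 (hW x)).le, (pos_of_mul_pos_left hy0 (hW y)).le⟩
    exact h z hz hz0
  have hle : t ≤ t + H := by linarith
  rcases hsign with hs | hs
  · rw [abs_of_nonneg (intervalIntegral.integral_nonneg hle hs)]
    refine intervalIntegral.integral_congr fun x hx => ?_
    rw [uIcc_of_le hle] at hx
    exact (abs_of_nonneg (hs x hx)).symm
  · have h1 : ∫ x in t..(t + H), |F x| = -∫ x in t..(t + H), F x := by
      rw [← intervalIntegral.integral_neg]
      refine intervalIntegral.integral_congr fun x hx => ?_
      rw [uIcc_of_le hle] at hx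
      exact abs_of_nonpos (hs x hx)
    have h0 : 0 ≤ ∫ x in t..(t + H), |F x| :=
      intervalIntegral.integral_nonneg hle fun x _ => abs_nonneg _
    rw [h1, abs_of_nonpos]
    linarith

theorem sq_integral_abs_le_of_zeros {F X W : ℝ → ℝ} (hF : Continuous F)
    (hX : Continuous X) (hW : ∀ t, 0 ≤ W t) (hXW : ∀ t, F t = X t * W t)
    (hF2 : Integrable fun t => F t ^ 2) {a b H : ℝ} (hH : 0 < H)
    (hab : a + H ≤ b) (hG : Integrable fun t => (∫ x in t..(t + H), F x) ^ 2) (Z : Finset ℝ)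
    (hZ : ∀ t ∈ Icc a (b + H), X t = 0 → t ∈ Z) :
    (H * ∫ t in (a + H)..b, |F t|) ^ 2 ≤
      2 * (b - a) * (∫ t, (∫ x in t..(t + H), F x) ^ 2) + 2 * Z.card * H ^ 3 * ∫ t, F t ^ 2 := by
  have hab' : a ≤ b := by linarith
  set g : ℝ → ℝ := fun t => ∫ x in t..(t + H), F x with hg
  set G : ℝ → ℝ := fun t => ∫ x in t..(t + H), |F x| with hGdef
  have hgc : Continuous g := continuous_intervalIntegral_add hF H
  have hGc : Continuous G := continuous_intervalIntegral_add hF.abs H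
  set S : Set ℝ := ⋃ γ ∈ Z, Icc (γ - H) γ with hS
  have hSm : MeasurableSet S := Z.measurableSet_biUnion fun γ _ => measurableSet_Icc
  set I := Icc a b with hI
  have hIm : MeasurableSet I := measurableSet_Icc
  have hfin : ∀ s ⊆ I, volume s ≠ ⊤ := fun s hs =>
    measure_ne_top_of_subset hs measure_Icc_lt_top.ne
  have hintv : ∀ s ⊆ I, ∀ f : ℝ → ℝ, Continuous f → IntegrableOn f s := fun s hs f hf =>
    (hf.continuousOn.integrableOn_compact isCompact_Icc).mono_set hs
  have hgG : ∀ t ∈ I \ S, |g t| = G t := fun t ht => by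
    simp only [hg, hGdef, hXW]
    refine abs_intervalIntegral_eq_of_ne_zero hX hW hH.le fun x hx h0 => ht.2 ?_
    have hxZ : x ∈ Z := hZ x ⟨ht.1.1.trans hx.1, hx.2.trans (by linarith [ht.1.2])⟩ h0
    exact mem_iUnion₂.2 ⟨x, hxZ, by linarith [hx.2], hx.1⟩
  have hlow : H * ∫ t in (a + H)..b, |F t| ≤ ∫ t in I, G t := by
    rw [hI, integral_Icc_eq_integral_Ioc, ← intervalIntegral.integral_of_le hab',
      intervalIntegral_shift_swap hF.abs hH.le]
    have : H * ∫ t in (a + H)..b, |F t| = ∫ x in (0 : ℝ)..H, ∫ t in (a + H)..b, |F t| := by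
      rw [intervalIntegral.integral_const, sub_zero, smul_eq_mul]
    rw [this]
    refine intervalIntegral.integral_mono_on hH.le intervalIntegrable_const ?_ fun x hx => ?_
    · refine Continuous.intervalIntegrable ?_ _ _
      have := intervalIntegral.continuous_primitive (μ := volume) (f := fun t => |F t|)
        (fun a b => hF.abs.intervalIntegrable a b) 0
      have e : (fun x => ∫ t in (a + x)..(b + x), |F t|) =
          fun x => (∫ t in (0 : ℝ)..(b + x), |F t|) - ∫ t in (0 : ℝ)..(a + x), |F t| := by
        ext x
        rw [intervalIntegral.integral_interval_sub_left] <;>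
          exact hF.abs.intervalIntegrable _ _
      rw [e]
      exact (this.comp (continuous_const_add b)).sub (this.comp (continuous_const_add a))
    · refine intervalIntegral.integral_mono_interval (by linarith [hx.2]) hab (by linarith [hx.1])
        (ae_of_all _ fun t => abs_nonneg _) (hF.abs.intervalIntegrable _ _)
  have hsplit : ∫ t in I, G t = (∫ t in I ∩ S, G t) + ∫ t in I \ S, G t :=
    (integral_inter_add_sdiff hSm (hintv I subset_rfl G hGc)).symm
  have hIS : (∫ t in I \ S, G t) ^ 2 ≤ (b - a) * ∫ t, g t ^ 2 := by
    rw [← setIntegral_congr_fun (hIm.diff hSm) hgG]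
    refine (sq_setIntegral_le (hfin _ sdiff_subset) (hintv _ sdiff_subset _ hgc.abs)
      (hintv _ sdiff_subset _ (hgc.abs.pow 2))).trans ?_
    have h1 : volume.real (I \ S) ≤ b - a := by
      refine (measureReal_mono sdiff_subset measure_Icc_lt_top.ne).trans_eq ?_
      rw [Real.volume_real_Icc_of_le hab']
    have h2 : ∫ t in I \ S, |g t| ^ 2 ≤ ∫ t, g t ^ 2 := by
      simp only [sq_abs]
      exact setIntegral_le_integral hG (ae_of_all _ fun t => sq_nonneg _)
    have h3 : 0 ≤ ∫ t in I \ S, |g t| ^ 2 := integral_nonneg fun t => sq_nonneg _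
    exact mul_le_mul h1 h2 h3 (by linarith)
  have hG2 (t : ℝ) : G t ^ 2 ≤ H * ∫ x in t..(t + H), F x ^ 2 := by
    have hle : t ≤ t + H := by linarith
    have := sq_setIntegral_le (s := Ioc t (t + H)) (f := fun x => |F x|) measure_Ioc_lt_top.ne
      ((hF.abs.intervalIntegrable t (t + H)).1) (((hF.abs.pow 2).intervalIntegrable t (t + H)).1)
    rw [Real.volume_real_Ioc_of_le hle, add_sub_cancel_left] at this
    simp only [sq_abs] at this
    rw [intervalIntegral.integral_of_le hle]
    simpa only [hGdef, intervalIntegral.integral_of_le hle] using this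
  have hY : (∫ t in I ∩ S, G t) ^ 2 ≤ Z.card * H ^ 3 * ∫ t, F t ^ 2 := by
    refine (sq_setIntegral_le (hfin _ inter_subset_left) (hintv _ inter_subset_left _ hGc)
      (hintv _ inter_subset_left _ (hGc.pow 2))).trans ?_
    have h1 : volume.real (I ∩ S) ≤ Z.card * H := by
      have hSfin : volume S ≠ ⊤ := by
        refine ((measure_biUnion_finset_le Z _).trans_lt ?_).ne
        exact ENNReal.sum_lt_top.2 fun γ _ => measure_Icc_lt_top
      refine (measureReal_mono inter_subset_right hSfin).trans ?_
      refine (measureReal_biUnion_finset_le Z _).trans_eq ?_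
      rw [Finset.sum_congr rfl fun γ _ => Real.volume_real_Icc_of_le (by linarith : γ - H ≤ γ)]
      simp
    have h2 : ∫ t in I ∩ S, G t ^ 2 ≤ H ^ 2 * ∫ t, F t ^ 2 := by
      calc _ ≤ ∫ t in I, G t ^ 2 := setIntegral_mono_set (hintv I subset_rfl _ (hGc.pow 2))
            (ae_of_all _ fun t => sq_nonneg _) inter_subset_left.eventuallyLE
        _ ≤ ∫ t in I, H * ∫ x in t..(t + H), F x ^ 2 :=
            setIntegral_mono_on (hintv I subset_rfl _ (hGc.pow 2)) (hintv I subset_rfl _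
              (continuous_const.mul (continuous_intervalIntegral_add (hF.pow 2) H))) hIm
              fun t _ => hG2 t
        _ = H * ∫ x in (0 : ℝ)..H, ∫ t in (a + x)..(b + x), F t ^ 2 := by
            rw [integral_const_mul, hI, integral_Icc_eq_integral_Ioc,
              ← intervalIntegral.integral_of_le hab',
              intervalIntegral_shift_swap (f := fun t => F t ^ 2) (hF.pow 2) hH.le]
        _ ≤ H * ∫ x in (0 : ℝ)..H, ∫ t, F t ^ 2 := by
            gcongr
            have := intervalIntegral.norm_integral_le_of_norm_le_const (a := 0) (b := H)
              (f := fun x => ∫ t in (a + x)..(b + x), F t ^ 2) (C := ∫ t, F t ^ 2) fun x _ => by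
                rw [intervalIntegral.integral_of_le (by linarith),
                  Real.norm_of_nonneg (integral_nonneg fun t => sq_nonneg _)]
                exact setIntegral_le_integral hF2 (ae_of_all _ fun t => sq_nonneg _)
            rw [intervalIntegral.integral_const, sub_zero, smul_eq_mul, mul_comm]
            rw [sub_zero, abs_of_pos hH] at this
            exact (le_abs_self _).trans this
        _ = H ^ 2 * ∫ t, F t ^ 2 := by
            rw [intervalIntegral.integral_const, sub_zero, smul_eq_mul]; ring
    calc _ ≤ Z.card * H * (H ^ 2 * ∫ t, F t ^ 2) :=
          mul_le_mul h1 h2 (integral_nonneg fun t => sq_nonneg _) (by positivity)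
      _ = _ := by ring
  have hM : 0 ≤ H * ∫ t in (a + H)..b, |F t| :=
    mul_nonneg hH.le (intervalIntegral.integral_nonneg hab fun t _ => abs_nonneg _)
  calc (H * ∫ t in (a + H)..b, |F t|) ^ 2 ≤ (∫ t in I, G t) ^ 2 := by gcongr
    _ ≤ 2 * ((∫ t in I ∩ S, G t) ^ 2 + (∫ t in I \ S, G t) ^ 2) := by
        rw [hsplit]; exact add_sq_le
    _ ≤ 2 * (Z.card * H ^ 3 * (∫ t, F t ^ 2) + (b - a) * ∫ t, g t ^ 2) := by gcongr
    _ = _ := by ring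

end SignChanges

end Selberg

namespace Selberg

open Complex Set MeasureTheory Filter Topology ComplexConjugate

section CriticalLine

theorem riemannZeta_eq_zero_of_xi_eq_zero {t : ℝ} (h : xi t = 0) :
    riemannZeta (1 / 2 + I * t) = 0 := by
  have hre : 0 < (1 / 2 + I * t : ℂ).re := by simp
  have h1 := ofReal_xi t
  rw [h, completedRiemannZeta_eq_mul hre, ofReal_zero] at h1
  exact (mul_eq_zero.1 h1.symm).resolve_right (Gammaℝ_ne_zero_of_re_pos hre)

theorem finite_zeros {a b : ℝ} (T : ℝ) :
    {ρ : ℂ | riemannZeta ρ = 0 ∧ a ≤ ρ.re ∧ ρ.re ≤ b ∧ 0 ≤ ρ.im ∧ ρ.im ≤ T}.Finite := by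
  refine ((isCompact_Icc (a := a) (b := b)).reProdIm
    (isCompact_Icc (a := 0) (b := T))).inter_riemannZetaZeros_finite.subset fun ρ hρ => ?_
  obtain ⟨h0, h1, h2, h3, h4⟩ := hρ
  exact ⟨⟨⟨h1, h2⟩, h3, h4⟩, h0⟩

theorem finite_zeros_on_line (T : ℝ) :
    {ρ : ℂ | riemannZeta ρ = 0 ∧ ρ.re = 1 / 2 ∧ 0 < ρ.im ∧ ρ.im ≤ T}.Finite :=
  (finite_zeros (a := 1 / 2) (b := 1 / 2) T).subset fun _ h =>
    ⟨h.1, h.2.1.ge, h.2.1.le, h.2.2.1.le, h.2.2.2⟩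

theorem exists_finset_zeros {T : ℝ} (hT : 0 < T) : ∃ Z : Finset ℝ,
    (∀ t ∈ Icc T (2 * T), xi t = 0 → t ∈ Z) ∧
    Z.card ≤ {ρ : ℂ | riemannZeta ρ = 0 ∧ ρ.re = 1 / 2 ∧ 0 < ρ.im ∧ ρ.im ≤ 2 * T}.ncard := by
  classical
  have hfin := finite_zeros_on_line (2 * T)
  refine ⟨hfin.toFinset.image Complex.im, fun t ht h0 => ?_, ?_⟩
  · refine Finset.mem_image.2 ⟨1 / 2 + I * t, hfin.mem_toFinset.2 ?_, by simp⟩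
    exact ⟨riemannZeta_eq_zero_of_xi_eq_zero h0, by simp, by simpa using hT.trans_le ht.1,
      by simpa using ht.2⟩
  · rw [Set.ncard_eq_toFinset_card _ hfin]
    exact Finset.card_image_le

theorem exists_zeros_on_line_ge : ∃ c : ℝ, 0 < c ∧ ∀ᶠ T : ℝ in atTop, c * (T * Real.log T) ≤
    {ρ : ℂ | riemannZeta ρ = 0 ∧ ρ.re = 1 / 2 ∧ 0 < ρ.im ∧ ρ.im ≤ 2 * T}.ncard := by
  obtain ⟨c, hc, hlow⟩ := exists_integral_abs_hardy_ge
  obtain ⟨C₁, hC₁, hsq⟩ := exists_integral_hardy_sq_le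
  obtain ⟨C₂, hC₂, hshort⟩ := exists_integral_intervalIntegral_hardy_sq_le
  set δ : ℝ := c ^ 2 / (8 * C₂) with hδ
  have hδ0 : 0 < δ := by positivity
  set η : ℝ := min (1 / 10) δ with hη
  have hη0 : 0 < η := lt_min (by norm_num) hδ0
  set A : ℝ := 1 / (η * √δ) with hA
  have hA0 : 0 < A := by positivity
  have hsmall : C₂ * (η + 1 / (η ^ 2 * A ^ 2)) ≤ c ^ 2 / 4 := by
    have h1 : 1 / (η ^ 2 * A ^ 2) = δ := by
      have : A ^ 2 = 1 / (η ^ 2 * δ) := by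
        rw [hA, div_pow, mul_pow, Real.sq_sqrt hδ0.le, one_pow]
      rw [this]
      field_simp
    have h2 : η ≤ δ := min_le_right _ _
    calc C₂ * (η + 1 / (η ^ 2 * A ^ 2)) ≤ C₂ * (δ + δ) := by rw [h1]; gcongr
      _ = c ^ 2 / 4 := by rw [hδ]; field_simp; norm_num
  refine ⟨c ^ 2 / (4 * C₁ * A), by positivity, ?_⟩
  filter_upwards [hlow, hsq, hshort η hη0 (min_le_left _ _) A hA0, eventually_ge_atTop 4,
    Real.tendsto_log_atTop.eventually_ge_atTop (max A 1)] with T hlow hsq hshort hT hlog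
  have hlog1 : 1 ≤ Real.log T := (le_max_right _ _).trans hlog
  have hlog0 : 0 < Real.log T := by linarith
  set H : ℝ := A / Real.log T with hH
  have hH0 : 0 < H := by positivity
  have hH1 : H ≤ 1 := (div_le_one hlog0).2 ((le_max_left _ _).trans hlog)
  have hT0 : 0 < T := by linarith
  set F := hardy (level T) (angle T) with hF
  have hFc : Continuous F := continuous_hardy _ _
  obtain ⟨Z, hZ, hcard⟩ := exists_finset_zeros hT0
  have ha0 := angle_pos (T := T) (by linarith)
  have ha1 := angle_lt hT0
  have main := sq_integral_abs_le_of_zeros (F := F) (X := xi)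
    (W := fun t => ‖mollPoly (level T) (1 / 2 + I * t)‖ ^ 2 * Real.exp (angle T * t / 2))
    hFc continuous_xi (fun t => by positivity) (fun t => by simp only [hF, hardy]; ring)
    (integrable_hardy_sq _ ha0 ha1) (a := T) (b := 2 * T - 1) hH0 (by linarith)
    (integrable_intervalIntegral_hardy_sq _ ha0 ha1 hH0.le) Z
    (fun t ht => hZ t ⟨ht.1, ht.2.trans (by linarith)⟩)
  set P : ℝ := T ^ (1 / 2 : ℝ) with hP
  have hP0 : 0 < P := Real.rpow_pos_of_pos hT0 _
  have hpow : (T ^ (3 / 4 : ℝ)) ^ 2 = T * P := by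
    rw [← Real.rpow_natCast, ← Real.rpow_mul hT0.le, hP]
    nth_rewrite 2 [← Real.rpow_one T]
    rw [← Real.rpow_add hT0]
    norm_num
  have hintv : c * T ^ (3 / 4 : ℝ) ≤ ∫ t in (T + H)..(2 * T - 1), |F t| :=
    hlow.trans (intervalIntegral.integral_mono_interval (by linarith) (by linarith) le_rfl
      (ae_of_all _ fun t => abs_nonneg _) (hFc.abs.intervalIntegrable _ _))
  have h1 : c ^ 2 * T * (H ^ 2 * P) ≤ (c ^ 2 / 2 * T + 2 * Z.card * H * C₁) * (H ^ 2 * P) := by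
    calc c ^ 2 * T * (H ^ 2 * P) = (H * (c * T ^ (3 / 4 : ℝ))) ^ 2 := by
          rw [mul_pow, mul_pow, hpow]; ring
      _ ≤ (H * ∫ t in (T + H)..(2 * T - 1), |F t|) ^ 2 := by gcongr
      _ ≤ _ := main
      _ ≤ 2 * T * (c ^ 2 / 4 * (H ^ 2 * P)) + 2 * Z.card * H ^ 3 * (C₁ * P) := by
          have h2 : 2 * (2 * T - 1 - T) ≤ 2 * T := by linarith
          have h3 : ∫ t, (∫ x in t..(t + H), F x) ^ 2 ≤ c ^ 2 / 4 * (H ^ 2 * P) :=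
            hshort.trans (by gcongr)
          have h4 : 0 ≤ ∫ t, (∫ x in t..(t + H), F x) ^ 2 := integral_nonneg fun t => sq_nonneg _
          gcongr
      _ = _ := by ring
  have h5 := le_of_mul_le_mul_right h1 (by positivity)
  have h6 : c ^ 2 / (4 * C₁ * A) * (T * Real.log T) ≤ Z.card := by
    have h7 : c ^ 2 * T ≤ 4 * Z.card * H * C₁ := by linarith
    rw [hH, mul_div_assoc', div_mul_eq_mul_div, le_div_iff₀ hlog0] at h7
    rw [div_mul_eq_mul_div, div_le_iff₀ (by positivity)]
    linarith
  exact h6.trans (by exact_mod_cast hcard)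

end CriticalLine

end Selberg

namespace Selberg

open Complex Set MeasureTheory Filter Topology ComplexConjugate

section ZeroCount

theorem ncard_zeros_le_of_norm_le {f : ℂ → ℂ} {c : ℂ} {r R M : ℝ} (hr : 0 < r) (hrR : r < R)
    (hM : 1 ≤ M) (hf : AnalyticOnNhd ℂ f (Metric.closedBall c R)) (hc : f c ≠ 0)
    (hb : ∀ z ∈ Metric.sphere c R, ‖f z‖ ≤ M) {S : Set ℂ} (hS : S ⊆ Metric.closedBall c r)
    (hfin : S.Finite) (h0 : ∀ z ∈ S, f z = 0) :
    (S.ncard : ℝ) ≤ Real.log (M / ‖f c‖) / Real.log (R / r) := by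
  have hR : 0 < R := hr.trans hrR
  have hJ := AnalyticOnNhd.sum_divisor_le (r := r) (R := R) (M := M) (c := c) (f := f)
    (by simpa using hr.ne') (by rwa [abs_of_pos hr, abs_of_pos hR]) hM
    (by rwa [abs_of_pos hR]) hc (by rwa [abs_of_pos hR])
  rw [abs_of_pos hr] at hJ
  refine le_trans ?_ hJ
  have hfr : AnalyticOnNhd ℂ f (Metric.closedBall c r) :=
    hf.mono (Metric.closedBall_subset_closedBall hrR.le)
  set D := MeromorphicOn.divisor f (Metric.closedBall c r) with hD
  have hD0 : ∀ u, 0 ≤ D u := MeromorphicOn.AnalyticOnNhd.divisor_nonneg hfr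
  have hDfin : (Function.support D).Finite := D.finiteSupport (isCompact_closedBall c r)
  have hS1 : ∀ u ∈ S, 1 ≤ D u := fun u hu => by
    have hu' := hS hu
    have htop : analyticOrderAt f u ≠ ⊤ :=
      hfr.analyticOrderAt_ne_top_of_isPreconnected
        (convex_closedBall c r).isPreconnected (Metric.mem_closedBall_self hr.le) hu'
        (by rw [(hfr c (Metric.mem_closedBall_self hr.le)).analyticOrderAt_eq_zero.2 hc]; simp)
    have hne : analyticOrderAt f u ≠ 0 := (hfr u hu').analyticOrderAt_ne_zero.2 (h0 u hu)
    rw [hD, MeromorphicOn.AnalyticOnNhd.divisor_apply hfr hu']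
    lift analyticOrderAt f u to ℕ using htop with n
    have : n ≠ 0 := by exact_mod_cast hne
    change (1 : ℤ) ≤ n
    omega
  have hsum : (S.ncard : ℤ) ≤ ∑ᶠ u, D u := by
    rw [finsum_eq_sum_of_support_subset (s := hDfin.toFinset) _ (by simp),
      Set.ncard_eq_toFinset_card _ hfin]
    calc ((hfin.toFinset.card : ℕ) : ℤ) = ∑ u ∈ hfin.toFinset, 1 := by simp
      _ ≤ ∑ u ∈ hfin.toFinset, D u :=
          Finset.sum_le_sum fun u hu => hS1 u (hfin.mem_toFinset.1 hu)
      _ ≤ _ := Finset.sum_le_sum_of_subset_of_nonneg (fun u hu => hDfin.mem_toFinset.2 (by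
          have := hS1 u (hfin.mem_toFinset.1 hu)
          simp only [Function.mem_support]
          omega)) fun u _ _ => hD0 u
  exact_mod_cast hsum

theorem exists_ncard_zeros_right_le : ∃ C : ℝ, 0 < C ∧ ∀ k : ℕ, 8 ≤ k →
    ({ρ : ℂ | riemannZeta ρ = 0 ∧ 1 / 2 ≤ ρ.re ∧ ρ.re ≤ 1 ∧ k ≤ ρ.im ∧ ρ.im ≤ k + 1}.ncard : ℝ) ≤
      C * Real.log (k + 1) := by
  obtain ⟨C, hC1, hC⟩ := exists_norm_riemannZeta_le
  have hl0 : 0 < Real.log (5.75 / 5.6) := Real.log_pos (by norm_num)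
  refine ⟨(Real.log (8 * C) + 1) / Real.log (5.75 / 5.6),
    div_pos (add_pos_of_nonneg_of_pos (Real.log_nonneg (by linarith)) one_pos) hl0, fun k hk => ?_⟩
  have hk8 : (8 : ℝ) ≤ k := by exact_mod_cast hk
  set c : ℂ := ⟨6, k + 1 / 2⟩ with hc
  have hcne := norm_riemannZeta_sub_one_le (s := c) rfl
  have hcl : 1 / 2 ≤ ‖riemannZeta c‖ := by
    have := norm_sub_norm_le (1 : ℂ) (1 - riemannZeta c)
    rw [norm_one, sub_sub_cancel, norm_sub_rev] at this
    linarith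
  have hre : ∀ z : ℂ, ∀ R : ℝ, ‖z - c‖ ≤ R → |z.re - 6| ≤ R ∧ |z.im - (k + 1 / 2)| ≤ R :=
    fun z R h => ⟨(abs_re_le_norm (z - c)).trans h, (abs_im_le_norm (z - c)).trans h⟩
  have hM : 1 ≤ C * (4 * (k + 1)) := by nlinarith
  have := ncard_zeros_le_of_norm_le (f := riemannZeta) (c := c) (r := 5.6) (R := 5.75)
    (by norm_num) (by norm_num) hM (S := {ρ : ℂ | riemannZeta ρ = 0 ∧ 1 / 2 ≤ ρ.re ∧ ρ.re ≤ 1 ∧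
      k ≤ ρ.im ∧ ρ.im ≤ k + 1}) ?_ (norm_pos_iff.1 (by linarith)) ?_ ?_ ?_ fun z hz => hz.1
  · refine this.trans ?_
    rw [div_mul_eq_mul_div]
    gcongr
    have hk1 : 1 ≤ Real.log (k + 1) := by
      rw [Real.le_log_iff_exp_le (by linarith)]
      exact Real.exp_one_lt_d9.le.trans (by linarith)
    have hlog8 : 0 ≤ Real.log (8 * C) := Real.log_nonneg (by linarith)
    calc Real.log (C * (4 * (k + 1)) / ‖riemannZeta c‖) ≤ Real.log (8 * C * (k + 1)) := by
          refine Real.log_le_log (by positivity) ?_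
          rw [div_le_iff₀ (by linarith)]
          have : 0 < C * (k + 1) := by positivity
          nlinarith
      _ = Real.log (8 * C) + Real.log (k + 1) := Real.log_mul (by positivity) (by positivity)
      _ ≤ (Real.log (8 * C) + 1) * Real.log (k + 1) := by nlinarith
  · intro z hz
    obtain ⟨-, h2⟩ := hre z _ (mem_closedBall_iff_norm.1 hz)
    rw [abs_le] at h2
    have hz1 : z ≠ 1 := fun h => by rw [h, one_im] at h2; linarith [h2.1]
    have hU : IsOpen ({1}ᶜ : Set ℂ) := isOpen_compl_singleton
    exact (DifferentiableOn.analyticOnNhd (fun w hw =>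
      (differentiableAt_riemannZeta hw).differentiableWithinAt) hU) z hz1
  · intro z hz
    obtain ⟨h1, h2⟩ := hre z _ (mem_sphere_iff_norm.1 hz).le
    rw [abs_le] at h1 h2
    refine (hC 1 zero_le_one le_rfl z (by linarith) (by linarith) (by linarith)).trans ?_
    rw [Real.rpow_one]
    gcongr
    refine (norm_le_abs_re_add_abs_im z).trans ?_
    rw [abs_of_nonneg (by linarith), abs_of_nonneg (by linarith)]
    linarith
  · rintro z ⟨-, h1, h2, h3, h4⟩
    rw [mem_closedBall_iff_norm]
    refine abs_le_of_sq_le_sq' ?_ (by norm_num) |>.2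
    rw [← normSq_eq_norm_sq, normSq_apply, sub_re, sub_im]
    simp only [hc]
    nlinarith
  · exact (finite_zeros (a := 1 / 2) (b := 1) (k + 1)).subset fun z hz =>
      ⟨hz.1, hz.2.1, hz.2.2.1, by linarith [hz.2.2.2.1], hz.2.2.2.2⟩

theorem riemannZeta_one_sub_conj_eq_zero {s : ℂ} (h : riemannZeta s = 0) (h0 : 0 < s.re)
    (hi : s.im ≠ 0) : riemannZeta (1 - conj s) = 0 := by
  have h1 : riemannZeta (conj s) = 0 := by rw [riemannZeta_conj, h, map_zero]
  rw [riemannZeta_one_sub, h1, mul_zero]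
  · intro n hn
    have := congrArg re hn
    simp at this
    have : (0 : ℝ) ≤ n := by positivity
    linarith
  · intro hn
    have := congrArg im hn
    simp at this
    exact hi this

theorem ncard_zeros_le_two_mul (a : ℝ) (ha : 0 < a) (b : ℝ) :
    {ρ : ℂ | riemannZeta ρ = 0 ∧ 0 < ρ.re ∧ ρ.re < 1 ∧ a ≤ ρ.im ∧ ρ.im ≤ b}.ncard ≤
      2 * {ρ : ℂ | riemannZeta ρ = 0 ∧ 1 / 2 ≤ ρ.re ∧ ρ.re ≤ 1 ∧ a ≤ ρ.im ∧ ρ.im ≤ b}.ncard := by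
  set A := {ρ : ℂ | riemannZeta ρ = 0 ∧ 1 / 2 ≤ ρ.re ∧ ρ.re ≤ 1 ∧ a ≤ ρ.im ∧ ρ.im ≤ b} with hA
  have hfin : A.Finite := (finite_zeros (a := 1 / 2) (b := 1) b).subset fun z hz =>
    ⟨hz.1, hz.2.1, hz.2.2.1, ha.le.trans hz.2.2.2.1, hz.2.2.2.2⟩
  have hsub : {ρ : ℂ | riemannZeta ρ = 0 ∧ 0 < ρ.re ∧ ρ.re < 1 ∧ a ≤ ρ.im ∧ ρ.im ≤ b} ⊆
      A ∪ (fun z => 1 - conj z) '' A := by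
    rintro z ⟨h0, h1, h2, h3, h4⟩
    rcases le_or_gt (1 / 2) z.re with h | h
    · exact Or.inl ⟨h0, h, h2.le, h3, h4⟩
    · refine Or.inr ⟨1 - conj z, ⟨riemannZeta_one_sub_conj_eq_zero h0 h1 (by linarith), ?_, ?_, ?_, ?_⟩,
        by simp⟩ <;> simp <;> linarith
  refine (Set.ncard_le_ncard hsub (hfin.union (hfin.image _))).trans ?_
  refine (Set.ncard_union_le _ _).trans ?_
  have := Set.ncard_image_le (f := fun z => 1 - conj z) hfin
  omega

theorem exists_ncard_zeros_le : ∃ C : ℝ, 0 < C ∧ ∀ᶠ T : ℝ in atTop,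
    ({ρ : ℂ | riemannZeta ρ = 0 ∧ 0 < ρ.re ∧ ρ.re < 1 ∧ 0 < ρ.im ∧ ρ.im ≤ T}.ncard : ℝ) ≤
      C * (T * Real.log T) := by
  obtain ⟨C, hC0, hC⟩ := exists_ncard_zeros_right_le
  set A := {ρ : ℂ | riemannZeta ρ = 0 ∧ 0 ≤ ρ.re ∧ ρ.re ≤ 1 ∧ 0 ≤ ρ.im ∧ ρ.im ≤ 8} with hA
  have hAfin : A.Finite := finite_zeros 8
  refine ⟨A.ncard + 8 * C, by positivity, ?_⟩
  filter_upwards [eventually_ge_atTop 8] with T hT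
  set n := ⌊T⌋₊ with hn
  have hnT : (n : ℝ) ≤ T := Nat.floor_le (by linarith)
  set B : ℕ → Set ℂ := fun k =>
    {ρ : ℂ | riemannZeta ρ = 0 ∧ 0 < ρ.re ∧ ρ.re < 1 ∧ (k : ℝ) ≤ ρ.im ∧ ρ.im ≤ k + 1} with hB
  have hsub : {ρ : ℂ | riemannZeta ρ = 0 ∧ 0 < ρ.re ∧ ρ.re < 1 ∧ 0 < ρ.im ∧ ρ.im ≤ T} ⊆
      A ∪ ⋃ k ∈ Finset.Icc 8 n, B k := by
    rintro z ⟨h0, h1, h2, h3, h4⟩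
    rcases le_or_gt z.im 8 with h | h
    · exact Or.inl ⟨h0, h1.le, h2.le, h3.le, h⟩
    · refine Or.inr (mem_iUnion₂.2 ⟨⌊z.im⌋₊, Finset.mem_Icc.2 ⟨Nat.le_floor (by exact_mod_cast h.le),
        Nat.floor_mono h4⟩, h0, h1, h2, Nat.floor_le h3.le, (Nat.lt_floor_add_one _).le⟩)
  have hlogT : 1 ≤ Real.log T := by
    rw [Real.le_log_iff_exp_le (by linarith)]
    exact Real.exp_one_lt_d9.le.trans (by linarith)
  have hBk : ∀ k ∈ Finset.Icc 8 n, ((B k).ncard : ℝ) ≤ 4 * C * Real.log T := fun k hk => by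
    obtain ⟨hk8, hkn⟩ := Finset.mem_Icc.1 hk
    have hk0 : (0 : ℝ) < k := by exact_mod_cast (by omega : 0 < k)
    have hkT : (k : ℝ) ≤ T := (Nat.cast_le.2 hkn).trans hnT
    have h1 : ((B k).ncard : ℝ) ≤ 2 * (C * Real.log (k + 1)) :=
      (Nat.cast_le.2 (ncard_zeros_le_two_mul k hk0 (k + 1))).trans (by
        push_cast
        exact mul_le_mul_of_nonneg_left (hC k hk8) zero_le_two)
    have h2 : Real.log (k + 1) ≤ 2 * Real.log T := by
      calc Real.log (k + 1) ≤ Real.log (T ^ 2) :=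
            Real.log_le_log (by positivity) (by nlinarith)
        _ = 2 * Real.log T := by rw [Real.log_pow]; norm_num
    nlinarith
  have hBfin : ∀ k, (B k).Finite := fun k => (finite_zeros (a := 0) (b := 1) (k + 1)).subset
    fun z hz => ⟨hz.1, hz.2.1.le, hz.2.2.1.le, k.cast_nonneg.trans hz.2.2.2.1, hz.2.2.2.2⟩
  have hcard := (Set.ncard_le_ncard hsub
    (hAfin.union ((Finset.Icc 8 n).finite_toSet.biUnion fun k _ => hBfin k))).trans
    ((Set.ncard_union_le _ _).trans
      (Nat.add_le_add_left (Finset.set_ncard_biUnion_le (Finset.Icc 8 n) B) _))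
  have hsum : ∑ k ∈ Finset.Icc 8 n, ((B k).ncard : ℝ) ≤ T * (4 * C * Real.log T) := by
    refine (Finset.sum_le_card_nsmul _ _ _ hBk).trans ?_
    rw [nsmul_eq_mul, Nat.card_Icc]
    gcongr
    exact (Nat.cast_le.2 (by omega : n + 1 - 8 ≤ n)).trans hnT
  have hfinal : ({ρ : ℂ | riemannZeta ρ = 0 ∧ 0 < ρ.re ∧ ρ.re < 1 ∧ 0 < ρ.im ∧
      ρ.im ≤ T}.ncard : ℝ) ≤ A.ncard + ∑ k ∈ Finset.Icc 8 n, ((B k).ncard : ℝ) := by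
    exact_mod_cast hcard
  have hTl : 1 ≤ T * Real.log T := by nlinarith
  have hA0 : (0 : ℝ) ≤ A.ncard := by positivity
  have h1 : (A.ncard : ℝ) ≤ A.ncard * (T * Real.log T) := le_mul_of_one_le_right hA0 hTl
  have h2 : 0 < C * (T * Real.log T) := by positivity
  nlinarith

end ZeroCount

end Selberg

/-- Selberg's theorem: a positive proportion of the nontrivial zeros of the Riemann
zeta function lie on the critical line. -/
theorem positive_proportion_of_zeros_on_critical_line :
    ∃ κ : ℝ, 0 < κ ∧ ∃ T₀ : ℝ, ∀ T : ℝ, T₀ ≤ T →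
      κ * (zetaZeros T : ℝ) ≤ (zetaZerosOnLine T : ℝ) := by
  obtain ⟨c, hc, hlow⟩ := Selberg.exists_zeros_on_line_ge
  obtain ⟨C, hC, hup⟩ := Selberg.exists_ncard_zeros_le
  have hhalf : Filter.Tendsto (fun T : ℝ => T / 2) Filter.atTop Filter.atTop :=
    Filter.tendsto_id.atTop_div_const two_pos
  obtain ⟨T₀, hT₀⟩ := Filter.eventually_atTop.1
    ((hhalf.eventually hlow).and (hup.and (Filter.eventually_ge_atTop 4)))
  refine ⟨c / (4 * C), by positivity, T₀, fun T hT => ?_⟩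
  obtain ⟨h1, h2, h4⟩ := hT₀ T hT
  rw [mul_div_cancel₀ T two_ne_zero] at h1
  have hlog : Real.log T ≤ 2 * Real.log (T / 2) := by
    calc Real.log T ≤ Real.log ((T / 2) ^ 2) := Real.log_le_log (by linarith) (by nlinarith)
      _ = 2 * Real.log (T / 2) := by rw [Real.log_pow]; norm_num
  calc c / (4 * C) * (zetaZeros T : ℝ) ≤ c / (4 * C) * (C * (T * Real.log T)) := by
        gcongr
        exact h2
    _ = c / 4 * (T * Real.log T) := by field_simp
    _ ≤ c / 4 * (T * (2 * Real.log (T / 2))) := by gcongr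
    _ = c * (T / 2 * Real.log (T / 2)) := by ring
    _ ≤ _ := h1
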